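/- Let f be a subpolynomial function belonging to some Hardy field. Suppose f is of type x^{0+} and that lim_{x→∞} |f(x)/log x| = ∞ and lim_{x→∞} x·|f'(x)| = ∞. Then the sequence (f(p_n))_{n∈ℕ} is uniformly distributed mod 1, where p_n is the n-th prime. -/

import Mathlib

open Filter Topology MeasureTheory
open scoped Pointwise

noncomputable section

/-- The germ of a real function at `+∞`. -/
def germAtTop (f : ℝ → ℝ) : Filter.Germ (Filter.atTop : Filter ℝ) ℝ := ↑f

/-- A Hardy field: a subring of the ring of germs at `+∞` of real-valued functions
which is a field and is closed under differentiation. -/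
def IsHardyField (H : Subring (Filter.Germ (Filter.atTop : Filter ℝ) ℝ)) : Prop :=
  (∀ g ∈ H, g ≠ 0 → ∃ h ∈ H, g * h = 1) ∧
  (∀ g ∈ H, ∃ f : ℝ → ℝ, germAtTop f = g ∧
    (∀ᶠ x in Filter.atTop, DifferentiableAt ℝ f x) ∧ germAtTop (deriv f) ∈ H)

/-- A function is subpolynomial if it is eventually dominated by some power `x ^ n`. -/
def Subpolynomial (f : ℝ → ℝ) : Prop := ∃ n : ℕ, ∀ᶠ x in Filter.atTop, |f x| < x ^ n

open scoped Classical in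
/-- A sequence of reals is uniformly distributed mod 1. -/
def UDMod1 (a : ℕ → ℝ) : Prop :=
  ∀ α β : ℝ, 0 ≤ α → α ≤ β → β ≤ 1 →
    Filter.Tendsto
      (fun N : ℕ =>
        (((Finset.range N).filter fun n => Int.fract (a n) ∈ Set.Icc α β).card : ℝ) / N)
      Filter.atTop (nhds (β - α))

open scoped Classical in
/-- A sequence of points of the `d`-torus is uniformly distributed mod 1. -/
def UDMod1Vec {d : ℕ} (a : ℕ → Fin d → ℝ) : Prop :=
  ∀ α β : Fin d → ℝ, (∀ i, 0 ≤ α i) → (∀ i, α i ≤ β i) → (∀ i, β i ≤ 1) →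
    Filter.Tendsto
      (fun N : ℕ =>
        (((Finset.range N).filter fun n =>
            ∀ i, Int.fract (a n i) ∈ Set.Icc (α i) (β i)).card : ℝ) / N)
      Filter.atTop (nhds (∏ i, (β i - α i)))

/-- The `n`-th prime (indexed from `0`, so `nthPrime 0 = 2`). -/
def nthPrime (n : ℕ) : ℕ := Nat.nth Nat.Prime n

/-- `e x = exp (2 π i x)`. -/
def e (x : ℝ) : ℂ := Complex.exp (2 * Real.pi * Complex.I * x)

/-- `f` is of type `x^{l+}`: `x^l / f x → 0` and `f x / x^(l+1) → 0` as `x → ∞`. -/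
def TypeXPow (f : ℝ → ℝ) (l : ℕ) : Prop :=
  Filter.Tendsto (fun x : ℝ => x ^ l / f x) Filter.atTop (nhds 0) ∧
  Filter.Tendsto (fun x : ℝ => f x / x ^ (l + 1)) Filter.atTop (nhds 0)

/-- Membership in the class `𝐇` attached to a Hardy field `H`: a subpolynomial member of `H`
which either is of type `x^{l+}` for some `l ≥ 1`, or satisfies
`ξ x / x → 0` and `log x / ξ x → 0`. -/
def MemBoldH (H : Subring (Filter.Germ (Filter.atTop : Filter ℝ) ℝ)) (ξ : ℝ → ℝ) : Prop :=
  germAtTop ξ ∈ H ∧ Subpolynomial ξ ∧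
  ((∃ l : ℕ, 1 ≤ l ∧
      Filter.Tendsto (fun x : ℝ => ξ x / x ^ (l + 1)) Filter.atTop (nhds 0) ∧
      Filter.Tendsto (fun x : ℝ => x ^ l / ξ x) Filter.atTop (nhds 0)) ∨
    (Filter.Tendsto (fun x : ℝ => ξ x / x) Filter.atTop (nhds 0) ∧
      Filter.Tendsto (fun x : ℝ => Real.log x / ξ x) Filter.atTop (nhds 0)))

/-- The upper Banach density of a subset of `ℤ^m`. -/
def upperBanachDensity {m : ℕ} (E : Set (Fin m → ℤ)) : ℝ :=
  sSup { d : ℝ | ∃ a b : ℕ → Fin m → ℤ,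
    (∀ i, Filter.Tendsto (fun n => b n i - a n i) Filter.atTop Filter.atTop) ∧
    d = Filter.limsup (fun n : ℕ =>
        (Nat.card ↥(E ∩ Set.pi Set.univ fun i => Set.Icc (a n i) (b n i)) : ℝ) /
        (Nat.card ↥(Set.pi Set.univ fun i : Fin m => Set.Icc (a n i) (b n i)) : ℝ))
      Filter.atTop }

/-- The Fourier transform of a measure on the `m`-torus, evaluated at `d ∈ ℤ^m`. -/
def measureFourier {m : ℕ} (σ : Measure (Fin m → AddCircle (1 : ℝ))) (d : Fin m → ℤ) : ℂ :=
  ∫ γ, (∏ i, fourier (d i) (γ i)) ∂σ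

/-- The filter `|d| → ∞, d ∈ D` on `ℤ^m`, where `|d| = max |d_i|`. -/
def alongD {m : ℕ} (D : Set (Fin m → ℤ)) : Filter (Fin m → ℤ) :=
  (Filter.atTop.comap fun d : Fin m → ℤ => Finset.univ.sup fun i => (d i).natAbs) ⊓
    Filter.principal D

/-- A nice `FC⁺` set in `ℤ^m`. -/
def IsNiceFCPlus {m : ℕ} (D : Set (Fin m → ℤ)) : Prop :=
  D.Infinite ∧
  ∀ σ : Measure (Fin m → AddCircle (1 : ℝ)), IsFiniteMeasure σ →
    (σ {0}).toReal ≤ Filter.limsup (fun d => ‖measureFourier σ d‖) (alongD D)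


namespace UDP

/-! ### Part 1a: growth of the zeta function near the line `Re s = 1` -/

/-- Summand in the series for `(s-1) ζ(s)`. -/
def zT (a : ℝ) (s : ℂ) : ℂ :=
  (s - 1) * (a : ℂ) ^ (-s) + (((a + 1 : ℝ) : ℂ) ^ (1 - s) - (a : ℂ) ^ (1 - s))

lemma hasDerivAt_shift_cpow (a : ℝ) (ha : 0 < a) (r : ℂ) (u : ℝ) (hu : 0 ≤ u) :
    HasDerivAt (fun u : ℝ => ((a + u : ℝ) : ℂ) ^ r) (r * ((a + u : ℝ) : ℂ) ^ (r - 1)) u := by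
  have h1 : HasDerivAt (fun z : ℂ => ((a : ℂ) + z) ^ r) (r * ((a : ℂ) + (u : ℂ)) ^ (r - 1) * 1)
      (u : ℂ) := by
    apply HasDerivAt.cpow_const
    · exact (hasDerivAt_id _).const_add _
    · rw [← Complex.ofReal_add, Complex.ofReal_mem_slitPlane]; linarith
  have h2 := h1.comp_ofReal
  simpa using h2

lemma norm_shift_cpow (a : ℝ) (ha : 0 < a) (r : ℂ) : ‖(a : ℂ) ^ r‖ = a ^ r.re :=
  Complex.norm_cpow_eq_rpow_re_of_pos ha r

lemma norm_shift_cpow_le (a : ℝ) (ha : 0 < a) (r : ℂ) (hr : r.re ≤ 0) (u : ℝ) (hu : 0 ≤ u) :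
    ‖((a + u : ℝ) : ℂ) ^ r‖ ≤ a ^ r.re := by
  rw [norm_shift_cpow _ (by linarith)]
  exact Real.rpow_le_rpow_of_nonpos ha (by linarith) hr

lemma norm_cpow_diff_le (a : ℝ) (ha : 0 < a) (s : ℂ) (hs : 0 ≤ s.re) (u : ℝ) (hu : 0 ≤ u)
    (hu1 : u ≤ 1) : ‖(a : ℂ) ^ (-s) - ((a + u : ℝ) : ℂ) ^ (-s)‖ ≤ ‖s‖ * a ^ (-s.re - 1) := by
  have h := Convex.norm_image_sub_le_of_norm_hasDerivWithin_le
    (f := fun u : ℝ => ((a + u : ℝ) : ℂ) ^ (-s))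
    (f' := fun u : ℝ => (-s) * ((a + u : ℝ) : ℂ) ^ (-s - 1)) (s := Set.Icc (0:ℝ) 1)
    (x := 0) (y := u) (C := ‖s‖ * a ^ (-s.re - 1))
    (fun x hx => (hasDerivAt_shift_cpow a ha _ x hx.1).hasDerivWithinAt) ?_ (convex_Icc _ _)
    ⟨le_rfl, zero_le_one⟩ ⟨hu, hu1⟩
  · rw [norm_sub_rev]
    have h3 : ‖u - 0‖ ≤ 1 := by rw [sub_zero, Real.norm_eq_abs, abs_of_nonneg hu]; exact hu1
    calc _ ≤ _ := by simpa using h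
      _ ≤ ‖s‖ * a ^ (-s.re - 1) * 1 := by
        have : |u| ≤ 1 := by simpa using h3
        gcongr
      _ = _ := mul_one _
  · intro x hx
    rw [norm_mul, norm_neg]
    gcongr
    have := norm_shift_cpow_le a ha (-s - 1) (by simp; linarith) x hx.1
    simpa using this

lemma norm_zT_le_of (a : ℝ) (ha : 0 < a) (s : ℂ) (B : ℝ)
    (hB : ∀ u : ℝ, 0 ≤ u → u ≤ 1 → ‖(a : ℂ) ^ (-s) - ((a + u : ℝ) : ℂ) ^ (-s)‖ ≤ B) :
    ‖zT a s‖ ≤ ‖s - 1‖ * B := by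
  have h := Convex.norm_image_sub_le_of_norm_hasDerivWithin_le
    (f := fun u : ℝ => (s - 1) * (a : ℂ) ^ (-s) * (u : ℂ) + ((a + u : ℝ) : ℂ) ^ (1 - s))
    (f' := fun u : ℝ => (s - 1) * ((a : ℂ) ^ (-s) - ((a + u : ℝ) : ℂ) ^ (-s)))
    (s := Set.Icc (0:ℝ) 1)
    (x := 0) (y := 1) (C := ‖s - 1‖ * B) ?_ ?_ (convex_Icc _ _)
    ⟨le_rfl, zero_le_one⟩ ⟨zero_le_one, le_rfl⟩
  · have e1 : zT a s = ((s - 1) * (a : ℂ) ^ (-s) * ((1:ℝ) : ℂ) + ((a + 1 : ℝ) : ℂ) ^ (1 - s)) -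
        ((s - 1) * (a : ℂ) ^ (-s) * ((0:ℝ) : ℂ) + ((a + 0 : ℝ) : ℂ) ^ (1 - s)) := by
      simp only [zT, add_zero]; push_cast; ring
    rw [e1]
    simpa using h
  · intro x hx
    have h1 := hasDerivAt_shift_cpow a ha (1 - s) x hx.1
    have h2 : HasDerivAt (fun u : ℝ => (s - 1) * (a : ℂ) ^ (-s) * (u : ℂ))
        ((s - 1) * (a : ℂ) ^ (-s) * 1) x :=
      (hasDerivAt_id (x : ℂ)).comp_ofReal.const_mul _
    have h3 := (h2.add h1).hasDerivWithinAt (s := Set.Icc (0:ℝ) 1)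
    refine h3.congr_deriv ?_
    rw [show (1 - s - 1) = -s by ring]; ring
  · intro x hx
    rw [norm_mul]
    gcongr
    exact hB x hx.1 hx.2

lemma norm_zT_le (a : ℝ) (ha : 1 ≤ a) (s : ℂ) (hs : 0 ≤ s.re) (θ : ℝ) (hθ0 : 0 ≤ θ)
    (hθ1 : θ ≤ 1) : ‖zT a s‖ ≤ ‖s - 1‖ * (2 * ‖s‖ ^ θ * a ^ (-s.re - θ)) := by
  have ha0 : 0 < a := by linarith
  apply norm_zT_le_of a ha0
  intro u hu hu1
  have e1 : 2 * ‖s‖ ^ θ * a ^ (-s.re - θ) = 2 * (‖s‖ / a) ^ θ * a ^ (-s.re) := by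
    rw [Real.div_rpow (norm_nonneg _) ha0.le, Real.rpow_sub ha0]; field_simp
  rw [e1]
  have hp : 0 < a ^ (-s.re) := Real.rpow_pos_of_pos ha0 _
  rcases le_total ‖s‖ a with h | h
  · refine (norm_cpow_diff_le a ha0 s hs u hu hu1).trans ?_
    have e2 : a ^ (-s.re - 1) = a ^ (-s.re) / a := by rw [Real.rpow_sub ha0, Real.rpow_one]
    have h3 : ‖s‖ / a ≤ (‖s‖ / a) ^ θ := by
      rcases (norm_nonneg s).eq_or_lt with h0 | h0
      · rw [← h0]; simp only [zero_div]; positivity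
      · calc ‖s‖ / a = (‖s‖ / a) ^ (1:ℝ) := (Real.rpow_one _).symm
          _ ≤ _ := Real.rpow_le_rpow_of_exponent_ge (by positivity) ((div_le_one ha0).2 h) hθ1
    have h4 : 0 ≤ ‖s‖ / a := by positivity
    rw [e2, show ‖s‖ * (a ^ (-s.re) / a) = (‖s‖ / a) * a ^ (-s.re) by ring]
    gcongr
    linarith
  · have h3 : 1 ≤ (‖s‖ / a) ^ θ := Real.one_le_rpow ((one_le_div ha0).2 h) hθ0
    calc _ ≤ ‖(a : ℂ) ^ (-s)‖ + ‖((a + u : ℝ) : ℂ) ^ (-s)‖ := norm_sub_le _ _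
      _ ≤ a ^ (-s.re) + a ^ (-s.re) := by
        gcongr
        · rw [norm_shift_cpow a ha0]; simp
        · simpa using norm_shift_cpow_le a ha0 (-s) (by simpa using hs) u hu
      _ = 2 * 1 * a ^ (-s.re) := by ring
      _ ≤ _ := by gcongr

lemma summable_rpow_shift (p : ℝ) (hp : 1 < p) : Summable (fun n : ℕ => ((n : ℝ) + 1) ^ (-p)) := by
  have := (summable_nat_add_iff 1).2 (Real.summable_nat_rpow.2 (by linarith : -p < -1))
  simpa using this

lemma differentiable_zT (a : ℝ) (ha : 0 < a) : Differentiable ℂ (zT a) := by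
  unfold zT
  have h1 : (a : ℂ) ≠ 0 := by exact_mod_cast ha.ne'
  have h2 : ((a + 1 : ℝ) : ℂ) ≠ 0 := by
    have : a + 1 ≠ 0 := by linarith
    exact_mod_cast this
  intro s
  refine DifferentiableAt.add (DifferentiableAt.mul (by fun_prop) ?_) (DifferentiableAt.sub ?_ ?_)
  · exact DifferentiableAt.const_cpow (by fun_prop) (Or.inl h1)
  · exact DifferentiableAt.const_cpow (by fun_prop) (Or.inl h2)
  · exact DifferentiableAt.const_cpow (by fun_prop) (Or.inl h1)

lemma summable_zT (s : ℂ) (hs : 0 < s.re) : Summable (fun n : ℕ => zT ((n : ℝ) + 1) s) := by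
  apply Summable.of_norm_bounded (g := fun n : ℕ =>
    ‖s - 1‖ * (2 * ‖s‖ ^ (1:ℝ) * ((n : ℝ) + 1) ^ (-s.re - 1)))
  · apply Summable.mul_left
    apply Summable.mul_left
    have := summable_rpow_shift (s.re + 1) (by linarith)
    refine this.congr fun n => ?_
    congr 1; ring
  · intro n
    exact norm_zT_le _ (by have : (0:ℝ) ≤ n := Nat.cast_nonneg n; linarith) s hs.le 1 zero_le_one le_rfl

lemma differentiableOn_tsum_zT :
    DifferentiableOn ℂ (fun s => ∑' n : ℕ, zT ((n : ℝ) + 1) s) {s : ℂ | 0 < s.re} := by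
  intro s hs
  have hs : 0 < s.re := hs
  set U : Set ℂ := {z : ℂ | s.re / 2 < z.re} ∩ Metric.ball 0 (‖s‖ + 1) with hU
  have hUo : IsOpen U := (isOpen_lt continuous_const Complex.continuous_re).inter Metric.isOpen_ball
  have hsU : s ∈ U := ⟨by change s.re / 2 < s.re; linarith, by simp⟩
  have := Complex.differentiableOn_tsum_of_summable_norm (F := fun (n : ℕ) (s : ℂ) => zT ((n : ℝ) + 1) s)
    (U := U) (u := fun n : ℕ => (‖s‖ + 2) * (2 * (‖s‖ + 1) * ((n : ℝ) + 1) ^ (-(s.re/2 + 1)))) ?_ ?_ hUo ?_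
  · exact ((this s hsU).differentiableAt (hUo.mem_nhds hsU)).differentiableWithinAt
  · exact ((summable_rpow_shift _ (by linarith)).mul_left _).mul_left _
  · intro n
    exact (differentiable_zT _ (by positivity)).differentiableOn
  · intro n w hw
    have hw1 : s.re / 2 < w.re := hw.1
    have hw2 : ‖w‖ < ‖s‖ + 1 := by simpa using hw.2
    have hn : (1:ℝ) ≤ (n:ℝ) + 1 := by have : (0:ℝ) ≤ n := Nat.cast_nonneg n; linarith
    refine (norm_zT_le _ hn w (by linarith) 1 zero_le_one le_rfl).trans ?_
    rw [Real.rpow_one]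
    have : ‖w - 1‖ ≤ ‖s‖ + 2 := (norm_sub_le _ _).trans (by simp; linarith)
    gcongr
    linarith

lemma zeta1_eq_of_one_lt (s : ℂ) (hs : 1 < s.re) :
    riemannZeta₁ s = 1 + ∑' n : ℕ, zT ((n : ℝ) + 1) s := by
  have hs1 : s ≠ 1 := by rintro rfl; simp at hs
  have hz : riemannZeta₁ s = (s - 1) * riemannZeta s := by
    rw [riemannZeta_eq_inv_sub_mul hs1, ← mul_assoc, mul_inv_cancel₀ (sub_ne_zero.2 hs1), one_mul]
  have h1 : HasSum (fun n : ℕ => (s - 1) * (((n : ℝ) + 1 : ℝ) : ℂ) ^ (-s)) ((s - 1) * riemannZeta s) := by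
    apply HasSum.mul_left
    rw [zeta_eq_tsum_one_div_nat_add_one_cpow hs]
    have : Summable (fun n : ℕ => 1 / ((n : ℂ) + 1) ^ s) := by
      have := (summable_nat_add_iff 1).2 (Complex.summable_one_div_nat_cpow.2 hs)
      simpa using this
    have e : (fun n : ℕ => (((n : ℝ) + 1 : ℝ) : ℂ) ^ (-s)) = fun n : ℕ => 1 / ((n : ℂ) + 1) ^ s := by
      funext n
      push_cast
      rw [Complex.cpow_neg, one_div]
    rw [e]
    exact this.hasSum
  have h2 : HasSum (fun n : ℕ => ((((n : ℝ) + 1 + 1 : ℝ) : ℂ) ^ (1 - s) - (((n : ℝ) + 1 : ℝ) : ℂ) ^ (1 - s))) (-1) := by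
    have hT : Tendsto (fun n : ℕ => (((n : ℝ) + 1 : ℝ) : ℂ) ^ (1 - s)) atTop (𝓝 0) := by
      rw [tendsto_zero_iff_norm_tendsto_zero]
      have h3 : Tendsto (fun n : ℕ => ((n:ℝ) + 1) ^ (-(s.re - 1))) atTop (𝓝 0) :=
        (tendsto_rpow_neg_atTop (by linarith)).comp
          (tendsto_atTop_add_const_right _ _ tendsto_natCast_atTop_atTop)
      refine h3.congr fun n => ?_
      rw [norm_shift_cpow _ (by positivity)]
      simp
    have hsum : Summable (fun n : ℕ => ((((n : ℝ) + 1 + 1 : ℝ) : ℂ) ^ (1 - s) - (((n : ℝ) + 1 : ℝ) : ℂ) ^ (1 - s))) := by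
      have := (summable_zT s (by linarith)).sub h1.summable
      refine this.congr fun n => ?_
      simp only [zT]; ring
    rw [hsum.hasSum_iff_tendsto_nat]
    have : ∀ n : ℕ, ∑ i ∈ Finset.range n, ((((i : ℝ) + 1 + 1 : ℝ) : ℂ) ^ (1 - s) - (((i : ℝ) + 1 : ℝ) : ℂ) ^ (1 - s))
        = (((n : ℝ) + 1 : ℝ) : ℂ) ^ (1 - s) - 1 := by
      intro n
      have := Finset.sum_range_sub (fun i : ℕ => (((i : ℝ) + 1 : ℝ) : ℂ) ^ (1 - s)) n
      simp at this ⊢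
      exact this
    simp_rw [this]
    simpa using hT.sub_const 1
  have h3 := (h1.add h2).tsum_eq
  rw [hz]
  have h4 : ∑' n : ℕ, zT ((n : ℝ) + 1) s = (s - 1) * riemannZeta s + -1 := by
    rw [← h3]; rfl
  rw [h4]; ring

lemma zeta1_eq (s : ℂ) (hs : 0 < s.re) :
    riemannZeta₁ s = 1 + ∑' n : ℕ, zT ((n : ℝ) + 1) s := by
  have hopen : IsOpen {s : ℂ | 0 < s.re} := isOpen_lt continuous_const Complex.continuous_re
  have hconv : Convex ℝ {s : ℂ | 0 < s.re} := convex_halfSpace_re_gt 0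
  have h1 : AnalyticOnNhd ℂ riemannZeta₁ {s : ℂ | 0 < s.re} :=
    (differentiable_riemannZeta₁.differentiableOn).analyticOnNhd hopen
  have h2 : AnalyticOnNhd ℂ (fun s => 1 + ∑' n : ℕ, zT ((n : ℝ) + 1) s) {s : ℂ | 0 < s.re} :=
    (differentiableOn_tsum_zT.const_add 1).analyticOnNhd hopen
  refine h1.eqOn_of_preconnected_of_eventuallyEq h2 hconv.isPreconnected (z₀ := 2) (by simp) ?_ hs
  have : {s : ℂ | 1 < s.re} ∈ 𝓝 (2 : ℂ) :=
    (isOpen_lt continuous_const Complex.continuous_re).mem_nhds (by simp)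
  filter_upwards [this] with s hs
  exact zeta1_eq_of_one_lt s hs

/-- Growth of `ζ` to the right of `1 - ε`. -/
lemma zeta_growth (ε : ℝ) (hε : 0 < ε) (hε1 : ε ≤ 1 / 4) : ∃ C : ℝ, 1 ≤ C ∧ ∀ s : ℂ, 1 - ε ≤ s.re →
    s.re ≤ 3 → 1 / 2 ≤ |s.im| → ‖riemannZeta s‖ ≤ C * |s.im| ^ (2 * ε) := by
  set B : ℝ := ∑' n : ℕ, ((n : ℝ) + 1) ^ (-(1 + ε)) with hB
  have hBs := summable_rpow_shift (1 + ε) (by linarith)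
  have hB0 : 0 ≤ B := tsum_nonneg fun n => by positivity
  refine ⟨(2 + 2 * B) * 7 ^ (2 * ε) * 2 ^ (2 * ε), ?_, ?_⟩
  · have : (1:ℝ) ≤ 7 ^ (2 * ε) := Real.one_le_rpow (by norm_num) (by linarith)
    have h2 : (1:ℝ) ≤ 2 ^ (2 * ε) := Real.one_le_rpow (by norm_num) (by linarith)
    have h3 : (1:ℝ) ≤ 2 + 2 * B := by linarith
    calc (1:ℝ) = 1 * 1 * 1 := by norm_num
      _ ≤ _ := by gcongr
  intro s hs hs3 ht
  have hs1 : s ≠ 1 := by rintro rfl; norm_num at ht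
  have hn1 : 1 / 2 ≤ ‖s - 1‖ := by
    refine ht.trans ?_
    have := Complex.abs_im_le_norm (s - 1)
    simpa using this
  have hnorm : ‖s‖ ≤ 7 * |s.im| := by
    refine (Complex.norm_le_abs_re_add_abs_im s).trans ?_
    have : |s.re| ≤ 3 := abs_le.2 ⟨by linarith, hs3⟩
    linarith
  have key : ‖riemannZeta₁ s‖ ≤ 1 + ‖s - 1‖ * (2 * ‖s‖ ^ (2 * ε) * B) := by
    rw [zeta1_eq s (by linarith)]
    refine (norm_add_le _ _).trans ?_
    rw [norm_one]
    gcongr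
    rw [hB, ← tsum_mul_left, ← tsum_mul_left]
    refine tsum_of_norm_bounded (Summable.hasSum ((hBs.mul_left _).mul_left _)) ?_
    intro n
    have hn : (1:ℝ) ≤ (n:ℝ) + 1 := by have : (0:ℝ) ≤ n := Nat.cast_nonneg n; linarith
    refine (norm_zT_le _ hn s (by linarith) (2 * ε) (by linarith) (by linarith)).trans ?_
    gcongr
    linarith
  rw [riemannZeta_eq_inv_sub_mul hs1, norm_mul, norm_inv]
  have hpos : 0 < ‖s - 1‖ := by linarith
  have ht0 : 0 < |s.im| := by linarith
  have hle1 : (1:ℝ) ≤ (2 * |s.im|) ^ (2 * ε) := Real.one_le_rpow (by linarith) (by linarith)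
  have hle2 : ‖s‖ ^ (2 * ε) ≤ 7 ^ (2 * ε) * |s.im| ^ (2 * ε) := by
    rw [← Real.mul_rpow (by norm_num) (abs_nonneg _)]
    exact Real.rpow_le_rpow (norm_nonneg _) hnorm (by linarith)
  have h7 : (1:ℝ) ≤ 7 ^ (2 * ε) := Real.one_le_rpow (by norm_num) (by linarith)
  have h2 : (1:ℝ) ≤ 2 ^ (2 * ε) := Real.one_le_rpow (by norm_num) (by linarith)
  rw [Real.mul_rpow (by norm_num) ht0.le] at hle1
  have hI : 0 < |s.im| ^ (2 * ε) := by positivity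
  calc ‖s - 1‖⁻¹ * ‖riemannZeta₁ s‖ ≤ ‖s - 1‖⁻¹ * (1 + ‖s - 1‖ * (2 * ‖s‖ ^ (2 * ε) * B)) := by gcongr
    _ = ‖s - 1‖⁻¹ + 2 * ‖s‖ ^ (2 * ε) * B := by field_simp
    _ ≤ 2 + 2 * (7 ^ (2 * ε) * |s.im| ^ (2 * ε)) * B := by
      gcongr
      rw [inv_le_comm₀ hpos (by norm_num)]; linarith
    _ ≤ 2 * (7 ^ (2 * ε) * (2 ^ (2 * ε) * |s.im| ^ (2 * ε))) + 2 * (7 ^ (2 * ε) * (2 ^ (2 * ε) * |s.im| ^ (2 * ε))) * B := by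
      have q1 : (1:ℝ) ≤ 7 ^ (2 * ε) * (2 ^ (2 * ε) * |s.im| ^ (2 * ε)) := by
        calc (1:ℝ) = 1 * 1 := by norm_num
          _ ≤ _ := by gcongr
      have q2 : |s.im| ^ (2 * ε) ≤ (2 ^ (2 * ε) * |s.im| ^ (2 * ε)) := by
        nlinarith
      gcongr
      linarith
    _ = _ := by ring

end UDP

namespace UDP

/-! ### Part 1b: bounds for the derivatives of `ζ'/ζ` on the line `Re s = 1` -/

lemma rpow_two_mul_le (t u ε : ℝ) (hε : 0 < ε) (hε1 : ε ≤ 1 / 4) (hu0 : 0 ≤ u) (hu : u ≤ 2 * t) (ht : 0 ≤ t) :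
    u ^ (2 * ε) ≤ 2 * t ^ (2 * ε) := by
  calc u ^ (2 * ε) ≤ (2 * t) ^ (2 * ε) := Real.rpow_le_rpow hu0 hu (by linarith)
    _ = 2 ^ (2 * ε) * t ^ (2 * ε) := Real.mul_rpow (by norm_num) ht
    _ ≤ 2 ^ (1:ℝ) * t ^ (2 * ε) := by
      gcongr
      · norm_num
      · linarith
    _ = _ := by rw [Real.rpow_one]

lemma ne_one_of_im {s : ℂ} (h : 1 / 2 ≤ |s.im|) : s ≠ 1 := by rintro rfl; norm_num at h

lemma zeta_deriv_growth (ε : ℝ) (hε : 0 < ε) (hε1 : ε ≤ 1 / 4) : ∃ C : ℝ, 1 ≤ C ∧ ∀ s : ℂ,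
    1 - ε / 2 ≤ s.re → s.re ≤ 5 / 2 → 3 / 4 ≤ |s.im| →
    ‖deriv riemannZeta s‖ ≤ C * |s.im| ^ (2 * ε) := by
  obtain ⟨C, hC1, hC⟩ := zeta_growth ε hε hε1
  refine ⟨C * 2 / (ε / 2), ?_, ?_⟩
  · rw [le_div_iff₀ (by linarith)]; nlinarith
  intro s hs1 hs2 ht
  have hd : ∀ z ∈ Metric.closedBall s (ε / 2), 1 - ε ≤ z.re ∧ z.re ≤ 3 ∧ 1 / 2 ≤ |z.im| ∧ |z.im| ≤ 2 * |s.im| := by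
    intro z hz
    have hz : ‖z - s‖ ≤ ε / 2 := by simpa [dist_eq_norm] using hz
    have h1 := (Complex.abs_re_le_norm (z - s)).trans hz
    have h2 := (Complex.abs_im_le_norm (z - s)).trans hz
    rw [Complex.sub_re, abs_le] at h1
    rw [Complex.sub_im] at h2
    have h3 := abs_sub_abs_le_abs_sub s.im z.im
    have h4 := abs_sub_abs_le_abs_sub z.im s.im
    rw [abs_sub_comm] at h3
    refine ⟨by linarith, by linarith, by linarith, by linarith⟩
  have := Complex.norm_deriv_le_of_forall_mem_sphere_norm_le (c := s) (R := ε / 2)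
    (C := C * (2 * |s.im| ^ (2 * ε))) (f := riemannZeta) (by linarith) ?_ ?_
  · refine this.trans (le_of_eq ?_); ring
  · apply DifferentiableOn.diffContOnCl
    intro z hz
    have hz' : z ∈ Metric.closedBall s (ε / 2) := Metric.closure_ball_subset_closedBall hz
    exact (differentiableAt_riemannZeta (ne_one_of_im (hd z hz').2.2.1)).differentiableWithinAt
  · intro z hz
    obtain ⟨a, b, c, d⟩ := hd z (Metric.sphere_subset_closedBall hz)
    refine (hC z a b c).trans ?_
    gcongr
    exact rpow_two_mul_le _ _ _ hε hε1 (abs_nonneg _) d (abs_nonneg _)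

lemma zeta_341 (x : ℝ) (hx : 0 < x) (y : ℝ) :
    1 ≤ ‖riemannZeta (1 + x)‖ ^ 3 * ‖riemannZeta (1 + x + Complex.I * y)‖ ^ 4 *
      ‖riemannZeta (1 + x + 2 * Complex.I * y)‖ := by
  have := DirichletCharacter.norm_LFunction_product_ge_one (1 : DirichletCharacter ℂ 1) hx y
  simp only [DirichletCharacter.LFunctionTrivChar, DirichletCharacter.LFunction_modOne_eq, one_pow,
    norm_mul, norm_pow] at this
  exact this

lemma zeta_real_bound : ∃ M : ℝ, 1 ≤ M ∧ ∀ x : ℝ, 0 < x → x ≤ 2 → ‖riemannZeta (1 + x)‖ ≤ M / x := by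
  have hc : ContinuousOn (fun x : ℝ => riemannZeta₁ (1 + x)) (Set.Icc 0 2) := by
    apply Continuous.continuousOn
    exact differentiable_riemannZeta₁.continuous.comp (by fun_prop)
  obtain ⟨M, hM⟩ := isCompact_Icc.exists_bound_of_continuousOn hc
  refine ⟨max M 1, le_max_right _ _, fun x hx hx1 => ?_⟩
  have h1 : (1 + x : ℂ) ≠ 1 := by simp [hx.ne']
  rw [riemannZeta_eq_inv_sub_mul h1, norm_mul, norm_inv]
  have : ‖(1 + x - 1 : ℂ)‖ = x := by simp [abs_of_pos hx]
  rw [this, inv_mul_eq_div]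
  gcongr
  exact (hM x ⟨hx.le, hx1⟩).trans (le_max_left _ _)

/-- Lower bound for `ζ` to the right of the line `Re s = 1`. -/
lemma zeta_lower (ε : ℝ) (hε : 0 < ε) (hε1 : ε ≤ 1 / 4) : ∃ c : ℝ, 0 < c ∧ ∀ s : ℂ,
    1 ≤ s.re → s.re ≤ 2 → 1 ≤ |s.im| →
    c / (|s.im| ^ (2 * ε)) ^ 4 ≤ ‖riemannZeta s‖ := by
  obtain ⟨C, hC1, hC⟩ := zeta_growth ε hε hε1
  obtain ⟨D, hD1, hD⟩ := zeta_deriv_growth ε hε hε1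
  obtain ⟨M, hM1, hM⟩ := zeta_real_bound
  set c1 : ℝ := 1 / (M ^ 3 * (C * 2)) with hc1
  have hc1p : 0 < c1 := by positivity
  have hc1le : c1 ≤ 1 := by
    rw [hc1, div_le_one (by positivity)]
    have : (1:ℝ) ≤ M ^ 3 := one_le_pow₀ hM1
    nlinarith
  -- consequence of the 3-4-1 inequality
  have key : ∀ x : ℝ, 0 < x → x ≤ 1 → ∀ y : ℝ, 1 ≤ |y| →
      c1 * x ^ 3 / |y| ^ (2 * ε) ≤ ‖riemannZeta (1 + x + Complex.I * y)‖ ^ 4 := by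
    intro x hx hx1 y hy
    have h := zeta_341 x hx y
    have h1 := hM x hx (by linarith)
    have h2 := hC (1 + x + 2 * Complex.I * y) (by simp; linarith) (by simp; linarith)
      (by simp [abs_mul]; linarith)
    have e2 : (1 + x + 2 * Complex.I * y : ℂ).im = 2 * y := by simp
    rw [e2] at h2
    have h3 : |2 * y| ^ (2 * ε) ≤ 2 * |y| ^ (2 * ε) :=
      rpow_two_mul_le _ _ _ hε hε1 (abs_nonneg _) (by simp [abs_mul]) (abs_nonneg _)
    have hτ : 0 < |y| ^ (2 * ε) := by positivity
    have h4 : 1 ≤ (M / x) ^ 3 * ‖riemannZeta (1 + x + Complex.I * y)‖ ^ 4 * (C * (2 * |y| ^ (2 * ε))) := by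
      refine h.trans ?_
      gcongr
      exact h2.trans (by gcongr)
    rw [div_le_iff₀ hτ, hc1, div_mul_eq_mul_div, one_mul, div_le_iff₀ (by positivity)]
    have h5 : x ^ 3 * 1 ≤ x ^ 3 * ((M / x) ^ 3 * ‖riemannZeta (1 + x + Complex.I * y)‖ ^ 4 * (C * (2 * |y| ^ (2 * ε)))) := by
      gcongr
    calc x ^ 3 ≤ _ := by simpa using h5
      _ = _ := by field_simp
  set c2 : ℝ := c1 / (16 * D ^ 4) with hc2
  have hc2p : 0 < c2 := by positivity
  have hc2le : c2 ≤ 1 := by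
    rw [hc2, div_le_one (by positivity)]
    have : (1:ℝ) ≤ D ^ 4 := one_le_pow₀ hD1
    linarith
  refine ⟨c2 * D, by positivity, ?_⟩
  intro s hs1 hs2 ht
  set τ : ℝ := |s.im| ^ (2 * ε) with hτ
  have hτ1 : 1 ≤ τ := Real.one_le_rpow ht (by linarith)
  have hτ0 : 0 < τ := by linarith
  set x : ℝ := c2 / τ ^ 5 with hx
  have hx0 : 0 < x := by positivity
  have hx1 : x ≤ 1 := by
    rw [hx, div_le_one (by positivity)]
    exact hc2le.trans (one_le_pow₀ hτ1)
  have hxe : c2 * D / τ ^ 4 = x * D * τ := by rw [hx]; field_simp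
  rw [hxe]
  have big : ∀ w : ℝ, x ≤ w → w ≤ 1 → 2 * (x * D * τ) ≤ ‖riemannZeta (1 + w + Complex.I * s.im)‖ := by
    intro w hxw hw1
    have h := key w (by linarith) hw1 s.im ht
    have h6 : (2 * (x * D * τ)) ^ 4 ≤ ‖riemannZeta (1 + w + Complex.I * s.im)‖ ^ 4 := by
      refine le_trans ?_ h
      rw [le_div_iff₀ hτ0]
      have : c1 = x * (16 * D ^ 4) * τ ^ 5 := by rw [hx, hc2]; field_simp
      calc (2 * (x * D * τ)) ^ 4 * τ = (x * (16 * D ^ 4) * τ ^ 5) * x ^ 3 := by ring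
        _ = c1 * x ^ 3 := by rw [← this]
        _ ≤ c1 * w ^ 3 := by gcongr
    exact le_of_pow_le_pow_left₀ (by norm_num) (norm_nonneg _) h6
  have hpos : 0 < x * D * τ := by positivity
  rcases le_total (1 + x) s.re with hc | hc
  · have h := big (s.re - 1) (by linarith) (by linarith)
    have e1 : (1 + ((s.re - 1 : ℝ) : ℂ) + Complex.I * s.im) = s := by
      apply Complex.ext <;> simp
    rw [e1] at h
    linarith
  · have h := big x le_rfl hx1
    set z : ℂ := 1 + x + Complex.I * s.im with hz
    have hzre : z.re = 1 + x := by simp [hz]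
    have hzim : z.im = s.im := by simp [hz]
    have hmv := Convex.norm_image_sub_le_of_norm_hasDerivWithin_le (𝕜 := ℂ)
      (f := riemannZeta) (f' := deriv riemannZeta)
      (s := {w : ℂ | w.im = s.im} ∩ {w : ℂ | 1 ≤ w.re} ∩ {w : ℂ | w.re ≤ 2}) (C := D * τ) (x := s) (y := z)
      ?_ ?_ ?_ ⟨⟨rfl, hs1⟩, hs2⟩ ⟨⟨hzim, ?_⟩, ?_⟩
    · have hdist : ‖z - s‖ ≤ x := by
        have : z - s = ((1 + x - s.re : ℝ) : ℂ) := by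
          apply Complex.ext
          · simp [hzre]
          · simp [hzim]
        rw [this, Complex.norm_real, Real.norm_eq_abs, abs_of_nonneg (by linarith)]
        linarith
      have h7 : ‖riemannZeta z - riemannZeta s‖ ≤ D * τ * x := hmv.trans (by gcongr)
      have h8 := norm_sub_norm_le (riemannZeta z) (riemannZeta s)
      nlinarith
    · intro w hw
      refine (differentiableAt_riemannZeta (ne_one_of_im ?_)).hasDerivAt.hasDerivWithinAt
      have : w.im = s.im := hw.1.1
      rw [this]; linarith
    · intro w hw
      have h9 : w.im = s.im := hw.1.1
      have h10 : 1 ≤ w.re := hw.1.2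
      have h11 : w.re ≤ 2 := hw.2
      have := hD w (by linarith) (by linarith) (by rw [h9]; linarith)
      rwa [h9] at this
    · exact ((convex_hyperplane (f := Complex.im) ⟨fun _ _ => rfl, fun c x => by simp⟩ _).inter
        (convex_halfSpace_re_ge 1)).inter (convex_halfSpace_re_le 2)
    · change 1 ≤ z.re; linarith
    · change z.re ≤ 2; linarith

/-- The Dirichlet series of `Λ - 1`, continued analytically. -/
def HH (s : ℂ) : ℂ := - (deriv riemannZeta₁ s / riemannZeta₁ s) - riemannZeta₀ s

lemma HH_eq (s : ℂ) (hs : s ≠ 1) (hz : riemannZeta s ≠ 0) :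
    HH s = - deriv riemannZeta s / riemannZeta s - riemannZeta s := by
  have hs' : s - 1 ≠ 0 := sub_ne_zero.2 hs
  have h1 : riemannZeta₁ s = (s - 1) * riemannZeta s := by
    rw [riemannZeta_eq_inv_sub_mul hs, ← mul_assoc, mul_inv_cancel₀ hs', one_mul]
  have h2 : deriv riemannZeta₁ s = riemannZeta s + (s - 1) * deriv riemannZeta s := by
    have hev : riemannZeta₁ =ᶠ[𝓝 s] fun s => (s - 1) * riemannZeta s := by
      filter_upwards [isOpen_ne.mem_nhds hs] with w hw
      rw [riemannZeta_eq_inv_sub_mul hw, ← mul_assoc, mul_inv_cancel₀ (sub_ne_zero.2 hw), one_mul]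
    rw [hev.deriv_eq]
    have := ((hasDerivAt_id s).sub_const 1).mul (differentiableAt_riemannZeta hs).hasDerivAt
    have := this.deriv
    simp only [id, one_mul] at this
    exact this
  have h3 : riemannZeta₀ s = riemannZeta s - (s - 1)⁻¹ := by
    rw [riemannZeta_eq_inv_sub_add hs]; ring
  rw [HH, h1, h2, h3]
  field_simp
  ring

lemma zeta1_ne_zero (s : ℂ) (hs : 1 ≤ s.re) : riemannZeta₁ s ≠ 0 := by
  by_cases h : s = 1
  · rw [h]; simp
  · have := riemannZeta_ne_zero_of_one_le_re hs
    rw [riemannZeta_eq_inv_sub_mul h] at this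
    exact right_ne_zero_of_mul this

lemma HH_analyticAt (s : ℂ) (hs : riemannZeta₁ s ≠ 0) : AnalyticAt ℂ HH s := by
  have h1 : AnalyticAt ℂ riemannZeta₁ s := differentiable_riemannZeta₁.analyticAt s
  have h0 : AnalyticAt ℂ riemannZeta₀ s := differentiable_riemannZeta₀.analyticAt s
  exact ((h1.deriv.div h1 hs).neg).sub h0

lemma HH_bound_large (k : ℕ) : ∃ C : ℝ, 0 < C ∧ ∀ s : ℂ, 1 ≤ s.re → s.re ≤ 2 → 1 ≤ |s.im| →
    ‖iteratedDeriv k HH s‖ ≤ C * |s.im| ^ (1 / 2 : ℝ) := by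
  set ε : ℝ := 1 / (40 * (k + 1)) with hε
  have hε0 : 0 < ε := by positivity
  have hε1 : ε ≤ 1 / 4 := by
    rw [hε, div_le_div_iff₀ (by positivity) (by norm_num)]
    have : (0:ℝ) ≤ k := Nat.cast_nonneg k
    linarith
  obtain ⟨C, hC1, hC⟩ := zeta_growth ε hε0 hε1
  obtain ⟨D, hD1, hD⟩ := zeta_deriv_growth ε hε0 hε1
  obtain ⟨c, hc0, hc⟩ := zeta_lower ε hε0 hε1
  set r0 : ℝ := min (ε / 4) (c / (4 * D)) with hr0
  have hr0p : 0 < r0 := by positivity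
  have hr0a : r0 ≤ ε / 4 := min_le_left _ _
  have hr0b : r0 * (4 * D) ≤ c := by
    rw [← le_div_iff₀ (by positivity)]; exact min_le_right _ _
  refine ⟨k.factorial * (4 * D / c + 2 * C) / r0 ^ k, by positivity, ?_⟩
  intro s hs1 hs2 ht
  set τ : ℝ := |s.im| ^ (2 * ε) with hτ
  have hτ1 : 1 ≤ τ := Real.one_le_rpow ht (by linarith)
  have hτ0 : 0 < τ := by linarith
  set r : ℝ := r0 / τ ^ 5 with hr
  have hrp : 0 < r := by positivity
  have hrr0 : r ≤ r0 := div_le_self hr0p.le (one_le_pow₀ hτ1)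
  have hd : ∀ z ∈ Metric.closedBall s r, 1 - ε / 2 ≤ z.re ∧ z.re ≤ 5 / 2 ∧ 3 / 4 ≤ |z.im| ∧
      |z.im| ^ (2 * ε) ≤ 2 * τ := by
    intro z hz
    have hz : ‖z - s‖ ≤ r := by simpa [dist_eq_norm] using hz
    have h1 := (Complex.abs_re_le_norm (z - s)).trans hz
    have h2 := (Complex.abs_im_le_norm (z - s)).trans hz
    rw [Complex.sub_re, abs_le] at h1
    rw [Complex.sub_im] at h2
    have h3 := abs_sub_abs_le_abs_sub s.im z.im
    have h4 := abs_sub_abs_le_abs_sub z.im s.im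
    rw [abs_sub_comm] at h3
    refine ⟨by linarith, by linarith, by linarith,
      rpow_two_mul_le _ _ _ hε0 hε1 (abs_nonneg _) (by linarith) (abs_nonneg _)⟩
  have hder : ∀ z ∈ Metric.closedBall s r, ‖deriv riemannZeta z‖ ≤ D * (2 * τ) := by
    intro z hz
    obtain ⟨a, b, c', d⟩ := hd z hz
    refine (hD z a b c').trans ?_
    gcongr
  have hlow : ∀ z ∈ Metric.closedBall s r, c / (2 * τ ^ 4) ≤ ‖riemannZeta z‖ := by
    intro z hz
    have hmv := Convex.norm_image_sub_le_of_norm_hasDerivWithin_le (𝕜 := ℂ)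
      (f := riemannZeta) (f' := deriv riemannZeta) (s := Metric.closedBall s r) (C := D * (2 * τ))
      (x := z) (y := s) ?_ hder (convex_closedBall _ _) hz (Metric.mem_closedBall_self hrp.le)
    · have h1 := hc s hs1 hs2 ht
      have h2 : ‖s - z‖ ≤ r := by
        rw [norm_sub_rev]; simpa [dist_eq_norm] using hz
      have h3 : ‖riemannZeta s - riemannZeta z‖ ≤ D * (2 * τ) * r := hmv.trans (by gcongr)
      have h4 := norm_sub_norm_le (riemannZeta s) (riemannZeta z)
      have h5 : D * (2 * τ) * r ≤ c / (2 * τ ^ 4) := by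
        rw [hr, le_div_iff₀ (by positivity)]
        have : D * (2 * τ) * (r0 / τ ^ 5) * (2 * τ ^ 4) = r0 * (4 * D) := by field_simp; ring
        rw [this]; exact hr0b
      have h6 : c / τ ^ 4 = c / (2 * τ ^ 4) + c / (2 * τ ^ 4) := by field_simp; ring
      linarith
    · intro w hw
      obtain ⟨a, b, c', d⟩ := hd w hw
      exact (differentiableAt_riemannZeta (ne_one_of_im (by linarith))).hasDerivAt.hasDerivWithinAt
  have hlowpos : 0 < c / (2 * τ ^ 4) := by positivity
  have hne : ∀ z ∈ Metric.closedBall s r, riemannZeta z ≠ 0 := by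
    intro z hz h0
    have := hlow z hz
    rw [h0, norm_zero] at this
    linarith
  have hbd := Complex.norm_iteratedDeriv_le_of_forall_mem_sphere_norm_le (c := s) (R := r)
    (C := (4 * D / c + 2 * C) * τ ^ 5) (f := HH) k hrp ?_ ?_
  · refine hbd.trans ?_
    have h1 : (k.factorial : ℝ) * ((4 * D / c + 2 * C) * τ ^ 5) / r ^ k =
      k.factorial * (4 * D / c + 2 * C) / r0 ^ k * τ ^ (5 * (k + 1)) := by
      rw [hr, div_pow, show 5 * (k + 1) = 5 * k + 5 by ring, pow_add, pow_mul]
      field_simp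
    rw [h1]
    have h2 : τ ^ (5 * (k + 1)) ≤ |s.im| ^ (1 / 2 : ℝ) := by
      rw [hτ, ← Real.rpow_natCast, ← Real.rpow_mul (abs_nonneg _)]
      apply Real.rpow_le_rpow_of_exponent_le ht
      rw [hε]; push_cast
      have : (0:ℝ) < (k:ℝ) + 1 := by positivity
      field_simp
      norm_num
    gcongr
  · apply DifferentiableOn.diffContOnCl
    intro z hz
    have hz' : z ∈ Metric.closedBall s r := Metric.closure_ball_subset_closedBall hz
    have hz1 : z ≠ 1 := ne_one_of_im (by linarith [(hd z hz').2.2.1])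
    refine (HH_analyticAt z ?_).differentiableAt.differentiableWithinAt
    have := hne z hz'
    rw [riemannZeta_eq_inv_sub_mul hz1] at this
    exact right_ne_zero_of_mul this
  · intro z hz
    have hz' := Metric.sphere_subset_closedBall hz
    obtain ⟨a, b, c', d⟩ := hd z hz'
    have hz1 : z ≠ 1 := ne_one_of_im (by linarith)
    rw [HH_eq z hz1 (hne z hz')]
    refine (norm_sub_le _ _).trans ?_
    rw [norm_div, norm_neg]
    have h1 : ‖deriv riemannZeta z‖ / ‖riemannZeta z‖ ≤ D * (2 * τ) / (c / (2 * τ ^ 4)) := by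
      gcongr
      · exact hder z hz'
      · exact hlow z hz'
    have h2 : ‖riemannZeta z‖ ≤ C * (2 * τ) :=
      (hC z (by linarith) (by linarith) (by linarith)).trans (by gcongr)
    have h3 : τ ≤ τ ^ 5 := le_self_pow₀ hτ1 (by norm_num)
    have h4 : D * (2 * τ) / (c / (2 * τ ^ 4)) = 4 * D / c * τ ^ 5 := by field_simp; ring
    rw [h4] at h1
    have h5 : C * (2 * τ) ≤ 2 * C * τ ^ 5 := by nlinarith
    linarith

lemma HH_bound (k : ℕ) : ∃ C : ℝ, 0 < C ∧ ∀ s : ℂ, 1 ≤ s.re → s.re ≤ 2 →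
    ‖iteratedDeriv k HH s‖ ≤ C * (1 + |s.im|) ^ (1 / 2 : ℝ) := by
  obtain ⟨C, hC0, hC⟩ := HH_bound_large k
  have hcomp : IsCompact ((Set.Icc (1:ℝ) 2) ×ℂ (Set.Icc (-1:ℝ) 1)) :=
    isCompact_Icc.reProdIm isCompact_Icc
  have hcont : ContinuousOn (iteratedDeriv k HH) ((Set.Icc (1:ℝ) 2) ×ℂ (Set.Icc (-1:ℝ) 1)) := by
    intro z hz
    have h1 : AnalyticAt ℂ HH z := HH_analyticAt z (zeta1_ne_zero z hz.1.1)
    rw [iteratedDeriv_eq_iterate]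
    exact (h1.iterated_deriv k).continuousAt.continuousWithinAt
  obtain ⟨M, hM⟩ := hcomp.exists_bound_of_continuousOn hcont
  refine ⟨max C M, lt_max_of_lt_left hC0, fun s hs1 hs2 => ?_⟩
  rcases le_total 1 |s.im| with h | h
  · refine (hC s hs1 hs2 h).trans ?_
    gcongr
    · exact le_max_left _ _
    · linarith
  · have := hM s ⟨⟨hs1, hs2⟩, abs_le.1 h⟩
    have h1 : (1:ℝ) ≤ (1 + |s.im|) ^ (1 / 2 : ℝ) := Real.one_le_rpow (by linarith [abs_nonneg s.im]) (by norm_num)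
    calc _ ≤ M := this
      _ ≤ max C M := le_max_right _ _
      _ ≤ max C M * (1 + |s.im|) ^ (1 / 2 : ℝ) := le_mul_of_one_le_right (lt_max_of_lt_left hC0).le h1

end UDP

namespace UDP

def tent (y : ℝ) : ℂ := ((max (1 - y) 0 : ℝ) : ℂ)

lemma tent_mellin {s : ℂ} (hs : 0 < s.re) : HasMellin tent s (1 / s - 1 / (s + 1)) := by
  have h1 := hasMellin_one_Ioc hs
  have h2 := hasMellin_cpow_Ioc 1 (s := s) (by simp; linarith)
  have h3 := hasMellin_sub h1.1 h2.1
  rw [h1.2, h2.2] at h3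
  have hc : ∀ t ∈ Set.Ioi (0:ℝ), (Set.Ioc (0:ℝ) 1).indicator (fun _ => (1:ℂ)) t -
      (Set.Ioc (0:ℝ) 1).indicator (fun t : ℝ => (t:ℂ) ^ (1:ℂ)) t = tent t := by
    intro t ht
    have ht : 0 < t := ht
    unfold tent
    by_cases h : t ≤ 1
    · have hm : t ∈ Set.Ioc (0:ℝ) 1 := ⟨ht, h⟩
      rw [Set.indicator_of_mem hm, Set.indicator_of_mem hm, max_eq_left (by linarith)]
      simp
    · rw [Set.indicator_of_notMem (fun h' => h h'.2), Set.indicator_of_notMem (fun h' => h h'.2),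
        max_eq_right (by linarith)]
      simp
  constructor
  · refine IntegrableOn.congr_fun h3.1 (fun t ht => ?_) measurableSet_Ioi
    simp only [hc t ht]
  · rw [← h3.2]
    refine setIntegral_congr_fun measurableSet_Ioi (fun t ht => ?_)
    simp only [hc t ht]

lemma tent_mellin_bound {s : ℂ} (hs : 1 ≤ s.re) :
    ‖mellin tent s‖ ≤ 2 * (1 + |s.im|) ^ (-2 : ℝ) := by
  rw [(tent_mellin (by linarith)).2]
  have h0 : s ≠ 0 := by rintro rfl; simp at hs; linarith
  have h1 : s + 1 ≠ 0 := by
    intro h; have := congrArg Complex.re h; simp at this; linarith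
  have : 1 / s - 1 / (s + 1) = 1 / (s * (s + 1)) := by field_simp; ring
  rw [this, norm_div, norm_one, norm_mul]
  have ha : (1 + |s.im|) ^ 2 / 2 ≤ ‖s‖ ^ 2 := by
    rw [Complex.sq_norm, Complex.normSq_apply]
    have := sq_abs s.im
    nlinarith [sq_nonneg (1 - |s.im|)]
  have hb : ‖s‖ ≤ ‖s + 1‖ := by
    rw [← abs_of_nonneg (norm_nonneg s), ← abs_of_nonneg (norm_nonneg (s+1)), ← sq_le_sq,
      Complex.sq_norm, Complex.normSq_apply, Complex.sq_norm, Complex.normSq_apply]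
    simp; nlinarith
  have hc : (1 + |s.im|) ^ 2 / 2 ≤ ‖s‖ * ‖s + 1‖ := by
    nlinarith [norm_nonneg s]
  rw [Real.rpow_neg (by positivity)]
  have hp : (0:ℝ) < (1 + |s.im|) ^ 2 := by positivity
  calc 1 / (‖s‖ * ‖s + 1‖) ≤ 1 / ((1 + |s.im|) ^ 2 / 2) := by gcongr
    _ = _ := by norm_cast; field_simp

lemma integrable_aux (r : ℝ) (hr : 1 < r) : Integrable (fun t : ℝ => (1 + |t|) ^ (-r)) := by
  have := integrable_one_add_norm (E := ℝ) (μ := volume) (r := r) (by simpa using hr)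
  simpa using this

lemma tent_vert {σ : ℝ} (hσ : 1 ≤ σ) : Complex.VerticalIntegrable (mellin tent) σ volume := by
  unfold Complex.VerticalIntegrable
  refine Integrable.mono' ((integrable_aux 2 (by norm_num)).const_mul 2) ?_ ?_
  · have : (fun y : ℝ => mellin tent (σ + y * Complex.I)) =
      fun y : ℝ => 1 / (σ + y * Complex.I) - 1 / ((σ + y * Complex.I) + 1) := by
      ext y
      exact (tent_mellin (by simp; linarith)).2
    rw [this]
    exact (by fun_prop : Measurable _).aestronglyMeasurable
  · refine Eventually.of_forall fun y => ?_
    have := tent_mellin_bound (s := σ + y * Complex.I) (by simpa using hσ)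
    simpa using this

lemma tent_inv {σ : ℝ} (hσ : 1 ≤ σ) {x : ℝ} (hx : 0 < x) :
    mellinInv σ (mellin tent) x = tent x := by
  refine mellinInv_mellin_eq σ tent hx (tent_mellin (by simp; linarith)).1 (tent_vert hσ) ?_
  unfold tent
  fun_prop

lemma perron (a : ℕ → ℂ) (σ : ℝ) (hσ : 1 ≤ σ) (hsum : LSeriesSummable a σ) (C : ℝ)
    (hC : ∀ t : ℝ, ‖LSeries a (σ + t * Complex.I)‖ ≤ C * (1 + |t|) ^ (1 / 2 : ℝ))
    (y : ℝ) (hy : 0 < y) (h0 : a 0 = 0) :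
    ‖∑' n : ℕ, a n * tent (n / y)‖ ≤ C * y ^ σ * ∫ t : ℝ, 2 * (1 + |t|) ^ (-(3 / 2) : ℝ) := by
  set F : ℕ → ℝ → ℂ := fun n t => (1 / (2 * Real.pi) : ℝ) •
    (LSeries.term a (σ + t * Complex.I) n * ((y : ℂ) ^ ((σ : ℂ) + t * Complex.I) *
      mellin tent (σ + t * Complex.I))) with hF
  have hnormterm : ∀ n : ℕ, ∀ t : ℝ, ‖LSeries.term a (σ + t * Complex.I) n‖ =
      ‖LSeries.term a σ n‖ := by
    intro n t
    rw [LSeries.norm_term_eq, LSeries.norm_term_eq]; simp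
  have hnormy : ∀ t : ℝ, ‖(y : ℂ) ^ ((σ : ℂ) + t * Complex.I)‖ = y ^ σ := by
    intro t
    rw [Complex.norm_cpow_eq_rpow_re_of_pos hy]; simp
  have hpi : |1 / (2 * Real.pi)| ≤ 1 := by
    rw [abs_of_pos (by positivity)]
    rw [div_le_one (by positivity)]; linarith [Real.two_le_pi]
  have hterm : ∀ n : ℕ, a n * tent (n / y) = ∫ t : ℝ, F n t := by
    intro n
    rcases eq_or_ne n 0 with rfl | hn
    · simp [hF, h0]
    · have hnp : (0:ℝ) < n := by positivity
      rw [← tent_inv hσ (div_pos hnp hy), mellinInv, hF]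
      simp only
      rw [integral_smul, mul_smul_comm, ← integral_const_mul]
      congr 2
      ext t
      rw [LSeries.term_of_ne_zero hn, smul_eq_mul]
      have e1 : (((n:ℝ) / y : ℝ) : ℂ) ^ (-((σ:ℂ) + t * Complex.I)) =
        (y : ℂ) ^ ((σ : ℂ) + t * Complex.I) / (n : ℂ) ^ ((σ : ℂ) + t * Complex.I) := by
        have hm := Complex.mul_cpow_ofReal_nonneg (div_pos hnp hy).le hy.le
          ((σ:ℂ) + t * Complex.I)
        rw [← Complex.ofReal_mul, div_mul_cancel₀ _ hy.ne', Complex.ofReal_natCast] at hm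
        have hy' : (y : ℂ) ^ ((σ : ℂ) + t * Complex.I) ≠ 0 := by
          simp [Complex.cpow_eq_zero_iff, hy.ne']
        rw [Complex.cpow_neg, hm]
        field_simp
      rw [e1]; ring
  have hmeas : ∀ n, AEStronglyMeasurable (F n) volume := by
    intro n
    have h1 : AEStronglyMeasurable (fun y : ℝ => mellin tent (σ + y * Complex.I)) volume :=
      (tent_vert hσ).1
    have h2 : Continuous (fun t : ℝ => LSeries.term a (σ + t * Complex.I) n) := by
      rcases eq_or_ne n 0 with rfl | hn
      · simp only [LSeries.term_zero]; exact continuous_const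
      · simp only [LSeries.term_of_ne_zero hn]
        have hn' : (n:ℂ) ≠ 0 := by exact_mod_cast hn
        refine Continuous.div continuous_const ?_ ?_
        · exact Continuous.const_cpow (by fun_prop) (Or.inl hn')
        · intro t; simp [Complex.cpow_eq_zero_iff, hn']
    have h3 : Continuous (fun t : ℝ => (y : ℂ) ^ ((σ : ℂ) + t * Complex.I)) :=
      Continuous.const_cpow (by fun_prop) (Or.inl (by exact_mod_cast hy.ne'))
    exact (h2.aestronglyMeasurable.mul (h3.aestronglyMeasurable.mul h1)).const_smul
      (1 / (2 * Real.pi) : ℝ)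
  have hb : ∀ n t, ‖F n t‖ ≤ ‖LSeries.term a σ n‖ * (y ^ σ * (2 * (1 + |t|) ^ (-2:ℝ))) := by
    intro n t
    have := tent_mellin_bound (s := σ + t * Complex.I) (by simpa using hσ)
    simp only [Complex.add_im, Complex.ofReal_im, Complex.mul_im, Complex.ofReal_re,
      Complex.I_im, mul_one, Complex.I_re, mul_zero, add_zero, zero_add] at this
    rw [hF]; simp only
    rw [norm_smul, norm_mul, norm_mul, hnormterm, hnormy, Real.norm_eq_abs]
    calc _ ≤ 1 * (‖LSeries.term a σ n‖ * (y ^ σ * (2 * (1 + |t|) ^ (-2:ℝ)))) := by gcongr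
      _ = _ := one_mul _
  have hintg2 := ((integrable_aux 2 (by norm_num)).const_mul 2).const_mul (y ^ σ)
  have hintg : ∀ n, Integrable (F n) := by
    intro n
    exact Integrable.mono' (hintg2.const_mul _) (hmeas n) (Eventually.of_forall (hb n))
  have hsm : Summable fun n => ∫ t : ℝ, ‖F n t‖ := by
    refine Summable.of_nonneg_of_le (fun n => integral_nonneg fun t => norm_nonneg _) (fun n => ?_)
      (hsum.norm.mul_right (∫ t : ℝ, y ^ σ * (2 * (1 + |t|) ^ (-2:ℝ))))
    rw [← integral_const_mul]
    exact integral_mono (hintg n).norm (hintg2.const_mul _) (hb n)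
  have hs := hasSum_integral_of_summable_integral_norm hintg hsm
  have e2 : ∑' n : ℕ, a n * tent (n / y) = ∫ t : ℝ, ∑' n, F n t := by
    rw [← hs.tsum_eq]; exact tsum_congr hterm
  rw [e2]
  have e3 : ∀ t, ∑' n, F n t = (1 / (2 * Real.pi) : ℝ) • (LSeries a (σ + t * Complex.I) *
     ((y : ℂ) ^ ((σ : ℂ) + t * Complex.I) * mellin tent (σ + t * Complex.I))) := by
    intro t
    rw [hF]; simp only
    rw [tsum_const_smul'', tsum_mul_right]; rfl
  rw [← integral_const_mul]
  refine norm_integral_le_of_norm_le (((integrable_aux (3/2) (by norm_num)).const_mul 2).const_mul _)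
    (Eventually.of_forall fun t => ?_)
  rw [e3, norm_smul, norm_mul, norm_mul, hnormy, Real.norm_eq_abs]
  have := tent_mellin_bound (s := σ + t * Complex.I) (by simpa using hσ)
  simp only [Complex.add_im, Complex.ofReal_im, Complex.mul_im, Complex.ofReal_re,
      Complex.I_im, mul_one, Complex.I_re, mul_zero, add_zero, zero_add] at this
  have hC0 : 0 ≤ C * (1 + |t|) ^ (1 / 2 : ℝ) := (norm_nonneg _).trans (hC t)
  calc _ ≤ 1 * (C * (1 + |t|) ^ (1 / 2 : ℝ) * (y ^ σ * (2 * (1 + |t|) ^ (-2:ℝ)))) := by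
        gcongr; exact hC t
    _ = C * y ^ σ * (2 * ((1 + |t|) ^ (1 / 2 : ℝ) * (1 + |t|) ^ (-2:ℝ))) := by ring
    _ = _ := by rw [← Real.rpow_add (by positivity)]; norm_num

end UDP

namespace UDP

def aK (k n : ℕ) : ℝ := (ArithmeticFunction.vonMangoldt n - 1) * Real.log n ^ k

lemma logMul_iter (f : ℕ → ℂ) (k n : ℕ) :
    LSeries.logMul^[k] f n = (Complex.log n) ^ k * f n := by
  induction k with
  | zero => simp
  | succ k ih =>
    rw [Function.iterate_succ_apply', LSeries.logMul, ih, pow_succ]; ring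

def lam1 (n : ℕ) : ℂ := (ArithmeticFunction.vonMangoldt n : ℂ) - 1

lemma aK_eq (k n : ℕ) : ((aK k n : ℝ) : ℂ) = LSeries.logMul^[k] lam1 n := by
  rw [logMul_iter, lam1, aK]
  push_cast
  ring

lemma lam1_summable {s : ℂ} (hs : 1 < s.re) : LSeriesSummable lam1 s :=
  (ArithmeticFunction.LSeriesSummable_vonMangoldt hs).sub (LSeriesSummable_one_iff.2 hs)

lemma lam1_LSeries {s : ℂ} (hs : 1 < s.re) : LSeries lam1 s = HH s := by
  have h := LSeries_sub (ArithmeticFunction.LSeriesSummable_vonMangoldt hs)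
    (LSeriesSummable_one_iff.2 hs)
  rw [HH_eq s (by rintro rfl; simp at hs) (riemannZeta_ne_zero_of_one_lt_re hs),
    ← LSeries_one_eq_riemannZeta hs]
  rw [ArithmeticFunction.LSeries_vonMangoldt_eq_deriv_riemannZeta_div hs,
     ← LSeries_one_eq_riemannZeta hs] at h
  rw [← h]
  rfl

lemma lam1_absc : LSeries.abscissaOfAbsConv lam1 ≤ (1:ℝ) := by
  apply LSeries.abscissaOfAbsConv_le_of_forall_lt_LSeriesSummable
  intro y hy
  apply lam1_summable
  simpa using hy

lemma aK_LSeries (k : ℕ) {s : ℂ} (hs : 1 < s.re) :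
    ‖LSeries (fun n => ((aK k n : ℝ) : ℂ)) s‖ = ‖iteratedDeriv k HH s‖ := by
  have h1 : LSeries.abscissaOfAbsConv lam1 < (s.re : EReal) :=
    lam1_absc.trans_lt (by exact_mod_cast hs)
  have h2 := LSeries_iteratedDeriv k h1
  have h3 : iteratedDeriv k HH s = iteratedDeriv k (LSeries lam1) s := by
    apply Filter.EventuallyEq.iteratedDeriv_eq
    have : {z : ℂ | 1 < z.re} ∈ 𝓝 s := (isOpen_lt continuous_const Complex.continuous_re).mem_nhds hs
    filter_upwards [this] with z hz using (lam1_LSeries hz).symm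
  rw [h3, h2, norm_mul, norm_pow, norm_neg, norm_one, one_pow, one_mul]
  congr 2
  ext n
  exact aK_eq k n

lemma aK_summable (k : ℕ) {s : ℂ} (hs : 1 < s.re) :
    LSeriesSummable (fun n => ((aK k n : ℝ) : ℂ)) s := by
  have h1 : LSeries.abscissaOfAbsConv (LSeries.logMul^[k] lam1) < (s.re : EReal) := by
    rw [LSeries.absicssaOfAbsConv_logPowMul]
    exact lam1_absc.trans_lt (by exact_mod_cast hs)
  have := LSeriesSummable_of_abscissaOfAbsConv_lt_re h1
  have e : (fun n => ((aK k n : ℝ) : ℂ)) = LSeries.logMul^[k] lam1 := by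
    ext n; exact aK_eq k n
  rw [e]; exact this

lemma aK_zero {k : ℕ} (hk : 1 ≤ k) : aK k 0 = 0 := by
  simp [aK]; omega

lemma smooth_bound (k : ℕ) (hk : 1 ≤ k) : ∃ C : ℝ, 0 < C ∧ ∀ N : ℕ,
    |∑ n ∈ Finset.range N, aK k n * ((N:ℝ) - n)| ≤ C * (N:ℝ) ^ 2 := by
  obtain ⟨C, hC0, hC⟩ := HH_bound k
  set J := ∫ t : ℝ, 2 * (1 + |t|) ^ (-(3 / 2) : ℝ) with hJ
  have hJ0 : 0 ≤ J := integral_nonneg fun t => by positivity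
  refine ⟨C * J + 1, by positivity, fun N => ?_⟩
  rcases Nat.eq_zero_or_pos N with rfl | hN
  · simp
  have hNr : (0:ℝ) < N := by exact_mod_cast hN
  have key : ∀ σ : ℝ, σ ∈ Set.Ioc (1:ℝ) 2 →
      ‖∑' n : ℕ, ((aK k n : ℝ) : ℂ) * tent (n / N)‖ ≤ C * (N:ℝ) ^ σ * J := by
    intro σ hσ
    refine perron _ σ hσ.1.le (aK_summable k (by simpa using hσ.1)) C (fun t => ?_) N hNr
      (by simp [aK_zero hk])
    rw [aK_LSeries k (by simpa using hσ.1)]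
    have := hC (σ + t * Complex.I) (by simpa using hσ.1.le) (by simpa using hσ.2)
    simpa using this
  have e1 : ∑' n : ℕ, ((aK k n : ℝ) : ℂ) * tent (n / N) =
      ((∑ n ∈ Finset.range N, aK k n * ((N:ℝ) - n)) / N : ℝ) := by
    rw [tsum_eq_sum (s := Finset.range N)]
    · rw [Finset.sum_div]; push_cast
      apply Finset.sum_congr rfl
      intro n hn
      have : (n:ℝ) ≤ N := by exact_mod_cast (Finset.mem_range.1 hn).le
      rw [tent, max_eq_left (by rw [sub_nonneg, div_le_one hNr]; exact this)]
      push_cast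
      have : (N:ℂ) ≠ 0 := by exact_mod_cast hN.ne'
      field_simp
    · intro n hn
      have : (N:ℝ) ≤ n := by simpa using hn
      rw [tent, max_eq_right (by rw [sub_nonpos, le_div_iff₀ hNr]; linarith)]
      simp
  have key2 : ‖∑' n : ℕ, ((aK k n : ℝ) : ℂ) * tent (n / N)‖ ≤ C * (N:ℝ) ^ (1:ℝ) * J := by
    have hcont : ContinuousAt (fun σ : ℝ => C * (N:ℝ) ^ σ * J) 1 := by
      have : ContinuousAt (fun σ : ℝ => (N:ℝ) ^ σ) 1 := Real.continuousAt_const_rpow hNr.ne'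
      fun_prop
    refine ge_of_tendsto (hcont.tendsto.mono_left (nhdsWithin_le_nhds (s := Set.Ioi 1))) ?_
    have : Set.Ioc (1:ℝ) 2 ∈ 𝓝[>] (1:ℝ) := Ioc_mem_nhdsGT (by norm_num)
    filter_upwards [this] with σ hσ using key σ hσ
  rw [e1, Complex.norm_real, Real.norm_eq_abs, abs_div, abs_of_pos hNr, div_le_iff₀ hNr,
    Real.rpow_one] at key2
  nlinarith

/-- partial sums -/
def PsiK (k N : ℕ) : ℝ := ∑ n ∈ Finset.range N, aK k n

lemma aK_ge (k n : ℕ) (N : ℕ) (h : n ≤ N) : -(Real.log N ^ k) ≤ aK k n := by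
  have h0 : 0 ≤ Real.log n := Real.log_natCast_nonneg n
  have h1 : Real.log n ^ k ≤ Real.log N ^ k := by
    rcases Nat.eq_zero_or_pos n with rfl | hn
    · have : 0 ≤ Real.log N := Real.log_natCast_nonneg N
      simp; gcongr
    · gcongr
  have h2 : 0 ≤ ArithmeticFunction.vonMangoldt n := ArithmeticFunction.vonMangoldt_nonneg
  unfold aK
  nlinarith [mul_nonneg h2 (pow_nonneg h0 k)]

lemma unsmooth (k : ℕ) (C : ℝ) (hC : ∀ N : ℕ,
    |∑ n ∈ Finset.range N, aK k n * ((N:ℝ) - n)| ≤ C * (N:ℝ) ^ 2) (N h : ℕ) (hh : 1 ≤ h)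
    (hN : h ≤ N) :
    |PsiK k N| ≤ 5 * C * (N:ℝ) ^ 2 / h + h * Real.log (2 * N : ℕ) ^ k := by
  have hhr : (0:ℝ) < h := by exact_mod_cast hh
  have hC0 : 0 ≤ C := by
    have := (abs_nonneg _).trans (hC 1); simpa using this
  have hstep : ∀ M : ℕ, ∑ n ∈ Finset.range (M + h), aK k n * (((M + h : ℕ):ℝ) - n) -
      ∑ n ∈ Finset.range M, aK k n * ((M:ℝ) - n) = h * PsiK k M +
        ∑ i ∈ Finset.range h, aK k (M + i) * ((h:ℝ) - i) := by
    intro M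
    rw [Finset.sum_range_add, PsiK, Finset.mul_sum]
    have : ∑ n ∈ Finset.range M, aK k n * (((M + h : ℕ):ℝ) - n) =
       ∑ n ∈ Finset.range M, h * aK k n + ∑ n ∈ Finset.range M, aK k n * ((M:ℝ) - n) := by
      rw [← Finset.sum_add_distrib]
      apply Finset.sum_congr rfl; intro n _; push_cast; ring
    rw [this]
    have : ∑ n ∈ Finset.range h, aK k (M + n) * (((M + h : ℕ):ℝ) - ((M + n : ℕ) : ℝ)) =
      ∑ i ∈ Finset.range h, aK k (M + i) * ((h:ℝ) - i) := by
      apply Finset.sum_congr rfl; intro n _; push_cast; ring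
    rw [this]; ring
  have hlog : 0 ≤ Real.log (2 * N : ℕ) := Real.log_natCast_nonneg _
  have hNh : (h:ℝ) ≤ N := by exact_mod_cast hN
  rw [abs_le]
  constructor
  · obtain ⟨M, rfl⟩ := Nat.exists_eq_add_of_le' hN
    have h1 := hstep M
    have h2 := abs_le.1 (hC (M + h))
    have h3 := abs_le.1 (hC M)
    have h4 : PsiK k (M + h) = PsiK k M + ∑ i ∈ Finset.range h, aK k (M + i) := by
      rw [PsiK, Finset.sum_range_add, PsiK]
    have h5 : -(h * (h * Real.log (2 * (M + h) : ℕ) ^ k)) ≤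
        ∑ i ∈ Finset.range h, aK k (M + i) * i := by
      have : ∀ i ∈ Finset.range h, -(h * Real.log (2 * (M + h) : ℕ) ^ k) ≤ aK k (M + i) * i := by
        intro i hi
        have hi := Finset.mem_range.1 hi
        have h6 := aK_ge k (M + i) (2 * (M + h)) (by omega)
        have h7 : (i:ℝ) ≤ h := by exact_mod_cast hi.le
        have h8 : (0:ℝ) ≤ i := by positivity
        have h9 := pow_nonneg hlog k
        nlinarith
      calc _ = ∑ i ∈ Finset.range h, -(h * Real.log (2 * (M + h) : ℕ) ^ k) := by simp
        _ ≤ _ := Finset.sum_le_sum this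
    have h6 : h * PsiK k (M + h) = h * PsiK k M +
        ∑ i ∈ Finset.range h, aK k (M + i) * ((h:ℝ) - i) +
        ∑ i ∈ Finset.range h, aK k (M + i) * i := by
      rw [h4, mul_add, Finset.mul_sum, add_assoc, ← Finset.sum_add_distrib]
      congr 1
      apply Finset.sum_congr rfl; intro n _; ring
    have hM : (M:ℝ) ^ 2 ≤ ((M + h : ℕ):ℝ) ^ 2 := by gcongr; omega
    rw [← sub_nonneg]
    have e : PsiK k (M + h) - -(5 * C * ((M + h : ℕ):ℝ) ^ 2 / h + h * Real.log (2 * (M + h) : ℕ) ^ k)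
      = (h * PsiK k (M + h) + 5 * C * ((M + h : ℕ):ℝ) ^ 2 + h * (h * Real.log (2 * (M + h) : ℕ) ^ k)) / h := by
      field_simp; ring
    rw [e]
    apply div_nonneg _ hhr.le
    nlinarith [mul_le_mul_of_nonneg_left hM hC0, mul_nonneg hC0 (sq_nonneg ((M + h : ℕ):ℝ))]
  · have h1 := hstep N
    have h2 := abs_le.1 (hC (N + h))
    have h3 := abs_le.1 (hC N)
    have h5 : -(h * (h * Real.log (2 * N : ℕ) ^ k)) ≤
        ∑ i ∈ Finset.range h, aK k (N + i) * ((h:ℝ) - i) := by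
      have : ∀ i ∈ Finset.range h, -(h * Real.log (2 * N : ℕ) ^ k) ≤ aK k (N + i) * ((h:ℝ) - i) := by
        intro i hi
        have hi := Finset.mem_range.1 hi
        have h6 := aK_ge k (N + i) (2 * N) (by omega)
        have h7 : (i:ℝ) ≤ h := by exact_mod_cast hi.le
        have h8 : (0:ℝ) ≤ i := by positivity
        have h9 := pow_nonneg hlog k
        nlinarith
      calc _ = ∑ i ∈ Finset.range h, -(h * Real.log (2 * N : ℕ) ^ k) := by simp
        _ ≤ _ := Finset.sum_le_sum this
    have hM : ((N + h : ℕ):ℝ) ^ 2 ≤ 4 * (N:ℝ) ^ 2 := by push_cast; nlinarith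
    rw [← sub_nonneg]
    have e : (5 * C * (N:ℝ) ^ 2 / h + h * Real.log (2 * N : ℕ) ^ k) - PsiK k N
      = (5 * C * (N:ℝ) ^ 2 + h * (h * Real.log (2 * N : ℕ) ^ k) - h * PsiK k N) / h := by
      field_simp
    rw [e]
    apply div_nonneg _ hhr.le
    nlinarith [mul_le_mul_of_nonneg_left hM hC0]

/-- Summation by parts. -/
lemma abel_bound (g c : ℕ → ℂ) (B : ℝ) (n : ℕ)
    (hB : ∀ m ≤ n, ‖∑ i ∈ Finset.range m, g i‖ ≤ B) :
    ‖∑ i ∈ Finset.range n, c i * g i‖ ≤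
      B * (‖c n‖ + ∑ i ∈ Finset.range n, ‖c (i + 1) - c i‖) := by
  have key : ∀ m, ∑ i ∈ Finset.range m, c i * g i = c m * ∑ i ∈ Finset.range m, g i -
      ∑ i ∈ Finset.range m, (c (i + 1) - c i) * ∑ j ∈ Finset.range (i + 1), g j := by
    intro m
    induction m with
    | zero => simp
    | succ m ih =>
      rw [Finset.sum_range_succ, ih, Finset.sum_range_succ (fun i => (c (i + 1) - c i) * _) m,
        Finset.sum_range_succ g m]
      ring
  rw [key]
  refine (norm_sub_le _ _).trans ?_
  rw [mul_add]
  gcongr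
  · rw [norm_mul, mul_comm]; gcongr; exact hB n le_rfl
  · refine (norm_sum_le _ _).trans ?_
    rw [Finset.mul_sum]
    apply Finset.sum_le_sum
    intro i hi
    rw [norm_mul, mul_comm]; gcongr
    exact hB _ (Finset.mem_range.1 hi)

lemma abel_antitone (g : ℕ → ℝ) (c : ℕ → ℝ) (B : ℝ) (n : ℕ)
    (hB : ∀ m ≤ n, |∑ i ∈ Finset.range m, g i| ≤ B) (hc : ∀ i < n, c (i + 1) ≤ c i)
    (hc0 : 0 ≤ c n) :
    |∑ i ∈ Finset.range n, c i * g i| ≤ B * c 0 := by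
  have h := abel_bound (fun i => (g i : ℂ)) (fun i => (c i : ℂ)) B n (by
    intro m hm
    have := hB m hm
    rw [← Complex.ofReal_sum, Complex.norm_real]; exact this)
  have e1 : ‖∑ i ∈ Finset.range n, (c i : ℂ) * (g i : ℂ)‖ = |∑ i ∈ Finset.range n, c i * g i| := by
    rw [← Real.norm_eq_abs, ← Complex.norm_real]; push_cast; rfl
  have e2 : ‖((c n : ℝ) : ℂ)‖ + ∑ i ∈ Finset.range n, ‖((c (i + 1) : ℝ) : ℂ) - ((c i : ℝ) : ℂ)‖ = c 0 := by
    have : ∑ i ∈ Finset.range n, ‖((c (i + 1) : ℝ) : ℂ) - ((c i : ℝ) : ℂ)‖ =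
       ∑ i ∈ Finset.range n, (c i - c (i + 1)) := by
      apply Finset.sum_congr rfl
      intro i hi
      rw [← Complex.ofReal_sub, Complex.norm_real, Real.norm_eq_abs, abs_sub_comm, abs_of_nonneg]
      linarith [hc i (Finset.mem_range.1 hi)]
    rw [this, Finset.sum_range_sub', Complex.norm_real, Real.norm_eq_abs, abs_of_nonneg hc0]
    ring
  rw [e1, e2] at h
  exact h

end UDP

namespace UDP

lemma log_pow_le (j : ℕ) (x : ℝ) (hx : 1 ≤ x) : Real.log x ^ j ≤ j.factorial * x := by
  have h := Real.pow_div_factorial_le_exp (Real.log x) (Real.log_nonneg hx) j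
  rw [Real.exp_log (by linarith), div_le_iff₀ (by positivity)] at h
  linarith

lemma log_pow_le_sqrt (j : ℕ) (x : ℝ) (hx : 1 ≤ x) :
    Real.log x ^ j ≤ 2 ^ j * j.factorial * Real.sqrt x := by
  have h := log_pow_le j (Real.sqrt x) (by rw [Real.one_le_sqrt]; exact hx)
  rw [Real.log_sqrt (by linarith), div_pow, div_le_iff₀ (by positivity)] at h
  linarith

lemma one_le_log {N : ℕ} (hN : 3 ≤ N) : 1 ≤ Real.log N := by
  rw [Real.le_log_iff_exp_le (by positivity)]
  have : (3:ℝ) ≤ N := by exact_mod_cast hN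
  linarith [Real.exp_one_lt_three]

lemma PsiK_bound (j : ℕ) (hj : 1 ≤ j) : ∃ C : ℝ, 0 < C ∧ ∀ N : ℕ, 3 ≤ N →
    |PsiK (2 * j) N| ≤ C * N * Real.log N ^ j := by
  obtain ⟨C, hC0, hC⟩ := smooth_bound (2 * j) (by omega)
  refine ⟨5 * C + 2 ^ (2 * j) * (1 + j.factorial), by positivity, fun N hN => ?_⟩
  have hl := one_le_log hN
  have hNr : (3:ℝ) ≤ N := by exact_mod_cast hN
  set L := Real.log N with hL
  have hLj : 1 ≤ L ^ j := one_le_pow₀ hl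
  set h := ⌈(N:ℝ) / L ^ j⌉₊ with hh
  have h1 : 1 ≤ h := Nat.one_le_iff_ne_zero.2 (by
    rw [hh]; exact (Nat.ceil_pos.2 (by positivity)).ne')
  have h2 : h ≤ N := by
    rw [hh, Nat.ceil_le]; exact div_le_self (by positivity) hLj
  have h3 : (N:ℝ) / L ^ j ≤ h := Nat.le_ceil _
  have h4 : (h:ℝ) ≤ N / L ^ j + 1 := (Nat.ceil_lt_add_one (by positivity)).le
  have hb := unsmooth (2 * j) C hC N h h1 h2
  have hlog2 : Real.log (2 * N : ℕ) ≤ 2 * L := by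
    push_cast
    rw [Real.log_mul (by norm_num) (by positivity), two_mul]
    have := Real.log_two_lt_d9
    linarith
  have hlog0 : 0 ≤ Real.log (2 * N : ℕ) := Real.log_natCast_nonneg _
  refine hb.trans ?_
  have t1 : 5 * C * (N:ℝ) ^ 2 / h ≤ 5 * C * (N * L ^ j) := by
    calc 5 * C * (N:ℝ) ^ 2 / h ≤ 5 * C * (N:ℝ) ^ 2 / (N / L ^ j) := by gcongr
      _ = _ := by field_simp
  have t2 : h * Real.log (2 * N : ℕ) ^ (2 * j) ≤ 2 ^ (2 * j) * (1 + j.factorial) * (N * L ^ j) := by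
    calc h * Real.log (2 * N : ℕ) ^ (2 * j) ≤ (N / L ^ j + 1) * (2 * L) ^ (2 * j) := by gcongr
      _ = 2 ^ (2 * j) * (N * L ^ j + L ^ j * L ^ j) := by
        rw [mul_pow, two_mul j, pow_add L]; field_simp
      _ ≤ 2 ^ (2 * j) * (N * L ^ j + (j.factorial * N) * L ^ j) := by
        gcongr; exact log_pow_le j N (by linarith)
      _ = _ := by ring
  calc _ ≤ _ := add_le_add t1 t2
    _ = _ := by ring

lemma sum_vonMangoldt_le (N : ℕ) :
    ∑ n ∈ Finset.range N, ArithmeticFunction.vonMangoldt n ≤ 6 * N := by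
  have h := Chebyshev.psi_le_const_mul_self (x := N) (by positivity)
  rw [Chebyshev.psi_eq_sum_Icc, Nat.floor_natCast] at h
  have : ∑ n ∈ Finset.range N, ArithmeticFunction.vonMangoldt n ≤
      ∑ n ∈ Finset.Icc 0 N, ArithmeticFunction.vonMangoldt n := by
    apply Finset.sum_le_sum_of_subset_of_nonneg
    · intro n hn; simp at hn ⊢; omega
    · intro _ _ _; exact ArithmeticFunction.vonMangoldt_nonneg
  have hl : Real.log 4 ≤ 2 := by
    rw [show (4:ℝ) = 2 ^ 2 by norm_num, Real.log_pow]
    have := Real.log_two_lt_d9; push_cast; linarith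
  have : (0:ℝ) ≤ N := by positivity
  nlinarith

lemma PsiK0_triv (N : ℕ) : |PsiK 0 N| ≤ 7 * N := by
  have h := sum_vonMangoldt_le N
  have h0 : 0 ≤ ∑ n ∈ Finset.range N, ArithmeticFunction.vonMangoldt n :=
    Finset.sum_nonneg fun _ _ => ArithmeticFunction.vonMangoldt_nonneg
  have e : PsiK 0 N = ∑ n ∈ Finset.range N, ArithmeticFunction.vonMangoldt n - N := by
    simp [PsiK, aK]
  have : (0:ℝ) ≤ N := by positivity
  rw [e, abs_le]; constructor <;> linarith

theorem pnt (j : ℕ) (hj : 1 ≤ j) : ∃ C : ℝ, 0 < C ∧ ∀ N : ℕ, 4 ≤ N →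
    |PsiK 0 N| ≤ C * N / Real.log N ^ j := by
  obtain ⟨C, hC0, hC⟩ := PsiK_bound j hj
  refine ⟨14 * (2 ^ j * j.factorial) + 2 * C * 2 ^ (2 * j), by positivity, fun N hN => ?_⟩
  have hl := one_le_log (show 3 ≤ N by omega)
  have hNr : (4:ℝ) ≤ N := by exact_mod_cast hN
  obtain ⟨M, hM⟩ : ∃ M, M = Nat.sqrt N + 1 := ⟨_, rfl⟩
  have hs2 : 2 ≤ Nat.sqrt N := by rw [Nat.le_sqrt]; omega
  have hM3 : 3 ≤ M := by omega
  have hMN : M ≤ N := by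
    have := Nat.sqrt_lt_self (show 1 < N by omega)
    omega
  have hMs : (M:ℝ) ≤ 2 * Real.sqrt N := by
    have h1 : ((Nat.sqrt N : ℕ):ℝ) ≤ Real.sqrt N := Real.nat_sqrt_le_real_sqrt
    have h2 : (1:ℝ) ≤ Real.sqrt N := by rw [Real.one_le_sqrt]; linarith
    rw [hM]; push_cast; linarith
  have hMl : Real.log N / 2 ≤ Real.log M := by
    have : (N:ℝ) ≤ (M:ℝ) ^ 2 := by
      have := (Nat.lt_succ_sqrt N).le
      rw [Nat.succ_eq_add_one, ← hM] at this
      rw [sq]; exact_mod_cast this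
    have h2 := Real.log_le_log (by positivity) this
    rw [Real.log_pow] at h2
    push_cast at h2; linarith
  clear hM hs2
  obtain ⟨n, rfl⟩ := Nat.exists_eq_add_of_le hMN
  set L := Real.log (M + n : ℕ) with hL
  have hLM : 0 < Real.log M := by linarith
  -- split
  have hsplit : PsiK 0 (M + n) = PsiK 0 M + ∑ i ∈ Finset.range n,
      (Real.log (M + i : ℕ) ^ (2 * j))⁻¹ * aK (2 * j) (M + i) := by
    rw [PsiK, Finset.sum_range_add, PsiK]
    congr 1
    apply Finset.sum_congr rfl
    intro i _
    have : 0 < Real.log (M + i : ℕ) := Real.log_pos (by exact_mod_cast (by omega : 1 < M + i))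
    unfold aK
    field_simp
  have h2 := abel_antitone (fun i => aK (2 * j) (M + i))
    (fun i => (Real.log (M + i : ℕ) ^ (2 * j))⁻¹) (2 * C * (M + n : ℕ) * L ^ j) n ?_ ?_ ?_
  · have h1 := PsiK0_triv M
    have h3 : |PsiK 0 M| ≤ 14 * (2 ^ j * j.factorial) * (M + n : ℕ) / L ^ j := by
      refine h1.trans ?_
      rw [le_div_iff₀ (by positivity)]
      calc 7 * (M:ℝ) * L ^ j ≤ 7 * (2 * Real.sqrt (M + n : ℕ)) *
            (2 ^ j * j.factorial * Real.sqrt (M + n : ℕ)) := by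
            gcongr
            exact log_pow_le_sqrt j _ (by linarith)
        _ = 14 * (2 ^ j * j.factorial) * (Real.sqrt (M + n : ℕ) * Real.sqrt (M + n : ℕ)) := by ring
        _ = _ := by rw [Real.mul_self_sqrt (by positivity)]
    have h4 : 2 * C * (M + n : ℕ) * L ^ j * (Real.log (M + 0 : ℕ) ^ (2 * j))⁻¹ ≤
        2 * C * 2 ^ (2 * j) * (M + n : ℕ) / L ^ j := by
      have : (L / 2) ^ (2 * j) ≤ Real.log (M + 0 : ℕ) ^ (2 * j) := by
        rw [add_zero]; gcongr
      calc _ ≤ 2 * C * (M + n : ℕ) * L ^ j * ((L / 2) ^ (2 * j))⁻¹ := by gcongr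
        _ = _ := by
          rw [div_pow, two_mul j, pow_add L]; field_simp
    rw [hsplit]
    calc _ ≤ _ := abs_add_le _ _
      _ ≤ _ := add_le_add h3 (h2.trans h4)
      _ = _ := by ring
  · intro m hm
    have : ∑ i ∈ Finset.range m, aK (2 * j) (M + i) = PsiK (2 * j) (M + m) - PsiK (2 * j) M := by
      rw [PsiK, PsiK, Finset.sum_range_add]; ring
    rw [this]
    have mono : ∀ q : ℕ, 3 ≤ q → q ≤ M + n → |PsiK (2 * j) q| ≤ C * (M + n : ℕ) * L ^ j := by
      intro q hq hq2
      refine (hC q hq).trans ?_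
      have : 0 ≤ Real.log q := Real.log_natCast_nonneg _
      have hq0 : (0:ℝ) < q := by positivity
      have : Real.log q ≤ L := by
        rw [hL]; apply Real.log_le_log hq0; exact_mod_cast hq2
      gcongr
    have a1 := mono (M + m) (by omega) (by omega)
    have a2 := mono M (by omega) (by omega)
    calc _ ≤ _ := abs_sub _ _
      _ ≤ _ := add_le_add a1 a2
      _ = _ := by ring
  · intro i _
    have : 0 < Real.log (M + i : ℕ) := Real.log_pos (by exact_mod_cast (by omega : 1 < M + i))
    gcongr
    · omega
  · have : 0 ≤ Real.log (M + n : ℕ) := Real.log_natCast_nonneg _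
    positivity

end UDP

namespace UDP

lemma norm_e (x : ℝ) : ‖e x‖ = 1 := by
  have : (2 * Real.pi * Complex.I * x : ℂ) = ((2 * Real.pi * x : ℝ) : ℂ) * Complex.I := by
    push_cast; ring
  rw [e, this, Complex.norm_exp_ofReal_mul_I]

lemma e_add (x y : ℝ) : e (x + y) = e x * e y := by
  unfold e; rw [← Complex.exp_add]; push_cast; ring_nf

lemma e_neg (x : ℝ) : e (-x) = (starRingEnd ℂ) (e x) := by
  unfold e; rw [← Complex.exp_conj]; congr 1; simp [map_ofNat]

lemma e_int (n : ℤ) : e n = 1 := by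
  unfold e
  rw [Complex.exp_eq_one_iff]
  exact ⟨n, by push_cast; ring⟩

lemma e_zero : e 0 = 1 := by simp [e]

lemma e_sub (x y : ℝ) : e (x - y) = e x * (starRingEnd ℂ) (e y) := by
  rw [sub_eq_add_neg, e_add, e_neg]

/-- `1/(e δ - 1)` -/
def zt (δ : ℝ) : ℂ := -(1 / 2) - Complex.I / 2 * ((Real.cos (Real.pi * δ) / Real.sin (Real.pi * δ) : ℝ) : ℂ)

lemma zt_mul (δ : ℝ) (h : Real.sin (Real.pi * δ) ≠ 0) : zt δ * (e δ - 1) = 1 := by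
  have h1 : e δ = (1 - 2 * Real.sin (Real.pi * δ) ^ 2 : ℝ) +
      (2 * Real.sin (Real.pi * δ) * Real.cos (Real.pi * δ) : ℝ) * Complex.I := by
    have : (2 * Real.pi * Complex.I * δ : ℂ) = ((2 * (Real.pi * δ) : ℝ) : ℂ) * Complex.I := by
      push_cast; ring
    rw [e, this, Complex.exp_mul_I, ← Complex.ofReal_cos, ← Complex.ofReal_sin, Real.cos_two_mul,
      Real.sin_two_mul, Real.cos_sq']
    push_cast; ring
  have h2 := Real.sin_sq_add_cos_sq (Real.pi * δ)
  rw [h1, zt]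
  set s := Real.sin (Real.pi * δ)
  set c := Real.cos (Real.pi * δ)
  have hs : (s:ℂ) ≠ 0 := by exact_mod_cast h
  have h3 : (s:ℂ) ^ 2 + (c:ℂ) ^ 2 = 1 := by exact_mod_cast h2
  push_cast
  field_simp
  linear_combination (2 * (s:ℂ) ) * h3 + (-2 * c^2 * s) * Complex.I_sq

lemma sin_lower {θ δ : ℝ} (h1 : θ ≤ δ) (h2 : δ ≤ 1 - θ) (h0 : 0 < θ) :
    2 * θ ≤ Real.sin (Real.pi * δ) := by
  have hpi := Real.pi_pos
  rcases le_total δ (1 / 2) with h | h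
  · have := Real.mul_le_sin (x := Real.pi * δ) (by nlinarith) (by nlinarith)
    have e : 2 / Real.pi * (Real.pi * δ) = 2 * δ := by field_simp
    linarith
  · have := Real.mul_le_sin (x := Real.pi * (1 - δ)) (by nlinarith) (by nlinarith)
    have e : 2 / Real.pi * (Real.pi * (1 - δ)) = 2 * (1 - δ) := by field_simp
    have e2 : Real.sin (Real.pi * (1 - δ)) = Real.sin (Real.pi * δ) := by
      rw [mul_sub, mul_one, Real.sin_pi_sub]
    linarith

lemma cot_anti {a b : ℝ} (ha : 0 < a) (hab : a ≤ b) (hb : b < 1) :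
    Real.cos (Real.pi * b) / Real.sin (Real.pi * b) ≤ Real.cos (Real.pi * a) / Real.sin (Real.pi * a) := by
  have hpi := Real.pi_pos
  have sa : 0 < Real.sin (Real.pi * a) := Real.sin_pos_of_pos_of_lt_pi (by positivity) (by nlinarith)
  have sb : 0 < Real.sin (Real.pi * b) :=
    Real.sin_pos_of_pos_of_lt_pi (by nlinarith) (by nlinarith)
  rw [div_le_div_iff₀ sb sa]
  have : 0 ≤ Real.sin (Real.pi * b - Real.pi * a) :=
    Real.sin_nonneg_of_nonneg_of_le_pi (by nlinarith) (by nlinarith)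
  rw [Real.sin_sub] at this
  linarith

lemma cot_abs {θ δ : ℝ} (h1 : θ ≤ δ) (h2 : δ ≤ 1 - θ) (h0 : 0 < θ) :
    |Real.cos (Real.pi * δ) / Real.sin (Real.pi * δ)| ≤ 1 / (2 * θ) := by
  have := sin_lower h1 h2 h0
  rw [abs_div, abs_of_pos (by linarith : 0 < Real.sin (Real.pi * δ))]
  gcongr
  exact Real.abs_cos_le_one _

/-- Kusmin-Landau, discrete form. -/
lemma kl_discrete (g δ : ℕ → ℝ) (n : ℕ) (θ : ℝ) (h0 : 0 < θ) 
    (hδ : ∀ i < n, e (g (i + 1)) = e (g i) * e (δ i)) (hanti : Antitone δ)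
    (hlo : ∀ i, θ ≤ δ i) (hhi : ∀ i, δ i ≤ 1 - θ) :
    ‖∑ i ∈ Finset.range n, e (g i)‖ ≤ 3 / θ := by
  have hθ2 : θ ≤ 1 / 2 := by linarith [hlo 0, hhi 0]
  have hs : ∀ i, 0 < Real.sin (Real.pi * δ i) := fun i => by
    have := sin_lower (hlo i) (hhi i) h0; linarith
  set ct : ℕ → ℝ := fun i => Real.cos (Real.pi * δ i) / Real.sin (Real.pi * δ i) with hct
  have hcabs : ∀ i, |ct i| ≤ 1 / (2 * θ) := fun i => cot_abs (hlo i) (hhi i) h0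
  have e1 : ∑ i ∈ Finset.range n, e (g i) =
      ∑ i ∈ Finset.range n, zt (δ i) * (e (g (i + 1)) - e (g i)) := by
    apply Finset.sum_congr rfl
    intro i hi
    rw [hδ i (Finset.mem_range.1 hi)]
    have := zt_mul (δ i) (hs i).ne'
    linear_combination (- e (g i)) * this
  rw [e1]
  have hab := abel_bound (fun i => e (g (i + 1)) - e (g i)) (fun i => zt (δ i)) 2 n (by
    intro m _
    rw [Finset.sum_range_sub (fun i => e (g i))]
    refine (norm_sub_le _ _).trans ?_
    rw [norm_e, norm_e]; norm_num)
  refine hab.trans ?_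
  have hz : ‖zt (δ n)‖ ≤ 1 / 2 + 1 / (4 * θ) := by
    rw [zt]
    refine (norm_sub_le _ _).trans ?_
    have h1 := hcabs n
    rw [norm_mul, Complex.norm_real, Real.norm_eq_abs, norm_neg, norm_div, norm_div, Complex.norm_I,
      norm_one, Complex.norm_ofNat]
    have : 1 / (4 * θ) = 1 / 2 * (1 / (2 * θ)) := by field_simp; norm_num
    rw [this]
    gcongr
  have hd : ∑ i ∈ Finset.range n, ‖zt (δ (i + 1)) - zt (δ i)‖ ≤ 1 / (2 * θ) := by
    have : ∀ i ∈ Finset.range n, ‖zt (δ (i + 1)) - zt (δ i)‖ = 1 / 2 * (ct (i + 1) - ct i) := by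
      intro i _
      have h1 : zt (δ (i + 1)) - zt (δ i) = -(Complex.I / 2) * ((ct (i + 1) - ct i : ℝ) : ℂ) := by
        simp only [zt, hct]; push_cast; ring
      have h2 : ct i ≤ ct (i + 1) :=
        cot_anti (by linarith [hlo (i + 1)]) (hanti (Nat.le_succ i)) (by linarith [hhi i])
      rw [h1, norm_mul, Complex.norm_real, Real.norm_eq_abs, abs_of_nonneg (by linarith), norm_neg,
        norm_div, Complex.norm_I, Complex.norm_ofNat]
    rw [Finset.sum_congr rfl this, ← Finset.mul_sum, Finset.sum_range_sub]
    have a := abs_le.1 (hcabs n)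
    have b := abs_le.1 (hcabs 0)
    linarith
  have h3 : (1:ℝ) / 2 ≤ 1 / (4 * θ) := by
    rw [div_le_div_iff₀ (by norm_num) (by positivity)]; linarith
  have h4 : 3 / θ = 12 * (1 / (4 * θ)) := by field_simp; norm_num
  have h5 : 1 / (2 * θ) = 2 * (1 / (4 * θ)) := by field_simp; norm_num
  have h6 : 0 < 1 / (4 * θ) := by positivity
  rw [h4]; rw [h5] at hd
  linarith

/-- Kusmin-Landau with integer shift and hypotheses on a finite range only. -/
lemma kl_fin (g δ : ℕ → ℝ) (n : ℕ) (θ : ℝ) (ν : ℤ) (h0 : 0 < θ)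
    (hδ : ∀ i < n, g (i + 1) - g i = δ i) (hanti : ∀ i j, i ≤ j → j < n → δ j ≤ δ i)
    (hlo : ∀ i < n, ν + θ ≤ δ i) (hhi : ∀ i < n, δ i ≤ ν + 1 - θ) :
    ‖∑ i ∈ Finset.range n, e (g i)‖ ≤ 3 / θ := by
  rcases Nat.eq_zero_or_pos n with rfl | hn
  · simp; positivity
  have hm : ∀ i, min i (n - 1) < n := fun i => by omega
  refine kl_discrete g (fun i => δ (min i (n - 1)) - ν) n θ h0 ?_ ?_ ?_ ?_
  · intro i hi
    have : g (i + 1) = g i + (δ i - ν) + ν := by rw [← hδ i hi]; ring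
    rw [this, e_add, e_int, mul_one, e_add, min_eq_left (by omega)]
  · intro i j hij
    have := hanti (min i (n - 1)) (min j (n - 1)) (by omega) (hm j)
    simp only; linarith
  · intro i; have := hlo _ (hm i); linarith
  · intro i; have := hhi _ (hm i); linarith

lemma filter_antitone_interval (δ : ℕ → ℝ) (n : ℕ) (hanti : ∀ i j, i ≤ j → j < n → δ j ≤ δ i)
    (J : Set ℝ) (hJ : J.OrdConnected) [DecidablePred fun i => δ i ∈ J] :
    ∃ a b : ℕ, a + b ≤ n ∧ (Finset.range n).filter (fun i => δ i ∈ J) = Finset.Ico a (a + b) := by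
  rcases ((Finset.range n).filter (fun i => δ i ∈ J)).eq_empty_or_nonempty with h | h
  · exact ⟨0, 0, by omega, by simpa using h⟩
  · set s := (Finset.range n).filter (fun i => δ i ∈ J) with hs
    have h1 := s.min'_mem h
    have h2 := s.max'_mem h
    have h3 : s.min' h ≤ s.max' h := s.min'_le _ h2
    have h2' := Finset.mem_filter.1 h2
    have h1' := Finset.mem_filter.1 h1
    have h4 := Finset.mem_range.1 h2'.1
    refine ⟨s.min' h, s.max' h + 1 - s.min' h, by omega, ?_⟩
    ext i
    rw [Finset.mem_Ico]
    constructor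
    · intro hi
      have := s.min'_le _ hi
      have := s.le_max' _ hi
      omega
    · intro hi
      rw [hs, Finset.mem_filter, Finset.mem_range]
      refine ⟨by omega, ?_⟩
      exact hJ.out h2'.2 h1'.2 ⟨hanti _ _ (by omega) h4, hanti _ _ hi.1 (by omega)⟩

lemma sum_Ico_shift (F : ℕ → ℂ) (a b : ℕ) :
    ∑ i ∈ Finset.Ico a (a + b), F i = ∑ i ∈ Finset.range b, F (a + i) := by
  rw [Finset.sum_Ico_eq_sum_range]; simp

/-- discrete second derivative test -/
lemma second_discrete (g δ : ℕ → ℝ) (n : ℕ) (lam Lam : ℝ) (h0 : 0 < lam) (h1 : lam ≤ 1 / 4)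
    (hLam : 0 ≤ Lam) (hδ : ∀ i < n, g (i + 1) - g i = δ i)
    (hlo : ∀ i, i + 1 < n → lam ≤ δ i - δ (i + 1)) (hhi : ∀ i, i + 1 < n → δ i - δ (i + 1) ≤ Lam) :
    ‖∑ i ∈ Finset.range n, e (g i)‖ ≤ (Lam * n + 2) * (7 / Real.sqrt lam) := by
  classical
  rcases Nat.eq_zero_or_pos n with rfl | hn
  · simp; positivity
  set θ := Real.sqrt lam with hθ
  have hθ0 : 0 < θ := Real.sqrt_pos.2 h0
  have hθsq : θ * θ = lam := Real.mul_self_sqrt h0.le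
  have hθ2 : θ ≤ 1 / 2 := by nlinarith
  have hdiff : ∀ k i, i + k < n → lam * k ≤ δ i - δ (i + k) ∧ δ i - δ (i + k) ≤ Lam * k := by
    intro k
    induction k with
    | zero => intro i _; simp
    | succ k ih =>
      intro i hi
      have a := ih i (by omega)
      have b := hlo (i + k) (by omega)
      have c := hhi (i + k) (by omega)
      rw [← add_assoc] 
      push_cast
      constructor <;> linarith
  have hanti : ∀ i j, i ≤ j → j < n → δ j ≤ δ i := by
    intro i j hij hj
    obtain ⟨k, rfl⟩ := Nat.exists_eq_add_of_le hij
    have := (hdiff k i hj).1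
    have : 0 ≤ lam * k := by positivity
    linarith
  -- counting
  have hcount : ∀ J : Set ℝ, J.OrdConnected → ∀ len : ℝ, (∀ x ∈ J, ∀ y ∈ J, x - y ≤ len) → 0 ≤ len →
      ∀ [DecidablePred fun i => δ i ∈ J], ‖∑ i ∈ (Finset.range n).filter (fun i => δ i ∈ J), e (g i)‖ ≤ len / lam + 1 := by
    intro J hJ len hlen hl0 _
    obtain ⟨a, b, hab, hfil⟩ := filter_antitone_interval δ n hanti J hJ
    have hcard : (b:ℝ) ≤ len / lam + 1 := by
      rcases Nat.eq_zero_or_pos b with rfl | hb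
      · simp; positivity
      · have m1 : a ∈ (Finset.range n).filter (fun i => δ i ∈ J) := by
          rw [hfil, Finset.mem_Ico]; omega
        have m2 : a + (b - 1) ∈ (Finset.range n).filter (fun i => δ i ∈ J) := by
          rw [hfil, Finset.mem_Ico]; omega
        have := hlen _ (Finset.mem_filter.1 m1).2 _ (Finset.mem_filter.1 m2).2
        have h3 := (hdiff (b - 1) a (by omega)).1
        rw [Nat.cast_sub hb, Nat.cast_one] at h3
        rw [← sub_le_iff_le_add, le_div_iff₀ h0]
        linarith
    rw [hfil]
    refine (norm_sum_le _ _).trans ?_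
    simp only [norm_e, Finset.sum_const, Nat.card_Ico, nsmul_eq_mul, mul_one]
    simpa using hcard
  have hmid : ∀ ν : ℤ, ‖∑ i ∈ (Finset.range n).filter (fun i => δ i ∈ Set.Icc (ν + θ) (ν + 1 - θ)),
      e (g i)‖ ≤ 3 / θ := by
    intro ν
    obtain ⟨a, b, hab, hfil⟩ := filter_antitone_interval δ n hanti _
      (Set.ordConnected_Icc (a := (ν + θ : ℝ)) (b := ν + 1 - θ))
    have hmem : ∀ i < b, δ (a + i) ∈ Set.Icc (ν + θ) (ν + 1 - θ) := by
      intro i hi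
      have : a + i ∈ Finset.Ico a (a + b) := by rw [Finset.mem_Ico]; omega
      rw [← hfil] at this
      exact (Finset.mem_filter.1 this).2
    rw [hfil, sum_Ico_shift]
    exact kl_fin (fun i => g (a + i)) (fun i => δ (a + i)) b θ ν hθ0
      (fun i hi => hδ (a + i) (by omega)) (fun i j hij hj => hanti _ _ (by omega) (by omega))
      (fun i hi => (hmem i hi).1) (fun i hi => (hmem i hi).2)
  have hfib : ∀ ν : ℤ, ‖∑ i ∈ (Finset.range n).filter (fun i => ⌊δ i⌋ = ν), e (g i)‖ ≤ 7 / θ := by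
    intro ν
    have hdec : ∑ i ∈ (Finset.range n).filter (fun i => ⌊δ i⌋ = ν), e (g i) =
        ∑ i ∈ (Finset.range n).filter (fun i => δ i ∈ Set.Ico (ν:ℝ) (ν + θ)), e (g i) +
        ∑ i ∈ (Finset.range n).filter (fun i => δ i ∈ Set.Icc (ν + θ) (ν + 1 - θ)), e (g i) +
        ∑ i ∈ (Finset.range n).filter (fun i => δ i ∈ Set.Ioo (ν + 1 - θ) (ν + 1 : ℝ)), e (g i) := by
      simp only [Finset.sum_filter]
      rw [← Finset.sum_add_distrib, ← Finset.sum_add_distrib]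
      apply Finset.sum_congr rfl
      intro i _
      simp only [Int.floor_eq_iff, Set.mem_Ico, Set.mem_Icc, Set.mem_Ioo]
      clear hdiff hanti hcount hmid hlo hhi hδ
      split_ifs <;> first | simp; done | (exfalso; grind)
    rw [hdec]
    have a1 := hcount (Set.Ico (ν:ℝ) (ν + θ)) Set.ordConnected_Ico θ
      (fun x hx y hy => by linarith [hx.2, hy.1]) hθ0.le
    have a2 := hmid ν
    have a3 := hcount (Set.Ioo (ν + 1 - θ) (ν + 1 : ℝ)) Set.ordConnected_Ioo θ
      (fun x hx y hy => by linarith [hx.2, hy.1]) hθ0.le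
    have e1 : θ / lam = 1 / θ := by rw [← hθsq]; field_simp
    rw [e1] at a1 a3
    have e2 : (1:ℝ) ≤ 1 / θ := by rw [le_div_iff₀ hθ0]; linarith
    have e3 : 7 / θ = 7 * (1 / θ) := by ring
    have e4 : 3 / θ = 3 * (1 / θ) := by ring
    rw [e4] at a2; rw [e3]
    refine (norm_add_le _ _).trans ?_
    have := norm_add_le (∑ i ∈ (Finset.range n).filter (fun i => δ i ∈ Set.Ico (ν:ℝ) (ν + θ)), e (g i)) (∑ i ∈ (Finset.range n).filter (fun i => δ i ∈ Set.Icc (ν + θ) (ν + 1 - θ)), e (g i))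
    linarith
  have hmaps : ∀ i ∈ Finset.range n, ⌊δ i⌋ ∈ Finset.Icc ⌊δ (n - 1)⌋ ⌊δ 0⌋ := by
    intro i hi
    have hi := Finset.mem_range.1 hi
    rw [Finset.mem_Icc]
    exact ⟨Int.floor_le_floor (hanti i (n - 1) (by omega) (by omega)),
      Int.floor_le_floor (hanti 0 i (by omega) hi)⟩
  rw [← Finset.sum_fiberwise_of_maps_to hmaps]
  refine (norm_sum_le _ _).trans ((Finset.sum_le_sum fun ν _ => hfib ν).trans ?_)
  rw [Finset.sum_const, nsmul_eq_mul]
  gcongr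
  rw [Int.card_Icc]
  have h5 := hdiff (n - 1) 0 (by omega)
  rw [zero_add] at h5
  have h6 := hanti 0 (n - 1) (by omega) (by omega)
  have h7 : 0 ≤ ⌊δ 0⌋ + 1 - ⌊δ (n - 1)⌋ := by have := Int.floor_le_floor h6; omega
  have h8 : (((⌊δ 0⌋ + 1 - ⌊δ (n - 1)⌋).toNat : ℕ) : ℝ) = (⌊δ 0⌋:ℝ) + 1 - ⌊δ (n - 1)⌋ := by
    have := Int.toNat_of_nonneg h7
    rw [← Int.cast_natCast, this]; push_cast; ring
  rw [h8]
  have h9 := Int.floor_le (δ 0)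
  have h10 := Int.lt_floor_add_one (δ (n - 1))
  have h11 : Lam * ((n - 1 : ℕ) : ℝ) ≤ Lam * n := by
    gcongr; omega
  linarith [h5.2]

end UDP

namespace UDP

lemma sum_Ioc_shift (F : ℕ → ℂ) (A n : ℕ) :
    ∑ k ∈ Finset.Ioc A (A + n), F k = ∑ i ∈ Finset.range n, F (A + 1 + i) := by
  have : Finset.Ioc A (A + n) = Finset.Ico (A + 1) (A + 1 + n) := by
    ext; simp only [Finset.mem_Ioc, Finset.mem_Ico]; omega
  rw [this, sum_Ico_shift]

lemma mvt (G G' : ℝ → ℝ) (a b : ℝ) (hab : a < b)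
    (hG : ∀ x ∈ Set.Icc a b, HasDerivAt G (G' x) x) :
    ∃ c ∈ Set.Ioo a b, G b - G a = G' c * (b - a) := by
  obtain ⟨c, hc, h⟩ := exists_hasDerivAt_eq_slope G G' hab
    (fun x hx => (hG x hx).continuousAt.continuousWithinAt)
    (fun x hx => hG x (Set.Ioo_subset_Icc_self hx))
  refine ⟨c, hc, ?_⟩
  have : b - a ≠ 0 := by linarith
  rw [h]; field_simp

lemma kl_cont (G G' : ℝ → ℝ) (A B : ℕ) (θ : ℝ) (h0 : 0 < θ) (h12 : θ ≤ 1 / 2)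
    (hG : ∀ x ∈ Set.Icc (A:ℝ) B, HasDerivAt G (G' x) x)
    (hanti : AntitoneOn G' (Set.Icc (A:ℝ) B))
    (hlo : ∀ x ∈ Set.Icc (A:ℝ) B, θ ≤ G' x) (hhi : ∀ x ∈ Set.Icc (A:ℝ) B, G' x ≤ 1 / 2) :
    ‖∑ k ∈ Finset.Ioc A B, e (G k)‖ ≤ 4 / θ := by
  rcases Nat.lt_or_ge A B with hAB | hAB
  swap
  · rw [Finset.Ioc_eq_empty (by omega)]; simp; positivity
  obtain ⟨n, rfl⟩ : ∃ n, B = A + (n + 1) := ⟨B - A - 1, by omega⟩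
  rw [sum_Ioc_shift, Finset.sum_range_succ]
  have hmv : ∀ i : ℕ, ∃ c : ℝ, i < n → c ∈ Set.Ioo ((A:ℝ) + 1 + i) (A + 1 + (i + 1)) ∧
      G ((A + 1 + (i + 1) : ℕ) : ℝ) - G ((A + 1 + i : ℕ) : ℝ) = G' c := by
    intro i
    by_cases hi : i < n
    · have hi' : (i:ℝ) + 1 ≤ n := by exact_mod_cast hi
      obtain ⟨c, hc, h⟩ := mvt G G' ((A:ℝ) + 1 + i) (A + 1 + (i + 1)) (by linarith) (by
        intro x hx
        apply hG
        push_cast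
        exact ⟨by linarith [hx.1, (Nat.cast_nonneg i : (0:ℝ) ≤ i)], by linarith [hx.2]⟩)
      refine ⟨c, fun _ => ⟨hc, ?_⟩⟩
      push_cast
      rw [h]; ring
    · exact ⟨0, fun h => absurd h hi⟩
  choose c hc using hmv
  have hcm : ∀ i < n, c i ∈ Set.Icc (A:ℝ) (A + (n + 1) : ℕ) := by
    intro i hi
    have hi' : (i:ℝ) + 1 ≤ n := by exact_mod_cast hi
    have := (hc i hi).1
    push_cast
    exact ⟨by linarith [this.1, (Nat.cast_nonneg i : (0:ℝ) ≤ i)], by linarith [this.2]⟩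
  have h1 := kl_fin (fun i => G ((A + 1 + i : ℕ) : ℝ)) (fun i => G' (c i)) n θ 0 h0
    (fun i hi => (hc i hi).2) (by
      intro i j hij hj
      rcases hij.eq_or_lt with rfl | hij
      · exact le_rfl
      · apply hanti (hcm i (by omega)) (hcm j hj)
        have a := (hc i (by omega)).1.2
        have b := (hc j hj).1.1
        have : (i:ℝ) + 1 ≤ j := by exact_mod_cast hij
        linarith)
    (fun i hi => by simpa using hlo _ (hcm i hi))
    (fun i hi => by have := hhi _ (hcm i hi); simp; linarith)
  refine (norm_add_le _ _).trans ?_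
  rw [norm_e]
  have h2 : 1 ≤ 1 / θ := by rw [le_div_iff₀ h0]; linarith
  have h3 : 4 / θ = 3 / θ + 1 / θ := by ring
  rw [h3]; exact add_le_add h1 h2

lemma second_cont (G G' G'' : ℝ → ℝ) (A B : ℕ) (lam Lam : ℝ) (h0 : 0 < lam) (h1 : lam ≤ 1 / 4)
    (hLam : 0 ≤ Lam) (hAB0 : A ≤ B)
    (hG : ∀ x ∈ Set.Icc (A:ℝ) B, HasDerivAt G (G' x) x)
    (hG' : ∀ x ∈ Set.Icc (A:ℝ) B, HasDerivAt G' (G'' x) x)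
    (hlo : ∀ x ∈ Set.Icc (A:ℝ) B, lam ≤ -G'' x) (hhi : ∀ x ∈ Set.Icc (A:ℝ) B, -G'' x ≤ Lam) :
    ‖∑ k ∈ Finset.Ioc A B, e (G k)‖ ≤ (Lam * ((B:ℝ) - A) + 3) * (7 / Real.sqrt lam) := by
  have hs0 : 0 < Real.sqrt lam := Real.sqrt_pos.2 h0
  have hs1 : Real.sqrt lam ≤ 1 / 2 := by
    rw [Real.sqrt_le_left (by norm_num)]; linarith
  rcases Nat.lt_or_ge A B with hAB | hAB
  swap
  · rw [Finset.Ioc_eq_empty (by omega)]; simp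
    have h : A = B := by omega
    subst h; simp; positivity
  obtain ⟨n, rfl⟩ : ∃ n, B = A + (n + 1) := ⟨B - A - 1, by omega⟩
  rw [sum_Ioc_shift, Finset.sum_range_succ]
  have hmv : ∀ i : ℕ, i + 1 < n → ∃ c ∈ Set.Icc (A:ℝ) (A + (n + 1) : ℕ),
      (G ((A + 1 + (i + 1) : ℕ) : ℝ) - G ((A + 1 + i : ℕ) : ℝ)) -
      (G ((A + 1 + (i + 1 + 1) : ℕ) : ℝ) - G ((A + 1 + (i + 1) : ℕ) : ℝ)) = - G'' c := by
    intro i hi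
    have hi' : (i:ℝ) + 1 + 1 ≤ n := by exact_mod_cast hi
    have hi0 : (0:ℝ) ≤ i := Nat.cast_nonneg i
    obtain ⟨c, hc, h⟩ := mvt (fun x => G (x + 1) - G x) (fun x => G' (x + 1) - G' x)
        ((A:ℝ) + 1 + i) (A + 1 + (i + 1)) (by linarith) (by
        intro x hx
        have e1 := (hG (x + 1) (by push_cast; exact ⟨by linarith [hx.1], by linarith [hx.2]⟩)).comp_add_const x 1
        exact e1.sub (hG x (by push_cast; exact ⟨by linarith [hx.1], by linarith [hx.2]⟩)))
    obtain ⟨d, hd, h'⟩ := mvt G' G'' c (c + 1) (by linarith) (by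
        intro x hx
        apply hG'
        push_cast; exact ⟨by linarith [hx.1, hc.1], by linarith [hx.2, hc.2]⟩)
    refine ⟨d, by push_cast; exact ⟨by linarith [hd.1, hc.1], by linarith [hd.2, hc.2]⟩, ?_⟩
    have e2 : (A:ℝ) + 1 + (i + 1) - (A + 1 + i) = 1 := by ring
    simp only [e2, mul_one] at h
    have e3 : c + 1 - c = 1 := by ring
    rw [e3, mul_one] at h'
    rw [← h', ← h]
    push_cast
    ring_nf
  have h2 := second_discrete (fun i => G ((A + 1 + i : ℕ) : ℝ))
    (fun i => G ((A + 1 + (i + 1) : ℕ) : ℝ) - G ((A + 1 + i : ℕ) : ℝ)) n lam Lam h0 h1 hLam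
    (fun i _ => rfl)
    (fun i hi => by obtain ⟨c, hc, h⟩ := hmv i hi; rw [h]; exact hlo c hc)
    (fun i hi => by obtain ⟨c, hc, h⟩ := hmv i hi; rw [h]; exact hhi c hc)
  refine (norm_add_le _ _).trans ?_
  rw [norm_e]
  have h3 : 1 ≤ 7 / Real.sqrt lam := by rw [le_div_iff₀ hs0]; linarith
  have h4 : (Lam * n + 2) * (7 / Real.sqrt lam) + 7 / Real.sqrt lam ≤
      (Lam * (((A + (n + 1) : ℕ):ℝ) - A) + 3) * (7 / Real.sqrt lam) := by
    push_cast
    have : 0 ≤ Lam * (7 / Real.sqrt lam) := by positivity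
    nlinarith
  linarith

end UDP

namespace UDP
open ArithmeticFunction (vonMangoldt moebius)

/-- restriction of an arithmetic function to arguments `≤ U` -/
def tle (f : ArithmeticFunction ℝ) (U : ℕ) : ArithmeticFunction ℝ :=
  ⟨fun n => if n ≤ U then f n else 0, by simp⟩

def tgt (f : ArithmeticFunction ℝ) (U : ℕ) : ArithmeticFunction ℝ :=
  ⟨fun n => if n ≤ U then 0 else f n, by simp⟩

lemma tle_apply (f : ArithmeticFunction ℝ) (U n : ℕ) : tle f U n = if n ≤ U then f n else 0 := rfl
lemma tgt_apply (f : ArithmeticFunction ℝ) (U n : ℕ) : tgt f U n = if n ≤ U then 0 else f n := rfl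

lemma tle_add_tgt (f : ArithmeticFunction ℝ) (U : ℕ) : tle f U + tgt f U = f := by
  ext n
  rw [ArithmeticFunction.add_apply, tle_apply, tgt_apply]
  split_ifs <;> simp

abbrev muR : ArithmeticFunction ℝ := ((moebius : ArithmeticFunction ℤ) : ArithmeticFunction ℝ)
abbrev oneR : ArithmeticFunction ℝ := ((ArithmeticFunction.zeta : ArithmeticFunction ℕ) : ArithmeticFunction ℝ)

lemma vaughan (U V : ℕ) : (vonMangoldt : ArithmeticFunction ℝ) = tle vonMangoldt V +
    tle muR U * ArithmeticFunction.log - (tle muR U * tle vonMangoldt V) * oneR +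
    tgt vonMangoldt V * (tgt muR U * oneR) := by
  have h1 := tle_add_tgt vonMangoldt V
  have h2 := tle_add_tgt muR U
  have h3 : muR * oneR = 1 := ArithmeticFunction.coe_moebius_mul_coe_zeta
  have h4 : vonMangoldt * oneR = ArithmeticFunction.log := ArithmeticFunction.vonMangoldt_mul_zeta
  rw [← h4]
  set a := tle vonMangoldt V
  set b := tgt vonMangoldt V
  set c := tle muR U
  set d := tgt muR U
  rw [← h1]
  have h5 : (c + d) * oneR = 1 := by rw [h2]; exact h3
  linear_combination (-b) * h5

/-- rearrangement of convolution sums -/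
lemma conv_sum (f g : ArithmeticFunction ℝ) (F : ℕ → ℂ) (X Y : ℕ) :
    ∑ n ∈ Finset.Ioc X Y, ((f * g) n : ℂ) * F n =
      ∑ a ∈ Finset.Icc 1 Y, (f a : ℂ) * ∑ b ∈ Finset.Ioc (X / a) (Y / a), (g b : ℂ) * F (a * b) := by
  have h1 : ∀ n ∈ Finset.Ioc X Y, (((f * g) n : ℝ) : ℂ) * F n =
      ∑ p ∈ n.divisorsAntidiagonal, (f p.1 : ℂ) * ((g p.2 : ℂ) * F (p.1 * p.2)) := by
    intro n hn
    rw [ArithmeticFunction.mul_apply]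
    push_cast
    rw [Finset.sum_mul]
    apply Finset.sum_congr rfl
    intro p hp
    rw [(Nat.mem_divisorsAntidiagonal.1 hp).1]; ring
  rw [Finset.sum_congr rfl h1]
  simp only [Finset.mul_sum]
  rw [Finset.sum_sigma', Finset.sum_sigma']
  refine Finset.sum_bij' (fun x _ => ⟨x.2.1, x.2.2⟩) (fun y _ => ⟨y.1 * y.2, (y.1, y.2)⟩) ?_ ?_ ?_ ?_ ?_
  · rintro ⟨n, a, b⟩ h
    simp only [Finset.mem_sigma, Finset.mem_Ioc, Nat.mem_divisorsAntidiagonal, Finset.mem_Icc] at h ⊢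
    obtain ⟨⟨h1, h2⟩, h3, h4⟩ := h
    subst h3
    have ha : 0 < a := Nat.pos_of_ne_zero (by rintro rfl; simp at h4)
    have hb : 0 < b := Nat.pos_of_ne_zero (by rintro rfl; simp at h4)
    refine ⟨⟨ha, ?_⟩, ?_, ?_⟩
    · nlinarith
    · rw [Nat.div_lt_iff_lt_mul ha, mul_comm]; exact h1
    · rw [Nat.le_div_iff_mul_le ha, mul_comm]; exact h2
  · rintro ⟨a, b⟩ h
    simp only [Finset.mem_sigma, Finset.mem_Ioc, Nat.mem_divisorsAntidiagonal, Finset.mem_Icc] at h ⊢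
    obtain ⟨⟨h1, h2⟩, h3, h4⟩ := h
    rw [Nat.div_lt_iff_lt_mul (by omega), mul_comm] at h3
    rw [Nat.le_div_iff_mul_le (by omega), mul_comm] at h4
    exact ⟨⟨h3, h4⟩, trivial, by omega⟩
  · rintro ⟨n, a, b⟩ h
    simp only [Finset.mem_sigma, Finset.mem_Ioc, Nat.mem_divisorsAntidiagonal] at h
    obtain ⟨_, h3, _⟩ := h
    subst h3; rfl
  · rintro ⟨a, b⟩ h; rfl
  · rintro ⟨n, a, b⟩ h; rfl

lemma harmonic_le (n : ℕ) (x : ℝ) (hx : (n:ℝ) ≤ x) (h1 : 1 ≤ x) :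
    ∑ m ∈ Finset.Icc 1 n, 1 / (m:ℝ) ≤ 1 + Real.log x := by
  have h := harmonic_le_one_add_log n
  have e : ((harmonic n : ℚ) : ℝ) = ∑ m ∈ Finset.Icc 1 n, 1 / (m:ℝ) := by
    rw [harmonic_eq_sum_Icc]; push_cast; simp
  rw [← e]
  refine h.trans ?_
  rcases Nat.eq_zero_or_pos n with rfl | hn
  · simp; exact Real.log_nonneg h1
  · gcongr

/-- first type I sum -/
lemma typeI_log (F : ℕ → ℂ) (X U : ℕ) (η : ℝ) (hη : 0 ≤ η) (hX : 1 ≤ X) (hU : U ≤ X)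
    (hI : ∀ m A B : ℕ, 1 ≤ m → m ≤ U → X ≤ 2 * m * A → A ≤ B → m * B ≤ 2 * X →
      ‖∑ k ∈ Finset.Ioc A B, F (m * k)‖ ≤ η * X / m) :
    ‖∑ n ∈ Finset.Ioc X (2 * X), (((tle muR U * ArithmeticFunction.log) n : ℝ) : ℂ) * F n‖ ≤
      2 * η * X * (1 + Real.log (2 * X)) ^ 2 := by
  have hXr : (1:ℝ) ≤ X := by exact_mod_cast hX
  set Lg := 1 + Real.log (2 * X) with hLg
  have hlog0 : 0 ≤ Real.log (2 * X) := Real.log_nonneg (by linarith)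
  rw [conv_sum]
  have hin : ∀ m : ℕ, 1 ≤ m → m ≤ U →
      ‖∑ b ∈ Finset.Ioc (X / m) (2 * X / m), ((ArithmeticFunction.log b : ℝ) : ℂ) * F (m * b)‖ ≤
        η * X / m * (2 * Lg) := by
    intro m hm hmU
    obtain ⟨n, hn⟩ : ∃ n, 2 * X / m = X / m + n := Nat.exists_eq_add_of_le
      (Nat.div_le_div_right (by omega))
    have hXm : 1 ≤ X / m := (Nat.le_div_iff_mul_le hm).2 (by omega)
    rw [hn, sum_Ioc_shift]
    have h2 : m * (2 * X / m) ≤ 2 * X := Nat.mul_div_le _ _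
    have hab := abel_bound (fun i => F (m * (X / m + 1 + i)))
      (fun i => ((Real.log (min (X / m + 1 + i) (2 * X) : ℕ) : ℝ) : ℂ)) (η * X / m) n (by
        intro j hj
        rw [← sum_Ioc_shift (fun k => F (m * k))]
        apply hI m _ _ hm hmU
        · have := Nat.lt_mul_div_succ X hm
          nlinarith
        · omega
        · have : m * (X / m + j) ≤ m * (X / m + n) := by gcongr
          rw [hn] at h2; omega)
    have e1 : ∑ i ∈ Finset.range n, ((ArithmeticFunction.log (X / m + 1 + i) : ℝ) : ℂ) * F (m * (X / m + 1 + i))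
      = ∑ i ∈ Finset.range n, ((Real.log (min (X / m + 1 + i) (2 * X) : ℕ) : ℝ) : ℂ) * F (m * (X / m + 1 + i)) := by
      apply Finset.sum_congr rfl
      intro i hi
      have := Finset.mem_range.1 hi
      have : 2 * X / m ≤ 2 * X := Nat.div_le_self _ _
      rw [min_eq_left (by omega), ArithmeticFunction.log_apply]
    rw [e1]
    refine hab.trans ?_
    gcongr
    set cc : ℕ → ℝ := fun i => Real.log (min (X / m + 1 + i) (2 * X) : ℕ) with hcc
    have hcb : ∀ i, 0 ≤ cc i ∧ cc i ≤ Real.log (2 * X) := by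
      intro i
      refine ⟨Real.log_natCast_nonneg _, ?_⟩
      apply Real.log_le_log
      · have : 0 < min (X / m + 1 + i) (2 * X) := by omega
        exact_mod_cast this
      · have : min (X / m + 1 + i) (2 * X) ≤ 2 * X := min_le_right _ _
        exact_mod_cast this
    have hsum : ∑ i ∈ Finset.range n, ‖((cc (i + 1) : ℝ) : ℂ) - ((cc i : ℝ) : ℂ)‖ = cc n - cc 0 := by
      rw [← Finset.sum_range_sub]
      apply Finset.sum_congr rfl
      intro i _
      rw [← Complex.ofReal_sub, Complex.norm_real, Real.norm_eq_abs, abs_of_nonneg]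
      rw [sub_nonneg]
      apply Real.log_le_log
      · have : 0 < min (X / m + 1 + i) (2 * X) := by omega
        exact_mod_cast this
      · have : min (X / m + 1 + i) (2 * X) ≤ min (X / m + 1 + (i + 1)) (2 * X) := by omega
        exact_mod_cast this
    have hnn : ‖((cc n : ℝ) : ℂ)‖ = cc n := by
      rw [Complex.norm_real, Real.norm_eq_abs, abs_of_nonneg (hcb n).1]
    change ‖((cc n : ℝ) : ℂ)‖ + ∑ i ∈ Finset.range n, ‖((cc (i + 1) : ℝ) : ℂ) - ((cc i : ℝ) : ℂ)‖ ≤ _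
    rw [hsum, hnn]
    have := hcb n; have := hcb 0
    rw [hLg]; linarith
  calc _ ≤ ∑ a ∈ Finset.Icc 1 (2 * X), ‖((tle muR U a : ℝ) : ℂ) * ∑ b ∈ Finset.Ioc (X / a) (2 * X / a), ((ArithmeticFunction.log b : ℝ) : ℂ) * F (a * b)‖ := norm_sum_le _ _
    _ ≤ ∑ a ∈ Finset.Icc 1 (2 * X), if a ≤ U then η * X / a * (2 * Lg) else 0 := by
      apply Finset.sum_le_sum
      intro a ha
      have ha := Finset.mem_Icc.1 ha
      rw [norm_mul, tle_apply]
      split_ifs with h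
      · have hmu : ‖((muR a : ℝ) : ℂ)‖ ≤ 1 := by
          rw [Complex.norm_real, ArithmeticFunction.intCoe_apply, Real.norm_eq_abs]
          exact_mod_cast ArithmeticFunction.abs_moebius_le_one
        calc _ ≤ 1 * (η * X / a * (2 * Lg)) := by
              gcongr
              exact hin a ha.1 h
          _ = _ := one_mul _
      · simp
    _ ≤ ∑ a ∈ Finset.Icc 1 U, η * X / a * (2 * Lg) := by
      rw [← Finset.sum_filter]
      apply Finset.sum_le_sum_of_subset_of_nonneg
      · intro a ha; simp at ha ⊢; omega
      · intro a _ _; positivity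
    _ = 2 * η * X * Lg * ∑ a ∈ Finset.Icc 1 U, 1 / (a:ℝ) := by
      rw [Finset.mul_sum]; apply Finset.sum_congr rfl; intro a _; ring
    _ ≤ 2 * η * X * Lg * Lg := by
      gcongr
      apply harmonic_le U (2 * X) _ (by linarith)
      have : (U:ℝ) ≤ X := by exact_mod_cast hU
      linarith
    _ = _ := by ring

end UDP

namespace UDP
open ArithmeticFunction (vonMangoldt moebius)

lemma muR_abs (a : ℕ) : |muR a| ≤ 1 := by
  rw [ArithmeticFunction.intCoe_apply]
  exact_mod_cast ArithmeticFunction.abs_moebius_le_one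

def gam (U V : ℕ) : ArithmeticFunction ℝ := tle muR U * tle vonMangoldt V

lemma gam_abs (U V m : ℕ) : |gam U V m| ≤ Real.log m := by
  rw [gam, ArithmeticFunction.mul_apply]
  have h : ∑ p ∈ m.divisorsAntidiagonal, vonMangoldt p.2 = Real.log m := by
    rw [Nat.sum_divisorsAntidiagonal' (fun _ b => vonMangoldt b), ArithmeticFunction.vonMangoldt_sum]
  rw [← h]
  refine (Finset.abs_sum_le_sum_abs _ _).trans (Finset.sum_le_sum fun p _ => ?_)
  rw [abs_mul, tle_apply, tle_apply]
  have h0 : 0 ≤ vonMangoldt p.2 := ArithmeticFunction.vonMangoldt_nonneg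
  have h1 := muR_abs p.1
  rw [ArithmeticFunction.intCoe_apply] at h1
  split_ifs <;> simp [abs_of_nonneg h0, h0]
  exact mul_le_of_le_one_left h0 h1

lemma gam_zero (U V m : ℕ) (h : U * V < m) : gam U V m = 0 := by
  rw [gam, ArithmeticFunction.mul_apply]
  apply Finset.sum_eq_zero
  intro p hp
  have := (Nat.mem_divisorsAntidiagonal.1 hp).1
  rw [tle_apply, tle_apply]
  split_ifs with h1 h2 <;> simp
  exfalso
  have : p.1 * p.2 ≤ U * V := by gcongr
  omega

lemma typeI_gam (F : ℕ → ℂ) (X U V : ℕ) (η : ℝ) (hη : 0 ≤ η) (hX : 1 ≤ X) (hU : U * V ≤ X)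
    (hI : ∀ m A B : ℕ, 1 ≤ m → m ≤ U * V → X ≤ 2 * m * A → A ≤ B → m * B ≤ 2 * X →
      ‖∑ k ∈ Finset.Ioc A B, F (m * k)‖ ≤ η * X / m) :
    ‖∑ n ∈ Finset.Ioc X (2 * X), (((gam U V * oneR) n : ℝ) : ℂ) * F n‖ ≤
      η * X * (1 + Real.log (2 * X)) ^ 2 := by
  have hXr : (1:ℝ) ≤ X := by exact_mod_cast hX
  set Lg := 1 + Real.log (2 * X) with hLg
  have hlog0 : 0 ≤ Real.log (2 * X) := Real.log_nonneg (by linarith)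
  rw [conv_sum]
  have hin : ∀ m : ℕ, 1 ≤ m → m ≤ U * V →
      ‖∑ b ∈ Finset.Ioc (X / m) (2 * X / m), ((oneR b : ℝ) : ℂ) * F (m * b)‖ ≤ η * X / m := by
    intro m hm hmU
    have hXm : 1 ≤ X / m := (Nat.le_div_iff_mul_le hm).2 (by omega)
    have e1 : ∑ b ∈ Finset.Ioc (X / m) (2 * X / m), ((oneR b : ℝ) : ℂ) * F (m * b) =
      ∑ b ∈ Finset.Ioc (X / m) (2 * X / m), F (m * b) := by
      apply Finset.sum_congr rfl
      intro b hb
      have := Finset.mem_Ioc.1 hb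
      have hb0 : b ≠ 0 := by omega
      simp [hb0]
    rw [e1]
    apply hI m _ _ hm hmU
    · have := Nat.lt_mul_div_succ X hm
      nlinarith
    · exact Nat.div_le_div_right (by omega)
    · exact Nat.mul_div_le _ _
  calc _ ≤ ∑ a ∈ Finset.Icc 1 (2 * X), ‖((gam U V a : ℝ) : ℂ) * ∑ b ∈ Finset.Ioc (X / a) (2 * X / a), ((oneR b : ℝ) : ℂ) * F (a * b)‖ := norm_sum_le _ _
    _ ≤ ∑ a ∈ Finset.Icc 1 (2 * X), if a ≤ U * V then Lg * (η * X / a) else 0 := by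
      apply Finset.sum_le_sum
      intro a ha
      have ha := Finset.mem_Icc.1 ha
      rw [norm_mul]
      split_ifs with h
      · have hmu : ‖((gam U V a : ℝ) : ℂ)‖ ≤ Lg := by
          rw [Complex.norm_real, Real.norm_eq_abs]
          refine (gam_abs U V a).trans ?_
          have : Real.log a ≤ Real.log (2 * X) := by
            apply Real.log_le_log (by exact_mod_cast ha.1)
            exact_mod_cast ha.2
          linarith
        gcongr
        exact hin a ha.1 h
      · rw [gam_zero U V a (by omega)]; simp
    _ ≤ ∑ a ∈ Finset.Icc 1 (U * V), Lg * (η * X / a) := by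
      rw [← Finset.sum_filter]
      apply Finset.sum_le_sum_of_subset_of_nonneg
      · intro a ha; simp at ha ⊢; omega
      · intro a _ _; positivity
    _ = η * X * Lg * ∑ a ∈ Finset.Icc 1 (U * V), 1 / (a:ℝ) := by
      rw [Finset.mul_sum]; apply Finset.sum_congr rfl; intro a _; ring
    _ ≤ η * X * Lg * Lg := by
      gcongr
      apply harmonic_le (U * V) (2 * X) _ (by linarith)
      have : ((U * V : ℕ):ℝ) ≤ X := by exact_mod_cast hU
      linarith
    _ = _ := by ring

/-- second moment of the divisor function -/
lemma divisor_sq (N : ℕ) (x : ℝ) (hx : (N:ℝ) ≤ x) (h1 : 1 ≤ x) :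
    ∑ k ∈ Finset.Icc 1 N, ((k.divisors.card : ℝ)) ^ 2 ≤ N * (1 + Real.log x) ^ 3 := by
  have hH := harmonic_le N x hx h1
  set Hs := ∑ m ∈ Finset.Icc 1 N, 1 / (m:ℝ) with hHs
  have hH0 : 0 ≤ Hs := Finset.sum_nonneg fun _ _ => by positivity
  -- d(k)^2 as a double sum
  have e1 : ∀ k ∈ Finset.Icc 1 N, ((k.divisors.card : ℝ)) ^ 2 =
      ∑ a ∈ Finset.Icc 1 N, ∑ b ∈ Finset.Icc 1 N, if a ∣ k ∧ b ∣ k then (1:ℝ) else 0 := by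
    intro k hk
    have hk := Finset.mem_Icc.1 hk
    have : (k.divisors.card : ℝ) = ∑ a ∈ Finset.Icc 1 N, if a ∣ k then (1:ℝ) else 0 := by
      rw [Finset.sum_boole]
      congr 2
      ext a
      rw [Nat.mem_divisors, Finset.mem_filter, Finset.mem_Icc]
      constructor
      · rintro ⟨h, _⟩
        exact ⟨⟨Nat.pos_of_dvd_of_pos h (by omega), (Nat.le_of_dvd (by omega) h).trans hk.2⟩, h⟩
      · rintro ⟨_, h⟩; exact ⟨h, by omega⟩
    rw [sq, this, Finset.sum_mul_sum]
    apply Finset.sum_congr rfl; intro a _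
    apply Finset.sum_congr rfl; intro b _
    by_cases c1 : a ∣ k <;> by_cases c2 : b ∣ k <;> simp [c1, c2]
  rw [Finset.sum_congr rfl e1, Finset.sum_comm]
  have e2 : ∀ a ∈ Finset.Icc 1 N, ∑ k ∈ Finset.Icc 1 N, ∑ b ∈ Finset.Icc 1 N,
      (if a ∣ k ∧ b ∣ k then (1:ℝ) else 0) ≤ ∑ b ∈ Finset.Icc 1 N, ∑ g ∈ Finset.Icc 1 N,
        if g ∣ a ∧ g ∣ b then (N:ℝ) * g / (a * b) else 0 := by
    intro a ha
    have ha := Finset.mem_Icc.1 ha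
    rw [Finset.sum_comm]
    apply Finset.sum_le_sum
    intro b hb
    have hb := Finset.mem_Icc.1 hb
    have hg : 0 < Nat.gcd a b := Nat.gcd_pos_of_pos_left _ (by omega)
    have hgN : Nat.gcd a b ≤ N := (Nat.le_of_dvd (by omega) (Nat.gcd_dvd_left a b)).trans ha.2
    have c1 : ∑ k ∈ Finset.Icc 1 N, (if a ∣ k ∧ b ∣ k then (1:ℝ) else 0) ≤ (N:ℝ) * (Nat.gcd a b) / (a * b) := by
      have : ∀ k, (a ∣ k ∧ b ∣ k) ↔ Nat.lcm a b ∣ k := fun k => Nat.lcm_dvd_iff.symm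
      simp only [this]
      rw [Finset.sum_boole]
      have hc : ((Finset.Icc 1 N).filter (fun k => Nat.lcm a b ∣ k)).card = N / Nat.lcm a b := by
        rw [← Nat.Ioc_filter_dvd_card_eq_div]; rfl
      rw [hc]
      refine Nat.cast_div_le.trans ?_
      have hl : (Nat.gcd a b : ℝ) * (Nat.lcm a b : ℝ) = a * b := by exact_mod_cast Nat.gcd_mul_lcm a b
      have hl0 : (0:ℝ) < Nat.lcm a b := by
        exact_mod_cast Nat.lcm_pos (by omega) (by omega)
      have hg0 : (0:ℝ) < Nat.gcd a b := by exact_mod_cast hg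
      rw [← hl]
      apply le_of_eq; field_simp
    refine c1.trans ?_
    have := Finset.single_le_sum (f := fun g : ℕ => if g ∣ a ∧ g ∣ b then (N:ℝ) * g / (a * b) else 0)
      (s := Finset.Icc 1 N) (fun g _ => by split_ifs <;> positivity)
      (Finset.mem_Icc.2 ⟨hg, hgN⟩)
    simpa [Nat.gcd_dvd_left, Nat.gcd_dvd_right] using this
  refine (Finset.sum_le_sum e2).trans ?_
  have e3 : ∑ a ∈ Finset.Icc 1 N, ∑ b ∈ Finset.Icc 1 N, ∑ g ∈ Finset.Icc 1 N,
        (if g ∣ a ∧ g ∣ b then (N:ℝ) * g / (a * b) else 0) =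
      ∑ g ∈ Finset.Icc 1 N, (N:ℝ) * g * (∑ a ∈ Finset.Icc 1 N, if g ∣ a then 1 / (a:ℝ) else 0) ^ 2 := by
    rw [Finset.sum_congr rfl (fun a _ => Finset.sum_comm), Finset.sum_comm]
    apply Finset.sum_congr rfl
    intro g _
    rw [sq, Finset.sum_mul_sum, Finset.mul_sum]
    apply Finset.sum_congr rfl; intro a _
    rw [Finset.mul_sum]
    apply Finset.sum_congr rfl; intro b _
    by_cases c1 : g ∣ a <;> by_cases c2 : g ∣ b <;> simp [c1, c2]
    field_simp
  rw [e3]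
  have e4 : ∀ g ∈ Finset.Icc 1 N, (∑ a ∈ Finset.Icc 1 N, if g ∣ a then 1 / (a:ℝ) else 0) ≤ 1 / g * Hs := by
    intro g hg
    have hg := Finset.mem_Icc.1 hg
    rw [← Finset.sum_filter, hHs, Finset.mul_sum]
    have : ∀ a ∈ (Finset.Icc 1 N).filter (fun a => g ∣ a), 1 / (a:ℝ) = 1 / (g:ℝ) * (1 / ((a / g : ℕ):ℝ)) := by
      intro a ha
      obtain ⟨c, rfl⟩ := (Finset.mem_filter.1 ha).2
      rw [Nat.mul_div_cancel_left _ (by omega)]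
      push_cast
      rw [one_div_mul_one_div]
    rw [Finset.sum_congr rfl this]
    have hinj : Set.InjOn (fun a => a / g) ((Finset.Icc 1 N).filter (fun a => g ∣ a) : Finset ℕ) := by
      intro a ha b hb hab
      obtain ⟨c, rfl⟩ := (Finset.mem_filter.1 ha).2
      obtain ⟨d, rfl⟩ := (Finset.mem_filter.1 hb).2
      simp only [Nat.mul_div_cancel_left _ (show 0 < g by omega)] at hab
      rw [hab]
    rw [← Finset.sum_image (f := fun c : ℕ => 1 / (g:ℝ) * (1 / (c:ℝ))) hinj]
    apply Finset.sum_le_sum_of_subset_of_nonneg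
    · intro c hc
      obtain ⟨a, ha, rfl⟩ := Finset.mem_image.1 hc
      obtain ⟨ha1, d, rfl⟩ := Finset.mem_filter.1 ha
      have ha1 := Finset.mem_Icc.1 ha1
      simp only [Nat.mul_div_cancel_left _ (show 0 < g by omega)]
      rw [Finset.mem_Icc]
      constructor
      · exact Nat.pos_of_ne_zero (by rintro rfl; simp at ha1)
      · nlinarith
    · intro c _ _; positivity
  calc _ ≤ ∑ g ∈ Finset.Icc 1 N, (N:ℝ) * g * (1 / g * Hs) ^ 2 := by
        apply Finset.sum_le_sum
        intro g hg
        have : 0 ≤ ∑ a ∈ Finset.Icc 1 N, (if g ∣ a then 1 / (a:ℝ) else 0) :=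
          Finset.sum_nonneg fun a _ => by split_ifs <;> positivity
        gcongr
        exact e4 g hg
    _ = ∑ g ∈ Finset.Icc 1 N, (N:ℝ) * Hs ^ 2 * (1 / g) := by
        apply Finset.sum_congr rfl
        intro g hg
        have : (0:ℝ) < g := by exact_mod_cast (Finset.mem_Icc.1 hg).1
        field_simp
    _ = N * Hs ^ 3 := by rw [← Finset.mul_sum]; ring
    _ ≤ _ := by gcongr

end UDP

namespace UDP
open ArithmeticFunction (vonMangoldt moebius)

lemma cs_bilinear (C S : Finset ℕ) (lam β : ℕ → ℝ) (W : ℕ → ℕ → ℂ) :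
    ‖∑ c ∈ C, ∑ k ∈ S, (lam c : ℂ) * (β k : ℂ) * W c k‖ ^ 2 ≤
      (∑ k ∈ S, β k ^ 2) * ∑ c1 ∈ C, ∑ c2 ∈ C, |lam c1| * |lam c2| *
        ‖∑ k ∈ S, W c2 k * (starRingEnd ℂ) (W c1 k)‖ := by
  set G : ℕ → ℂ := fun k => ∑ c ∈ C, (lam c : ℂ) * W c k with hG
  have e1 : ∑ c ∈ C, ∑ k ∈ S, (lam c : ℂ) * (β k : ℂ) * W c k = ∑ k ∈ S, (β k : ℂ) * G k := by
    rw [Finset.sum_comm]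
    apply Finset.sum_congr rfl; intro k _
    rw [hG]; simp only; rw [Finset.mul_sum]
    apply Finset.sum_congr rfl; intro c _; ring
  rw [e1]
  have e2 : ‖∑ k ∈ S, (β k : ℂ) * G k‖ ^ 2 ≤ (∑ k ∈ S, |β k| * ‖G k‖) ^ 2 := by
    gcongr
    refine (norm_sum_le _ _).trans (Finset.sum_le_sum fun k _ => ?_)
    rw [norm_mul, Complex.norm_real, Real.norm_eq_abs]
  refine e2.trans ((Finset.sum_mul_sq_le_sq_mul_sq _ _ _).trans ?_)
  simp only [sq_abs]
  gcongr
  have e3 : ((∑ k ∈ S, ‖G k‖ ^ 2 : ℝ) : ℂ) = ∑ c1 ∈ C, ∑ c2 ∈ C, (lam c1 : ℂ) * (lam c2 : ℂ) *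
      ∑ k ∈ S, W c2 k * (starRingEnd ℂ) (W c1 k) := by
    push_cast
    have : ∀ k ∈ S, ((‖G k‖ : ℝ) : ℂ) ^ 2 = ∑ c1 ∈ C, ∑ c2 ∈ C, (lam c1 : ℂ) * (lam c2 : ℂ) *
      (W c2 k * (starRingEnd ℂ) (W c1 k)) := by
      intro k _
      rw [← Complex.conj_mul', hG]; simp only
      rw [map_sum, Finset.sum_mul_sum]
      apply Finset.sum_congr rfl; intro c _
      apply Finset.sum_congr rfl; intro d _
      rw [map_mul, Complex.conj_ofReal]; ring
    rw [Finset.sum_congr rfl this, Finset.sum_comm]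
    apply Finset.sum_congr rfl; intro c _
    rw [Finset.sum_comm]
    apply Finset.sum_congr rfl; intro d _
    rw [Finset.mul_sum]
  have e4 : ∑ k ∈ S, ‖G k‖ ^ 2 = ‖((∑ k ∈ S, ‖G k‖ ^ 2 : ℝ) : ℂ)‖ := by
    rw [Complex.norm_real, Real.norm_eq_abs, abs_of_nonneg]
    exact Finset.sum_nonneg fun _ _ => by positivity
  rw [e4, e3]
  refine (norm_sum_le _ _).trans (Finset.sum_le_sum fun c _ => ?_)
  refine (norm_sum_le _ _).trans (Finset.sum_le_sum fun d _ => ?_)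
  rw [norm_mul, norm_mul, Complex.norm_real, Complex.norm_real, Real.norm_eq_abs, Real.norm_eq_abs]

def Wf (F : ℕ → ℂ) (X c k : ℕ) : ℂ := if X < c * k ∧ c * k ≤ 2 * X then F (c * k) else 0

lemma Wf_norm (F : ℕ → ℂ) (hF : ∀ n, ‖F n‖ ≤ 1) (X c k : ℕ) : ‖Wf F X c k‖ ≤ 1 := by
  unfold Wf; split_ifs
  · exact hF _
  · simp

/-- the sum over a block of `c` -/
lemma block_bound (F : ℕ → ℂ) (hF : ∀ n, ‖F n‖ ≤ 1) (X K D c0 : ℕ) (hK : 2 ≤ K) (b : ℕ → ℝ)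
    (hb0 : ∀ i, 0 ≤ b i) (hb : ∀ c1 c2 A B : ℕ, 1 ≤ c1 → c1 < c2 → c2 < c1 + D → A ≤ B → K ≤ 2 * A → B ≤ 2 * K →
      X ≤ 2 * c1 * A → c2 * B ≤ 2 * X →
      ‖∑ k ∈ Finset.Ioc A B, F (c2 * k) * (starRingEnd ℂ) (F (c1 * k))‖ ≤ b (c2 - c1))
    (C : Finset ℕ) (hC : ∀ c ∈ C, 1 ≤ c ∧ c0 ≤ c ∧ c < c0 + D)
    (lam β : ℕ → ℝ) (L : ℝ) (hL : 0 ≤ L) (hlam : ∀ c ∈ C, |lam c| ≤ L) :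
    ‖∑ c ∈ C, ∑ k ∈ Finset.Ico K (2 * K), (lam c : ℂ) * (β k : ℂ) * Wf F X c k‖ ^ 2 ≤
      (∑ k ∈ Finset.Ico K (2 * K), β k ^ 2) * (L ^ 2 * (D * (K + 2 * ∑ i ∈ Finset.Ico 1 D, b i))) := by
  refine (cs_bilinear _ _ _ _ _).trans ?_
  have hpair : ∀ c1 c2, 1 ≤ c1 → c1 < c2 → c2 < c1 + D →
      ‖∑ k ∈ Finset.Ico K (2 * K), Wf F X c2 k * (starRingEnd ℂ) (Wf F X c1 k)‖ ≤ b (c2 - c1) := by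
    intro c1 c2 h1 h12 hD
    set A := max (K - 1) (X / c1) with hA
    set B := min (2 * K - 1) (2 * X / c2) with hB
    have e1 : ∑ k ∈ Finset.Ico K (2 * K), Wf F X c2 k * (starRingEnd ℂ) (Wf F X c1 k) =
        ∑ k ∈ Finset.Ioc A B, F (c2 * k) * (starRingEnd ℂ) (F (c1 * k)) := by
      symm
      have hsub : Finset.Ioc A B ⊆ Finset.Ico K (2 * K) := by
        intro k hk; rw [Finset.mem_Ioc] at hk; rw [Finset.mem_Ico]; omega
      have hkey : ∀ k, k ∈ Finset.Ico K (2 * K) → (k ∈ Finset.Ioc A B ↔ X < c1 * k ∧ c2 * k ≤ 2 * X) := by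
        intro k hk
        rw [Finset.mem_Ico] at hk
        have a1 : X / c1 < k ↔ X < c1 * k := by rw [Nat.div_lt_iff_lt_mul h1, mul_comm]
        have a2 : k ≤ 2 * X / c2 ↔ c2 * k ≤ 2 * X := by
          rw [Nat.le_div_iff_mul_le (by omega), mul_comm]
        rw [Finset.mem_Ioc, ← a1, ← a2]
        omega
      rw [← Finset.sum_subset hsub (f := fun k => Wf F X c2 k * (starRingEnd ℂ) (Wf F X c1 k))]
      · apply Finset.sum_congr rfl
        intro k hk
        have h := (hkey k (hsub hk)).1 hk
        have h3 : c1 * k ≤ c2 * k := by gcongr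
        simp only [Wf]
        rw [if_pos ⟨by omega, h.2⟩, if_pos ⟨h.1, by omega⟩]
      · intro k hk hk2
        have h := (not_congr (hkey k hk)).1 hk2
        simp only [Wf]
        by_cases q1 : X < c1 * k
        · have : ¬ c2 * k ≤ 2 * X := fun q => h ⟨q1, q⟩
          rw [if_neg (fun q => this q.2)]; simp
        · rw [if_neg (fun q => q1 q.1) (c := X < c1 * k ∧ c1 * k ≤ 2 * X)]; simp
    rw [e1]
    by_cases hAB : A ≤ B
    · apply hb c1 c2 A B h1 h12 hD hAB
      · omega
      · omega
      · have := Nat.lt_mul_div_succ X h1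
        have h5 : c1 * (X / c1 + 1) ≤ c1 * (2 * A) := by gcongr; omega
        have h6 : c1 * (2 * A) = 2 * c1 * A := by ring
        omega
      · have h5 : c2 * B ≤ c2 * (2 * X / c2) := by gcongr; omega
        have := Nat.mul_div_le (2 * X) c2
        omega
    · rw [Finset.Ioc_eq_empty (by omega)]; simpa using hb0 _
  have hcard : (C.card : ℝ) ≤ D := by
    have : C ⊆ Finset.Ico c0 (c0 + D) := fun c hc => by
      rw [Finset.mem_Ico]; exact (hC c hc).2
    have := Finset.card_le_card this
    rw [Nat.card_Ico] at this
    exact_mod_cast (by omega : C.card ≤ D)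
  set SB := ∑ i ∈ Finset.Ico 1 D, b i with hSB
  have hrow : ∀ c1 ∈ C, ∑ c2 ∈ C, ‖∑ k ∈ Finset.Ico K (2 * K), Wf F X c2 k * (starRingEnd ℂ) (Wf F X c1 k)‖
      ≤ K + 2 * SB := by
    intro c1 h1
    have hle : ∀ c2 ∈ C, ‖∑ k ∈ Finset.Ico K (2 * K), Wf F X c2 k * (starRingEnd ℂ) (Wf F X c1 k)‖ ≤
        (if c2 = c1 then (K:ℝ) else 0) + (if c1 < c2 then b (c2 - c1) else 0) +
          (if c2 < c1 then b (c1 - c2) else 0) := by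
      intro c2 h2
      have q1 := hC c1 h1
      have q2 := hC c2 h2
      rcases lt_trichotomy c1 c2 with h | h | h
      · rw [if_neg (by omega), if_pos h, if_neg (by omega)]
        have := hpair c1 c2 q1.1 h (by omega)
        simpa using this
      · subst h
        simp only [if_true, lt_irrefl, if_false, add_zero]
        refine (norm_sum_le _ _).trans ?_
        calc _ ≤ ∑ k ∈ Finset.Ico K (2 * K), (1:ℝ) := by
              apply Finset.sum_le_sum
              intro k _
              rw [norm_mul, RCLike.norm_conj]
              have := Wf_norm F hF X c1 k
              nlinarith [norm_nonneg (Wf F X c1 k)]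
          _ = K := by
              rw [Finset.sum_const, Nat.card_Ico, nsmul_eq_mul, mul_one]
              congr 1; omega
      · rw [if_neg (by omega), if_neg (by omega), if_pos h]
        have := hpair c2 c1 q2.1 h (by omega)
        have e5 : ‖∑ k ∈ Finset.Ico K (2 * K), Wf F X c2 k * (starRingEnd ℂ) (Wf F X c1 k)‖ =
          ‖∑ k ∈ Finset.Ico K (2 * K), Wf F X c1 k * (starRingEnd ℂ) (Wf F X c2 k)‖ := by
          rw [← RCLike.norm_conj, map_sum]
          congr 1; apply Finset.sum_congr rfl; intro k _
          rw [map_mul, Complex.conj_conj, mul_comm]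
        rw [e5]; simpa using this
    refine (Finset.sum_le_sum hle).trans ?_
    rw [Finset.sum_add_distrib, Finset.sum_add_distrib]
    have s1 : ∑ c2 ∈ C, (if c2 = c1 then (K:ℝ) else 0) = K := by
      rw [Finset.sum_ite_eq' C c1, if_pos h1]
    have s2 : ∑ c2 ∈ C, (if c1 < c2 then b (c2 - c1) else 0) ≤ SB := by
      rw [← Finset.sum_filter]
      rw [← Finset.sum_image (f := b) (g := fun c2 => c2 - c1)]
      · apply Finset.sum_le_sum_of_subset_of_nonneg
        · intro i hi
          obtain ⟨c2, h2, rfl⟩ := Finset.mem_image.1 hi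
          rw [Finset.mem_filter] at h2
          have := hC c1 h1; have := hC c2 h2.1
          rw [Finset.mem_Ico]; omega
        · intro i _ _; exact hb0 i
      · intro x hx y hy hxy
        have := (Finset.mem_filter.1 hx).2
        have := (Finset.mem_filter.1 hy).2
        simp only at hxy; omega
    have s3 : ∑ c2 ∈ C, (if c2 < c1 then b (c1 - c2) else 0) ≤ SB := by
      rw [← Finset.sum_filter]
      rw [← Finset.sum_image (f := b) (g := fun c2 => c1 - c2)]
      · apply Finset.sum_le_sum_of_subset_of_nonneg
        · intro i hi
          obtain ⟨c2, h2, rfl⟩ := Finset.mem_image.1 hi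
          rw [Finset.mem_filter] at h2
          have := hC c1 h1; have := hC c2 h2.1
          rw [Finset.mem_Ico]; omega
        · intro i _ _; exact hb0 i
      · intro x hx y hy hxy
        have := (Finset.mem_filter.1 hx).2
        have := (Finset.mem_filter.1 hy).2
        simp only at hxy; omega
    linarith
  have hSB0 : 0 ≤ SB := Finset.sum_nonneg fun i _ => hb0 i
  apply mul_le_mul_of_nonneg_left _ (Finset.sum_nonneg fun _ _ => by positivity)
  calc _ ≤ ∑ c1 ∈ C, ∑ c2 ∈ C, L * L * ‖∑ k ∈ Finset.Ico K (2 * K), Wf F X c2 k * (starRingEnd ℂ) (Wf F X c1 k)‖ := by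
        apply Finset.sum_le_sum; intro c1 h1
        apply Finset.sum_le_sum; intro c2 h2
        have := hlam c1 h1; have := hlam c2 h2
        gcongr
    _ = L ^ 2 * ∑ c1 ∈ C, ∑ c2 ∈ C, ‖∑ k ∈ Finset.Ico K (2 * K), Wf F X c2 k * (starRingEnd ℂ) (Wf F X c1 k)‖ := by
        rw [Finset.mul_sum]; apply Finset.sum_congr rfl; intro c _
        rw [Finset.mul_sum]; apply Finset.sum_congr rfl; intro d _; ring
    _ ≤ L ^ 2 * ∑ c1 ∈ C, (K + 2 * SB) := by
        gcongr with c1 h1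
        exact hrow c1 h1
    _ ≤ _ := by
        rw [Finset.sum_const, nsmul_eq_mul]
        gcongr

def betaF (U : ℕ) : ArithmeticFunction ℝ := tgt muR U * oneR

lemma betaF_abs (U k : ℕ) : |betaF U k| ≤ k.divisors.card := by
  rw [betaF, ArithmeticFunction.mul_apply]
  have h : ∑ p ∈ k.divisorsAntidiagonal, (1:ℝ) = k.divisors.card := by
    rw [Nat.sum_divisorsAntidiagonal (fun _ _ => (1:ℝ))]; simp
  rw [← h]
  refine (Finset.abs_sum_le_sum_abs _ _).trans (Finset.sum_le_sum fun p _ => ?_)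
  rw [abs_mul, tgt_apply]
  have h1 := muR_abs p.1
  rw [ArithmeticFunction.intCoe_apply] at h1
  by_cases h0 : p.2 = 0 <;> split_ifs <;> simp [h0, h1]

lemma betaF_zero (U k : ℕ) (h : k ≤ U) : betaF U k = 0 := by
  rw [betaF, ArithmeticFunction.mul_apply]
  apply Finset.sum_eq_zero
  intro p hp
  obtain ⟨h1, h2⟩ := Nat.mem_divisorsAntidiagonal.1 hp
  have : p.1 ≤ U := (Nat.le_of_dvd (by omega) ⟨p.2, h1.symm⟩).trans h
  rw [tgt_apply, if_pos this, zero_mul]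

lemma betaF_sq (U K : ℕ) (x : ℝ) (hx : (2 * K : ℝ) ≤ x) (h1 : 1 ≤ x) (hK : 1 ≤ K) :
    ∑ k ∈ Finset.Ico K (2 * K), betaF U k ^ 2 ≤ 2 * K * (1 + Real.log x) ^ 3 := by
  have := divisor_sq (2 * K) x (by push_cast; exact hx) h1
  push_cast at this
  refine le_trans ?_ this
  calc _ ≤ ∑ k ∈ Finset.Ico K (2 * K), ((k.divisors.card : ℝ)) ^ 2 := by
        apply Finset.sum_le_sum; intro k _
        rw [← sq_abs]
        have := betaF_abs U k
        gcongr
    _ ≤ _ := by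
        apply Finset.sum_le_sum_of_subset_of_nonneg
        · intro k hk; rw [Finset.mem_Ico] at hk; rw [Finset.mem_Icc]; omega
        · intro k _ _; positivity

end UDP

namespace UDP
open ArithmeticFunction (vonMangoldt moebius)

lemma dyadic_sum (N : ℕ) (g : ℕ → ℂ) (hg : ∀ k, N < k → g k = 0) :
    ∑ k ∈ Finset.Icc 1 N, g k = ∑ j ∈ Finset.range (Nat.log 2 N + 1), ∑ k ∈ Finset.Ico (2 ^ j) (2 * 2 ^ j), g k := by
  rw [← Finset.sum_fiberwise_of_maps_to (s := Finset.Icc 1 N) (t := Finset.range (Nat.log 2 N + 1)) (g := fun k => Nat.log 2 k)]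
  · apply Finset.sum_congr rfl
    intro j _
    have key : ∀ k, 1 ≤ k → (Nat.log 2 k = j ↔ 2 ^ j ≤ k ∧ k < 2 * 2 ^ j) := by
      intro k hk
      rw [Nat.log_eq_iff (Or.inr ⟨by norm_num, by omega⟩), pow_succ, mul_comm]
    apply Finset.sum_subset
    · intro k hk
      rw [Finset.mem_filter, Finset.mem_Icc] at hk
      rw [Finset.mem_Ico]
      exact (key k hk.1.1).1 hk.2
    · intro k hk hk2
      apply hg
      rw [Finset.mem_Ico] at hk
      rw [Finset.mem_filter, Finset.mem_Icc] at hk2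
      have h1 : 1 ≤ k := Nat.one_le_two_pow.trans hk.1
      by_contra h
      exact hk2 ⟨⟨h1, by omega⟩, (key k h1).2 hk⟩
  · intro k hk
    rw [Finset.mem_Icc] at hk
    rw [Finset.mem_range]
    have := Nat.log_mono_right (b := 2) hk.2
    omega

lemma typeII (F : ℕ → ℂ) (hF : ∀ n, ‖F n‖ ≤ 1) (X U V : ℕ) (η : ℝ) (hη : 0 < η) (hη1 : η ≤ 1)
    (hX : 1 ≤ X) (hU : 3 ≤ U) (hV : 2 ≤ V)
    (hII : ∀ K : ℕ, U < 2 * K → K * V < 2 * X → ∃ D : ℕ, ∃ b : ℕ → ℝ, 1 ≤ D ∧ (∀ i, 0 ≤ b i) ∧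
      D * K ≤ X ∧ 1 ≤ η * D ∧ ∑ i ∈ Finset.Ico 1 D, b i ≤ η * K * D ∧
      ∀ c1 c2 A B : ℕ, 1 ≤ c1 → c1 < c2 → c2 < c1 + D → A ≤ B → K ≤ 2 * A → B ≤ 2 * K →
      X ≤ 2 * c1 * A → c2 * B ≤ 2 * X →
      ‖∑ k ∈ Finset.Ioc A B, F (c2 * k) * (starRingEnd ℂ) (F (c1 * k))‖ ≤ b (c2 - c1)) :
    ‖∑ n ∈ Finset.Ioc X (2 * X), (((tgt vonMangoldt V * betaF U) n : ℝ) : ℂ) * F n‖ ≤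
      18 * X * √η * (1 + Real.log (2 * X)) ^ 4 := by
  have hXr : (1:ℝ) ≤ X := by exact_mod_cast hX
  set Lg := 1 + Real.log (2 * X) with hLg
  have hlog0 : 0 ≤ Real.log (2 * X) := Real.log_nonneg (by linarith)
  have hLg1 : 1 ≤ Lg := by linarith
  rw [conv_sum]
  set lam : ℕ → ℝ := fun c => tgt vonMangoldt V c with hlamdef
  set β : ℕ → ℝ := fun k => betaF U k with hβdef
  have hW0 : ∀ a k, 1 ≤ a → 2 * X < k → Wf F X a k = 0 := by
    intro a k ha hk
    unfold Wf
    rw [if_neg]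
    rintro ⟨_, h⟩
    nlinarith
  have e1 : ∀ a ∈ Finset.Icc 1 (2 * X), (lam a : ℂ) * ∑ b ∈ Finset.Ioc (X / a) (2 * X / a), (β b : ℂ) * F (a * b)
      = ∑ j ∈ Finset.range (Nat.log 2 (2 * X) + 1), ∑ k ∈ Finset.Ico (2 ^ j) (2 * 2 ^ j), (lam a : ℂ) * (β k : ℂ) * Wf F X a k := by
    intro a ha
    rw [Finset.mem_Icc] at ha
    rw [← dyadic_sum (2 * X) (fun k => (lam a : ℂ) * (β k : ℂ) * Wf F X a k)]
    · rw [Finset.mul_sum]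
      symm
      have hkey : ∀ k, k ∈ Finset.Ioc (X / a) (2 * X / a) ↔ X < a * k ∧ a * k ≤ 2 * X := by
        intro k
        rw [Finset.mem_Ioc, Nat.div_lt_iff_lt_mul (by omega), Nat.le_div_iff_mul_le (by omega), mul_comm]
      rw [← Finset.sum_subset (s₁ := Finset.Ioc (X / a) (2 * X / a))]
      · apply Finset.sum_congr rfl
        intro k hk
        rw [Wf, if_pos ((hkey k).1 hk)]; ring
      · intro k hk
        have := (hkey k).1 hk
        rw [Finset.mem_Icc]
        constructor
        · exact Nat.pos_of_ne_zero (by rintro rfl; simp at this)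
        · nlinarith
      · intro k _ hk
        rw [Wf, if_neg (fun h => hk ((hkey k).2 h)), mul_zero]
    · intro k hk
      rw [hW0 a k ha.1 hk, mul_zero]
  have e2 := Finset.sum_congr rfl e1
  rw [Finset.sum_comm] at e2
  change ‖∑ a ∈ Finset.Icc 1 (2 * X), (lam a : ℂ) * ∑ b ∈ Finset.Ioc (X / a) (2 * X / a), (β b : ℂ) * F (a * b)‖ ≤ _
  rw [e2]
  have hone : ∀ j ∈ Finset.range (Nat.log 2 (2 * X) + 1),
      ‖∑ a ∈ Finset.Icc 1 (2 * X), ∑ k ∈ Finset.Ico (2 ^ j) (2 * 2 ^ j), (lam a : ℂ) * (β k : ℂ) * Wf F X a k‖ ≤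
        9 * X * √η * Lg ^ 3 := by
    intro j _
    obtain ⟨K, hKdef⟩ : ∃ K, K = 2 ^ j := ⟨_, rfl⟩
    rw [← hKdef]
    have hK1 : 1 ≤ K := by rw [hKdef]; exact Nat.one_le_two_pow
    have hnn : 0 ≤ 9 * X * √η * Lg ^ 3 := by positivity
    by_cases hKU : U < 2 * K
    swap
    · rw [Finset.sum_eq_zero]
      · simpa using hnn
      · intro a _
        apply Finset.sum_eq_zero
        intro k hk
        rw [Finset.mem_Ico] at hk
        simp only [hβdef]
        rw [betaF_zero U k (by omega)]; simp
    by_cases hKV : K * V < 2 * X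
    swap
    · rw [Finset.sum_eq_zero]
      · simpa using hnn
      · intro a _
        apply Finset.sum_eq_zero
        intro k hk
        rw [Finset.mem_Ico] at hk
        simp only [hlamdef]
        rw [tgt_apply]
        split_ifs with h
        · simp
        · have : Wf F X a k = 0 := by
            rw [Wf, if_neg]
            rintro ⟨_, h2⟩
            nlinarith
          rw [this, mul_zero]
    obtain ⟨D, b, hD, hb0, hDK, hηD, hbs, hb⟩ := hII K hKU hKV
    have hK2 : 2 ≤ K := by omega
    have hKX : K ≤ X := by nlinarith
    -- restrict to c ≤ 2X/K and split in blocks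
    set N := 2 * X / K with hN
    have r1 : ∑ a ∈ Finset.Icc 1 (2 * X), ∑ k ∈ Finset.Ico K (2 * K), (lam a : ℂ) * (β k : ℂ) * Wf F X a k =
        ∑ i ∈ Finset.range (N / D + 1), ∑ a ∈ (Finset.Icc 1 N).filter (fun a => a / D = i),
          ∑ k ∈ Finset.Ico K (2 * K), (lam a : ℂ) * (β k : ℂ) * Wf F X a k := by
      rw [Finset.sum_fiberwise_of_maps_to]
      · symm
        apply Finset.sum_subset
        · apply Finset.Icc_subset_Icc le_rfl
          exact Nat.div_le_self _ _
        · intro a ha ha2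
          apply Finset.sum_eq_zero
          intro k hk
          rw [Finset.mem_Ico] at hk
          rw [Finset.mem_Icc] at ha ha2
          have hNa : N < a := by omega
          rw [hN, Nat.div_lt_iff_lt_mul (by omega)] at hNa
          rw [Wf, if_neg, mul_zero]
          rintro ⟨_, h2⟩
          nlinarith
      · intro a ha
        rw [Finset.mem_Icc] at ha
        rw [Finset.mem_range]
        have := Nat.div_le_div_right (c := D) ha.2
        omega
    rw [r1]
    have hKr : (0:ℝ) < K := by exact_mod_cast hK1
    have hDr : (1:ℝ) ≤ D := by exact_mod_cast hD
    have hbl : ∀ i ∈ Finset.range (N / D + 1), ‖∑ a ∈ (Finset.Icc 1 N).filter (fun a => a / D = i),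
          ∑ k ∈ Finset.Ico K (2 * K), (lam a : ℂ) * (β k : ℂ) * Wf F X a k‖ ≤ 3 * K * D * √η * Lg ^ 3 := by
      intro i _
      apply le_of_sq_le_sq _ (by positivity)
      have hbb := block_bound F hF X K D (i * D) hK2 b hb0 hb ((Finset.Icc 1 N).filter (fun a => a / D = i)) (by
        intro c hc
        rw [Finset.mem_filter, Finset.mem_Icc] at hc
        have h1 := Nat.div_mul_le_self c D
        have h2 := Nat.lt_div_mul_add (a := c) (b := D) (by omega)
        rw [hc.2] at h1 h2
        exact ⟨hc.1.1, h1, h2⟩) lam β Lg (by linarith) (by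
        intro c hc
        rw [Finset.mem_filter, Finset.mem_Icc] at hc
        simp only [hlamdef, tgt_apply]
        split_ifs
        · simp; linarith
        · rw [abs_of_nonneg ArithmeticFunction.vonMangoldt_nonneg]
          refine ArithmeticFunction.vonMangoldt_le_log.trans ?_
          have hcX : c ≤ 2 * X := hc.1.2.trans (Nat.div_le_self _ _)
          have : Real.log c ≤ Real.log (2 * X) := by
            apply Real.log_le_log (by exact_mod_cast hc.1.1)
            exact_mod_cast hcX
          linarith)
      refine hbb.trans ?_
      have hB := betaF_sq U K (2 * X) (by
        have : (K:ℝ) ≤ X := by exact_mod_cast hKX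
        linarith) (by linarith) hK1
      calc _ ≤ (2 * K * Lg ^ 3) * (Lg ^ 2 * (D * (K * (η * D) + 2 * (η * K * D)))) := by
            gcongr
            · have := Finset.sum_nonneg fun i (_ : i ∈ Finset.Ico 1 D) => hb0 i
              positivity
            · nlinarith
        _ = 6 * K ^ 2 * D ^ 2 * η * Lg ^ 5 := by ring
        _ ≤ 9 * K ^ 2 * D ^ 2 * η * Lg ^ 6 := by
            gcongr <;> norm_num
        _ = (3 * K * D * √η * Lg ^ 3) ^ 2 := by
            have := Real.sq_sqrt hη.le
            calc _ = 9 * K ^ 2 * D ^ 2 * (√η ^ 2) * Lg ^ 6 := by rw [this]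
              _ = _ := by ring
    refine (norm_sum_le _ _).trans ((Finset.sum_le_sum hbl).trans ?_)
    rw [Finset.sum_const, Finset.card_range, nsmul_eq_mul]
    have hcnt : ((N / D + 1 : ℕ) : ℝ) * (K * D) ≤ 3 * X := by
      have h1 : N / D * D ≤ N := Nat.div_mul_le_self _ _
      have h2 : N * K ≤ 2 * X := Nat.div_mul_le_self _ _
      have h3 : (N / D + 1) * (K * D) ≤ 3 * X := by nlinarith
      exact_mod_cast h3
    calc _ = 3 * √η * Lg ^ 3 * (((N / D + 1 : ℕ) : ℝ) * (K * D)) := by ring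
      _ ≤ 3 * √η * Lg ^ 3 * (3 * X) := by gcongr
      _ = _ := by ring
  refine (norm_sum_le _ _).trans ((Finset.sum_le_sum hone).trans ?_)
  rw [Finset.sum_const, Finset.card_range, nsmul_eq_mul]
  have hcnt : ((Nat.log 2 (2 * X) + 1 : ℕ) : ℝ) ≤ 2 * Lg := by
    have h1 : (2:ℝ) ^ (Nat.log 2 (2 * X)) ≤ 2 * X := by
      exact_mod_cast Nat.pow_log_le_self 2 (show 2 * X ≠ 0 by omega)
    have h2 := Real.log_le_log (by positivity) h1
    rw [Real.log_pow] at h2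
    have h3 : (0.5:ℝ) ≤ Real.log 2 := by linarith [Real.log_two_gt_d9]
    push_cast
    have : (0:ℝ) ≤ (Nat.log 2 (2 * X) : ℝ) := by positivity
    nlinarith
  calc _ ≤ (2 * Lg) * (9 * X * √η * Lg ^ 3) := by gcongr
    _ = _ := by ring

/-- the bilinear method -/
theorem bilinear (F : ℕ → ℂ) (hF : ∀ n, ‖F n‖ ≤ 1) (X U V : ℕ) (η : ℝ) (hη : 0 < η) (hη1 : η ≤ 1)
    (hX : 1 ≤ X) (hU : 3 ≤ U) (hV : 2 ≤ V) (hUV : U * V ≤ X)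
    (hI : ∀ m A B : ℕ, 1 ≤ m → m ≤ U * V → X ≤ 2 * m * A → A ≤ B → m * B ≤ 2 * X →
      ‖∑ k ∈ Finset.Ioc A B, F (m * k)‖ ≤ η * X / m)
    (hII : ∀ K : ℕ, U < 2 * K → K * V < 2 * X → ∃ D : ℕ, ∃ b : ℕ → ℝ, 1 ≤ D ∧ (∀ i, 0 ≤ b i) ∧
      D * K ≤ X ∧ 1 ≤ η * D ∧ ∑ i ∈ Finset.Ico 1 D, b i ≤ η * K * D ∧
      ∀ c1 c2 A B : ℕ, 1 ≤ c1 → c1 < c2 → c2 < c1 + D → A ≤ B → K ≤ 2 * A → B ≤ 2 * K →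
      X ≤ 2 * c1 * A → c2 * B ≤ 2 * X →
      ‖∑ k ∈ Finset.Ioc A B, F (c2 * k) * (starRingEnd ℂ) (F (c1 * k))‖ ≤ b (c2 - c1)) :
    ‖∑ n ∈ Finset.Ioc X (2 * X), ((vonMangoldt n : ℝ) : ℂ) * F n‖ ≤
      21 * X * √η * (1 + Real.log (2 * X)) ^ 4 := by
  have hXr : (1:ℝ) ≤ X := by exact_mod_cast hX
  have hUX : U ≤ X := by nlinarith
  have hVX : V ≤ X := by nlinarith
  have t2 := typeII F hF X U V η hη hη1 hX hU hV hII
  have t1 := typeI_gam F X U V η hη.le hX hUV hI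
  have t0 := typeI_log F X U η hη.le hX hUX (fun m A B h1 h2 => hI m A B h1 (by nlinarith))
  set Lg := 1 + Real.log (2 * X) with hLg
  have hlog0 : 0 ≤ Real.log (2 * X) := Real.log_nonneg (by linarith)
  have hLg1 : 1 ≤ Lg := by linarith
  have e : ∑ n ∈ Finset.Ioc X (2 * X), ((vonMangoldt n : ℝ) : ℂ) * F n =
      ∑ n ∈ Finset.Ioc X (2 * X), (((tle muR U * ArithmeticFunction.log) n : ℝ) : ℂ) * F n
      - ∑ n ∈ Finset.Ioc X (2 * X), (((gam U V * oneR) n : ℝ) : ℂ) * F n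
      + ∑ n ∈ Finset.Ioc X (2 * X), (((tgt vonMangoldt V * betaF U) n : ℝ) : ℂ) * F n := by
    rw [← Finset.sum_sub_distrib, ← Finset.sum_add_distrib]
    apply Finset.sum_congr rfl
    intro n hn
    rw [Finset.mem_Ioc] at hn
    have hv := congrArg (fun g => g n) (vaughan U V)
    simp only [sub_eq_add_neg, ArithmeticFunction.add_apply, ArithmeticFunction.neg_apply] at hv
    have hz : tle vonMangoldt V n = 0 := by rw [tle_apply, if_neg (by omega)]
    rw [hz] at hv
    rw [hv, gam, betaF]
    push_cast; ring
  rw [e]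
  have hs : η ≤ √η := by
    apply Real.le_sqrt_of_sq_le; nlinarith
  have hL4 : Lg ^ 2 ≤ Lg ^ 4 := pow_le_pow_right₀ hLg1 (by norm_num)
  have h3 : η * X * Lg ^ 2 ≤ X * √η * Lg ^ 4 := by
    calc _ = X * η * Lg ^ 2 := by ring
      _ ≤ _ := by gcongr
  refine (norm_add_le _ _).trans ?_
  have := norm_sub_le (∑ n ∈ Finset.Ioc X (2 * X), (((tle muR U * ArithmeticFunction.log) n : ℝ) : ℂ) * F n)
    (∑ n ∈ Finset.Ioc X (2 * X), (((gam U V * oneR) n : ℝ) : ℂ) * F n)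
  linarith

end UDP

namespace UDP
open ArithmeticFunction (vonMangoldt moebius)

lemma hasDeriv_scale (f f1 : ℝ → ℝ) (c x : ℝ) (h : HasDerivAt f (f1 (c * x)) (c * x)) :
    HasDerivAt (fun x => f (c * x)) (c * f1 (c * x)) x := by
  have h2 : HasDerivAt (fun x : ℝ => c * x) c x := by
    simpa using (hasDerivAt_id x).const_mul c
  have := HasDerivAt.comp x h h2
  refine this.congr_deriv (by ring)

/-- the range facts for a pair -/
lemma pair_range (X c1 c2 A B : ℕ) (h12 : c1 < c2) (h1 : 1 ≤ c1) (hA : X ≤ 2 * c1 * A) (hB : c2 * B ≤ 2 * X)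
    (c x : ℝ) (hc1 : (c1:ℝ) ≤ c) (hc2 : c ≤ c2) (hx : x ∈ Set.Icc (A:ℝ) B) :
    c * x ∈ Set.Icc ((X:ℝ) / 2) (2 * X) := by
  have hA' : (X:ℝ) ≤ 2 * c1 * A := by exact_mod_cast hA
  have hB' : (c2:ℝ) * B ≤ 2 * X := by exact_mod_cast hB
  have hA0 : (0:ℝ) ≤ A := by positivity
  have h1' : (1:ℝ) ≤ c1 := by exact_mod_cast h1
  have hx0 : 0 ≤ x := hA0.trans hx.1
  constructor
  · have : (c1:ℝ) * A ≤ c * x := by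
      have := hx.1
      gcongr
      linarith
    linarith
  · have : c * x ≤ c2 * B := by
      have := hx.2
      gcongr
    linarith

/-- regime B1 -/
theorem regimeB1 (f f1 f2 : ℝ → ℝ) (X : ℕ) (φ Lg : ℝ) (hLg : Lg = 1 + Real.log (2 * X)) (hL128 : 128 ≤ Lg)
    (hX : 4 * Lg ^ 26 ≤ X) (hφ0 : 0 < φ) (hφ1 : φ ≤ 1 / (8 * Lg ^ 26)) (hφ2 : 32 * Lg ^ 12 ≤ X * φ)
    (hf : ∀ x ∈ Set.Icc ((X:ℝ) / 2) (2 * X), HasDerivAt f (f1 x) x)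
    (hf1 : ∀ x ∈ Set.Icc ((X:ℝ) / 2) (2 * X), HasDerivAt f1 (f2 x) x)
    (hanti : AntitoneOn f1 (Set.Icc ((X:ℝ) / 2) (2 * X)))
    (hb1 : ∀ x ∈ Set.Icc ((X:ℝ) / 2) (2 * X), φ / 4 ≤ f1 x ∧ f1 x ≤ φ)
    (hb2 : ∀ x ∈ Set.Icc ((X:ℝ) / 2) (2 * X), φ / (4 * Lg) ≤ f1 x + x * f2 x ∧ f1 x + x * f2 x ≤ φ)
    (hq : AntitoneOn (fun x => x ^ 2 * f2 x) (Set.Icc ((X:ℝ) / 2) (2 * X))) :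
    ‖∑ n ∈ Finset.Ioc X (2 * X), ((vonMangoldt n : ℝ) : ℂ) * e (f n)‖ ≤ 21 * X / Lg := by
  have hLpos : 0 < Lg := by linarith
  have hLp : ∀ n : ℕ, 1 ≤ Lg ^ n := fun n => one_le_pow₀ (by linarith)
  have hXr : (4:ℝ) ≤ X := by have := hLp 26; linarith
  have hX1 : 1 ≤ X := by exact_mod_cast (by linarith : (1:ℝ) ≤ X)
  set U := ⌈Lg ^ 13⌉₊ with hU
  have hU1 : Lg ^ 13 ≤ U := Nat.le_ceil _
  have hU2 : (U:ℝ) ≤ 2 * Lg ^ 13 := by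
    have := Nat.ceil_lt_add_one (show 0 ≤ Lg ^ 13 by positivity)
    have := hLp 13
    linarith
  have hUU : (U:ℝ) * U ≤ 4 * Lg ^ 26 := by
    calc (U:ℝ) * U ≤ (2 * Lg ^ 13) * (2 * Lg ^ 13) := by gcongr
      _ = _ := by ring
  have hL13 : 128 * Lg ^ 12 ≤ Lg ^ 13 := by
    calc _ ≤ Lg * Lg ^ 12 := by gcongr
      _ = _ := by ring
  have hUbig : (128:ℝ) ≤ U := by have := hLp 12; linarith
  have hUn : 128 ≤ U := by exact_mod_cast hUbig
  obtain ⟨η, hη⟩ : ∃ η, η = 1 / Lg ^ 10 := ⟨_, rfl⟩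
  have hη0 : 0 < η := by rw [hη]; positivity
  have hη1 : η ≤ 1 := by rw [hη, div_le_one (by positivity)]; exact hLp 10
  have hφU : U * U * φ ≤ 1 / 2 := by
    calc U * U * φ ≤ (4 * Lg ^ 26) * (1 / (8 * Lg ^ 26)) := by gcongr
      _ = 1 / 2 := by field_simp; norm_num
  have hsq : √η = 1 / Lg ^ 5 := by
    rw [hη, show 1 / Lg ^ 10 = (1 / Lg ^ 5) ^ 2 by rw [div_pow, one_pow, ← pow_mul]]
    exact Real.sqrt_sq (by positivity)
  have hL12 : Lg ^ 10 ≤ Lg ^ 12 := pow_le_pow_right₀ (by linarith) (by norm_num)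
  have main := bilinear (fun n => e (f n)) (fun n => by rw [norm_e]) X U U η hη0 hη1 hX1 (by omega) (by omega)
    (by exact_mod_cast hUU.trans hX) ?_ ?_
  · rw [hsq, ← hLg] at main
    refine main.trans (le_of_eq ?_)
    field_simp
  · -- type I
    intro m A B hm hmU hA hAB hB
    have hmr : (1:ℝ) ≤ m := by exact_mod_cast hm
    have hmUr : (m:ℝ) ≤ U * U := by exact_mod_cast hmU
    have hrange : ∀ x ∈ Set.Icc (A:ℝ) B, (m:ℝ) * x ∈ Set.Icc ((X:ℝ) / 2) (2 * X) := by
      intro x hx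
      have hA' : (X:ℝ) ≤ 2 * m * A := by exact_mod_cast hA
      have hB' : (m:ℝ) * B ≤ 2 * X := by exact_mod_cast hB
      have := hx.1; have := hx.2
      constructor <;> nlinarith
    have hmφ : m * φ ≤ 1 / 2 := by
      calc m * φ ≤ U * U * φ := by gcongr
        _ ≤ _ := hφU
    have hk := kl_cont (fun x => f (m * x)) (fun x => m * f1 (m * x)) A B (m * φ / 4) (by positivity) (by linarith)
      (fun x hx => hasDeriv_scale f f1 m x (hf _ (hrange x hx)))
      (fun x hx y hy hxy => by
        have := hanti (hrange x hx) (hrange y hy) (by gcongr)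
        simp only; gcongr)
      (fun x hx => by
        have := (hb1 _ (hrange x hx)).1
        calc m * φ / 4 = m * (φ / 4) := by ring
          _ ≤ _ := by gcongr)
      (fun x hx => by
        have := (hb1 _ (hrange x hx)).2
        calc m * f1 (m * x) ≤ m * φ := by gcongr
          _ ≤ _ := hmφ)
    simp only [Nat.cast_mul]
    refine hk.trans ?_
    rw [hη]
    rw [show (4:ℝ) / (m * φ / 4) = 16 / φ / m by field_simp; norm_num]
    gcongr
    rw [div_le_iff₀ hφ0]
    calc (16:ℝ) = 1 / Lg ^ 10 * (16 * Lg ^ 10) := by field_simp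
      _ ≤ 1 / Lg ^ 10 * (X * φ) := mul_le_mul_of_nonneg_left (by have := hLp 12; linarith) (by positivity)
      _ = _ := by ring
  · -- type II
    intro K hK1 hK2
    have hK1r : (U:ℝ) < 2 * K := by exact_mod_cast hK1
    have hK2r : (K:ℝ) * U < 2 * X := by exact_mod_cast hK2
    have hK0 : 0 < K := by omega
    have hKr : (0:ℝ) < K := by exact_mod_cast hK0
    obtain ⟨M, hM⟩ : ∃ M, M = min ((X:ℝ) / K) (1 / (2 * φ)) := ⟨_, rfl⟩
    have hM1 : M ≤ X / K := hM ▸ min_le_left _ _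
    have hM2 : M ≤ 1 / (2 * φ) := hM ▸ min_le_right _ _
    have hMlo : 2 * Lg ^ 10 ≤ M := by
      rw [hM, le_min_iff]
      constructor
      · rw [le_div_iff₀ hKr]
        have : (128 * Lg ^ 10) ≤ (U:ℝ) := by linarith
        nlinarith
      · rw [le_div_iff₀ (by positivity)]
        have h26 : Lg ^ 10 ≤ Lg ^ 26 := pow_le_pow_right₀ (by linarith) (by norm_num)
        calc 2 * Lg ^ 10 * (2 * φ) ≤ 2 * Lg ^ 26 * (2 * (1 / (8 * Lg ^ 26))) := by gcongr
          _ = 1 / 2 := by field_simp; norm_num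
          _ ≤ 1 := by norm_num
    have hM1' : 2 ≤ M := by have := hLp 10; linarith
    obtain ⟨D, hD⟩ : ∃ D, D = ⌊M⌋₊ := ⟨_, rfl⟩
    have hDM : (D:ℝ) ≤ M := hD ▸ Nat.floor_le (by linarith)
    have hDM2 : M / 2 ≤ D := by
      have := Nat.lt_floor_add_one M
      rw [← hD] at this
      linarith
    have hD1r : (1:ℝ) ≤ D := by linarith
    have hD1 : 1 ≤ D := by exact_mod_cast hD1r
    have hDK : (D:ℝ) * K ≤ X := by
      calc (D:ℝ) * K ≤ X / K * K := by gcongr; linarith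
        _ = X := by field_simp
    have hDφ : D * φ ≤ 1 / 2 := by
      calc D * φ ≤ 1 / (2 * φ) * φ := by gcongr; linarith
        _ = 1 / 2 := by field_simp
    refine ⟨D, fun i => 16 * Lg / φ * (1 / i), hD1, fun i => by positivity, by exact_mod_cast hDK, ?_, ?_, ?_⟩
    · rw [hη]
      calc (1:ℝ) = 1 / Lg ^ 10 * Lg ^ 10 := by field_simp
        _ ≤ _ := by gcongr; linarith
    · rw [← Finset.mul_sum]
      have hh : ∑ i ∈ Finset.Ico 1 D, 1 / (i:ℝ) ≤ Lg := by
        have h1 := harmonic_le D (2 * X) (by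
          have : (1:ℝ) ≤ K := by exact_mod_cast hK0
          nlinarith) (by linarith)
        rw [← hLg] at h1
        refine le_trans ?_ h1
        apply Finset.sum_le_sum_of_subset_of_nonneg
        · intro i hi; rw [Finset.mem_Ico] at hi; rw [Finset.mem_Icc]; omega
        · intro i _ _; positivity
      calc 16 * Lg / φ * ∑ i ∈ Finset.Ico 1 D, 1 / (i:ℝ) ≤ 16 * Lg / φ * Lg := by gcongr
        _ = 16 * Lg ^ 2 / φ := by ring
        _ ≤ η * K * (M / 2) := by
            rw [hM, div_le_iff₀ hφ0, hη]
            rcases min_cases ((X:ℝ) / K) (1 / (2 * φ)) with ⟨h, _⟩ | ⟨h, _⟩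
            · rw [h]
              rw [show 1 / Lg ^ 10 * K * (X / K / 2) * φ = (X * φ) / (2 * Lg ^ 10) by field_simp]
              rw [le_div_iff₀ (by positivity)]
              calc 16 * Lg ^ 2 * (2 * Lg ^ 10) = 32 * Lg ^ 12 := by ring
                _ ≤ _ := hφ2
            · rw [h]
              rw [show 1 / Lg ^ 10 * K * (1 / (2 * φ) / 2) * φ = K / (4 * Lg ^ 10) by field_simp; norm_num]
              rw [le_div_iff₀ (by positivity)]
              calc 16 * Lg ^ 2 * (4 * Lg ^ 10) = 64 * Lg ^ 12 := by ring
                _ ≤ _ := by linarith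
        _ ≤ _ := by gcongr
    · intro c1 c2 A B h1 h12 hcD hAB _ _ hA hB
      have hr := pair_range X c1 c2 A B h12 h1 hA hB
      have h12r : (c1:ℝ) < c2 := by exact_mod_cast h12
      have h1r : (1:ℝ) ≤ c1 := by exact_mod_cast h1
      have hA0 : (0:ℝ) < A := by
        have : 0 < A := Nat.pos_of_ne_zero (by rintro rfl; omega)
        exact_mod_cast this
      have hcDr : (c2:ℝ) - c1 ≤ D := by
        have : (c2:ℝ) ≤ c1 + D := by exact_mod_cast hcD.le
        linarith
      obtain ⟨δ, hδ⟩ : ∃ δ, δ = (c2:ℝ) - c1 := ⟨_, rfl⟩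
      have hδ0 : 0 < δ := by linarith
      have hδφ : δ * φ ≤ 1 / 2 := by
        calc δ * φ ≤ D * φ := by gcongr; linarith
          _ ≤ _ := hDφ
      -- derivative via mean value
      have hmv : ∀ x ∈ Set.Icc (A:ℝ) B, ∃ ξ ∈ Set.Icc ((X:ℝ) / 2) (2 * X),
          c2 * f1 (c2 * x) - c1 * f1 (c1 * x) = δ * (f1 ξ + ξ * f2 ξ) := by
        intro x hx
        have hx0 : 0 < x := hA0.trans_le hx.1
        obtain ⟨ξ, hξ, h⟩ := mvt (fun u => u * f1 u) (fun u => f1 u + u * f2 u) (c1 * x) (c2 * x) (by gcongr)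
          (fun u hu => by
            have hu' : u ∈ Set.Icc ((X:ℝ) / 2) (2 * X) :=
              ⟨(hr c1 x le_rfl h12r.le hx).1.trans hu.1, hu.2.trans (hr c2 x h12r.le le_rfl hx).2⟩
            have := (hasDerivAt_id u).mul (hf1 u hu')
            refine this.congr_deriv (by simp))
        refine ⟨ξ, ⟨(hr c1 x le_rfl h12r.le hx).1.trans hξ.1.le, hξ.2.le.trans (hr c2 x h12r.le le_rfl hx).2⟩, ?_⟩
        have h3 : x * (c2 * f1 (c2 * x) - c1 * f1 (c1 * x)) = x * (δ * (f1 ξ + ξ * f2 ξ)) := by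
          rw [hδ]; linear_combination h
        exact mul_left_cancel₀ hx0.ne' h3
      have hG' : ∀ x ∈ Set.Icc (A:ℝ) B, HasDerivAt (fun x => c2 * f1 (c2 * x) - c1 * f1 (c1 * x))
          (c2 * (c2 * f2 (c2 * x)) - c1 * (c1 * f2 (c1 * x))) x := by
        intro x hx
        exact ((hasDeriv_scale f1 f2 c2 x (hf1 _ (hr c2 x h12r.le le_rfl hx))).const_mul _).sub
          ((hasDeriv_scale f1 f2 c1 x (hf1 _ (hr c1 x le_rfl h12r.le hx))).const_mul _)
      have hk := kl_cont (fun x => f (c2 * x) - f (c1 * x)) (fun x => c2 * f1 (c2 * x) - c1 * f1 (c1 * x)) A B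
        (δ * φ / (4 * Lg)) (by positivity) (by
          calc δ * φ / (4 * Lg) ≤ δ * φ / 1 := by gcongr; linarith
            _ ≤ _ := by linarith)
        (fun x hx => (hasDeriv_scale f f1 c2 x (hf _ (hr c2 x h12r.le le_rfl hx))).sub
          (hasDeriv_scale f f1 c1 x (hf _ (hr c1 x le_rfl h12r.le hx))))
        (by
          apply antitoneOn_of_deriv_nonpos (convex_Icc _ _)
          · exact fun x hx => (hG' x hx).continuousAt.continuousWithinAt
          · intro x hx
            exact (hG' x (interior_subset hx)).differentiableAt.differentiableWithinAt
          · intro x hx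
            have hx := interior_subset hx
            rw [(hG' x hx).deriv]
            have hx0 : 0 < x := hA0.trans_le hx.1
            have hqq := hq (hr c1 x le_rfl h12r.le hx) (hr c2 x h12r.le le_rfl hx) (by gcongr)
            simp only at hqq
            have h3 : x ^ 2 * (c2 * (c2 * f2 (c2 * x)) - c1 * (c1 * f2 (c1 * x))) ≤ 0 := by
              linarith
            by_contra hcon
            push Not at hcon
            have := mul_pos (pow_pos hx0 2) hcon
            linarith)
        (fun x hx => by
          obtain ⟨ξ, hξ, h⟩ := hmv x hx
          rw [h]
          calc δ * φ / (4 * Lg) = δ * (φ / (4 * Lg)) := by ring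
            _ ≤ _ := by gcongr; exact (hb2 ξ hξ).1)
        (fun x hx => by
          obtain ⟨ξ, hξ, h⟩ := hmv x hx
          rw [h]
          calc _ ≤ δ * φ := by gcongr; exact (hb2 ξ hξ).2
            _ ≤ _ := hδφ)
      have e1 : ∑ k ∈ Finset.Ioc A B, e (f ((c2 * k : ℕ) : ℝ)) * (starRingEnd ℂ) (e (f ((c1 * k : ℕ) : ℝ))) =
          ∑ k ∈ Finset.Ioc A B, e (f (c2 * (k:ℝ)) - f (c1 * (k:ℝ))) := by
        apply Finset.sum_congr rfl
        intro k _
        rw [e_sub]; push_cast; rfl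
      rw [e1]
      refine hk.trans (le_of_eq ?_)
      beta_reduce
      rw [Nat.cast_sub h12.le, ← hδ]
      field_simp; norm_num

end UDP

namespace UDP
open ArithmeticFunction (vonMangoldt moebius)

set_option maxHeartbeats 2000000 in
/-- regime B2 -/
theorem regimeB2 (f f1 f2 q1 : ℝ → ℝ) (X : ℕ) (r Lg : ℝ) (hLg : Lg = 1 + Real.log (2 * X)) (hL : 1000 ≤ Lg)
    (hX : Lg ^ 400 ≤ X) (hr1 : r ≤ 1) (hr0 : 1 / Lg ^ 30 ≤ r)
    (hf : ∀ x ∈ Set.Icc ((X:ℝ) / 2) (2 * X), HasDerivAt f (f1 x) x)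
    (hf1 : ∀ x ∈ Set.Icc ((X:ℝ) / 2) (2 * X), HasDerivAt f1 (f2 x) x)
    (hb1 : ∀ x ∈ Set.Icc ((X:ℝ) / 2) (2 * X), r / 2 ≤ - (x * f2 x) ∧ - (x * f2 x) ≤ r)
    (hq : ∀ x ∈ Set.Icc ((X:ℝ) / 2) (2 * X), HasDerivAt (fun x => x ^ 2 * f2 x) (q1 x) x)
    (hb2 : ∀ x ∈ Set.Icc ((X:ℝ) / 2) (2 * X), r / 4 ≤ - q1 x ∧ - q1 x ≤ r) :
    ‖∑ n ∈ Finset.Ioc X (2 * X), ((vonMangoldt n : ℝ) : ℂ) * e (f n)‖ ≤ 21 * X / Lg := by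
  have hLpos : 0 < Lg := by linarith
  have hLp : ∀ n : ℕ, 1 ≤ Lg ^ n := fun n => one_le_pow₀ (by linarith)
  have hmono : ∀ m n : ℕ, m ≤ n → Lg ^ m ≤ Lg ^ n := fun m n h => pow_le_pow_right₀ (by linarith) h
  have hrpos : 0 < r := lt_of_lt_of_le (by positivity) hr0
  have hL30 : 1 ≤ r * Lg ^ 30 := by rwa [div_le_iff₀ (by positivity)] at hr0
  have hL2 : 1000000 ≤ Lg ^ 2 := by nlinarith
  have hXr1 : (1:ℝ) ≤ X := (hLp 400).trans hX
  have hX1 : 1 ≤ X := by exact_mod_cast hXr1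
  have hXr : (0:ℝ) < X := by linarith
  set U := ⌈Lg ^ 52⌉₊ with hU
  have hU1 : Lg ^ 52 ≤ U := Nat.le_ceil _
  have hU2 : (U:ℝ) ≤ 2 * Lg ^ 52 := by
    have := Nat.ceil_lt_add_one (show 0 ≤ Lg ^ 52 by positivity)
    have := hLp 52
    linarith
  have hUU : (U:ℝ) * U ≤ 4 * Lg ^ 104 := by
    calc (U:ℝ) * U ≤ (2 * Lg ^ 52) * (2 * Lg ^ 52) := by gcongr
      _ = _ := by ring
  have hUbig : (1000:ℝ) ≤ U := by
    calc (1000:ℝ) ≤ Lg ^ 1 := by rw [pow_one]; exact hL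
      _ ≤ Lg ^ 52 := hmono 1 52 (by norm_num)
      _ ≤ U := hU1
  have hUn : 1000 ≤ U := by exact_mod_cast hUbig
  obtain ⟨η, hη⟩ : ∃ η, η = 1 / Lg ^ 10 := ⟨_, rfl⟩
  have hη0 : 0 < η := by rw [hη]; positivity
  have hη1 : η ≤ 1 := by rw [hη, div_le_one (by positivity)]; exact hLp 10
  have hsq : √η = 1 / Lg ^ 5 := by
    rw [hη, show 1 / Lg ^ 10 = (1 / Lg ^ 5) ^ 2 by rw [div_pow, one_pow, ← pow_mul]]
    exact Real.sqrt_sq (by positivity)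
  have hUUX : (U:ℝ) * U ≤ X := by
    calc (U:ℝ) * U ≤ 4 * Lg ^ 104 := hUU
      _ ≤ Lg ^ 2 * Lg ^ 104 := by gcongr; linarith
      _ = Lg ^ 106 := by ring
      _ ≤ Lg ^ 400 := hmono _ _ (by norm_num)
      _ ≤ X := hX
  have main := bilinear (fun n => e (f n)) (fun n => by rw [norm_e]) X U U η hη0 hη1 hX1 (by omega) (by omega)
    (by exact_mod_cast hUUX) ?_ ?_
  · rw [hsq, ← hLg] at main
    refine main.trans (le_of_eq ?_)
    field_simp
  · -- type I
    intro m A B hm hmU hA hAB hB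
    have hmr : (1:ℝ) ≤ m := by exact_mod_cast hm
    have hm0 : (0:ℝ) < m := by linarith
    have hmUr : (m:ℝ) ≤ 4 * Lg ^ 104 := le_trans (by exact_mod_cast hmU) hUU
    have hA' : (X:ℝ) ≤ 2 * m * A := by exact_mod_cast hA
    have hB' : (m:ℝ) * B ≤ 2 * X := by exact_mod_cast hB
    have hrange : ∀ x ∈ Set.Icc (A:ℝ) B, (m:ℝ) * x ∈ Set.Icc ((X:ℝ) / 2) (2 * X) := by
      intro x hx
      have := hx.1; have := hx.2
      constructor <;> nlinarith
    obtain ⟨lam, hlam⟩ : ∃ lam, lam = (m:ℝ) ^ 2 * r / (4 * X) := ⟨_, rfl⟩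
    have hlam0 : 0 < lam := by rw [hlam]; positivity
    have hlamhi : lam ≤ (1 / (224 * Lg ^ 10)) ^ 2 := by
      rw [hlam, div_le_iff₀ (by positivity), div_pow, one_pow, div_mul_eq_mul_div, le_div_iff₀ (by positivity), one_mul]
      calc (m:ℝ) ^ 2 * r * (224 * Lg ^ 10) ^ 2 ≤ (4 * Lg ^ 104) ^ 2 * 1 * (224 * Lg ^ 10) ^ 2 := by gcongr
        _ = 802816 * Lg ^ 228 := by ring
        _ ≤ Lg ^ 2 * Lg ^ 228 := by gcongr; linarith
        _ = Lg ^ 230 := by ring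
        _ ≤ Lg ^ 400 := hmono _ _ (by norm_num)
        _ ≤ X := hX
        _ ≤ 4 * X := by linarith
    have hlamlo : (42 * m * Lg ^ 10 / X) ^ 2 ≤ lam := by
      rw [hlam, div_pow, div_le_div_iff₀ (by positivity) (by positivity)]
      have h1 : 7056 * Lg ^ 20 ≤ r * X := by
        calc 7056 * Lg ^ 20 ≤ Lg ^ 2 * Lg ^ 20 := by gcongr; linarith
          _ = Lg ^ 22 * 1 := by ring
          _ ≤ Lg ^ 22 * (r * Lg ^ 30) := by gcongr
          _ = r * Lg ^ 52 := by ring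
          _ ≤ r * Lg ^ 400 := mul_le_mul_of_nonneg_left (hmono 52 400 (by norm_num)) hrpos.le
          _ ≤ _ := by gcongr
      calc (42 * m * Lg ^ 10) ^ 2 * (4 * X) = (m:ℝ) ^ 2 * X * (7056 * Lg ^ 20) := by ring
        _ ≤ (m:ℝ) ^ 2 * X * (r * X) := by gcongr
        _ = _ := by ring
    have hlam4 : lam ≤ 1 / 4 := by
      refine hlamhi.trans ?_
      have : 1 / (224 * Lg ^ 10) ≤ 1 / 2 := by
        apply one_div_le_one_div_of_le (by norm_num)
        have := hLp 10; linarith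
      calc _ ≤ (1 / 2 : ℝ) ^ 2 := by gcongr
        _ = _ := by norm_num
    have hk := second_cont (fun x => f (m * x)) (fun x => m * f1 (m * x)) (fun x => m * (m * f2 (m * x))) A B
      lam (8 * lam) hlam0 hlam4 (by positivity) hAB
      (fun x hx => hasDeriv_scale f f1 m x (hf _ (hrange x hx)))
      (fun x hx => (hasDeriv_scale f1 f2 m x (hf1 _ (hrange x hx))).const_mul _)
      (fun x hx => by
        have h1 := (hb1 _ (hrange x hx)).1
        have h2 := (hrange x hx)
        have hpos : 0 < (m:ℝ) * x := lt_of_lt_of_le (by positivity) h2.1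
        have h3 : r / (4 * X) ≤ - f2 (m * x) := by
          rw [div_le_iff₀ (by positivity)]
          have hn : 0 ≤ - f2 (m * x) := by
            by_contra hcon
            push Not at hcon
            nlinarith
          nlinarith [h2.2]
        calc lam = m ^ 2 * (r / (4 * X)) := by rw [hlam]; ring
          _ ≤ m ^ 2 * (- f2 (m * x)) := by gcongr
          _ = _ := by ring)
      (fun x hx => by
        have h1 := (hb1 _ (hrange x hx)).1
        have h1' := (hb1 _ (hrange x hx)).2
        have h2 := (hrange x hx)
        have hpos : 0 < (m:ℝ) * x := lt_of_lt_of_le (by positivity) h2.1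
        have h3 : - f2 (m * x) ≤ 2 * r / X := by
          rw [le_div_iff₀ (by positivity)]
          have hn : 0 ≤ - f2 (m * x) := by
            by_contra hcon
            push Not at hcon
            nlinarith
          nlinarith [h2.1]
        calc _ = m ^ 2 * (- f2 (m * x)) := by ring
          _ ≤ m ^ 2 * (2 * r / X) := by gcongr
          _ = 8 * lam := by rw [hlam]; field_simp; norm_num)
    simp only [Nat.cast_mul]
    refine hk.trans ?_
    obtain ⟨s, hs⟩ : ∃ s, s = √lam := ⟨_, rfl⟩
    rw [← hs]
    have hs0 : 0 < s := by rw [hs]; exact Real.sqrt_pos.2 hlam0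
    have hs2 : lam = s ^ 2 := by rw [hs]; exact (Real.sq_sqrt hlam0.le).symm
    have hshi : s ≤ 1 / (224 * Lg ^ 10) := by
      rw [hs]; exact Real.sqrt_le_iff.2 ⟨by positivity, hlamhi⟩
    have hslo : 42 * m * Lg ^ 10 / X ≤ s := by rw [hs]; exact Real.le_sqrt_of_sq_le hlamlo
    have hBA : (B:ℝ) - A ≤ 2 * X / m := by
      rw [le_div_iff₀ hm0]
      have : (0:ℝ) ≤ A := by positivity
      nlinarith
    calc (8 * lam * ((B:ℝ) - A) + 3) * (7 / s) ≤ (8 * lam * (2 * X / m) + 3) * (7 / s) := by gcongr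
      _ = 112 * X / m * s + 21 / s := by rw [hs2]; field_simp; ring
      _ ≤ 112 * X / m * (1 / (224 * Lg ^ 10)) + 21 / (42 * m * Lg ^ 10 / X) := by gcongr
      _ = η * X / m := by rw [hη]; field_simp; norm_num
  · -- type II
    intro K hK1 hK2
    have hK1r : (U:ℝ) < 2 * K := by exact_mod_cast hK1
    have hK2r : (K:ℝ) * U < 2 * X := by exact_mod_cast hK2
    have hK0 : 0 < K := by omega
    have hKr : (0:ℝ) < K := by exact_mod_cast hK0
    have hKlo : Lg ^ 52 ≤ 2 * K := by linarith
    obtain ⟨D, hD⟩ : ∃ D, D = ⌈Lg ^ 10⌉₊ := ⟨_, rfl⟩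
    have hDlo : Lg ^ 10 ≤ D := hD ▸ Nat.le_ceil _
    have hDhi : (D:ℝ) ≤ 2 * Lg ^ 10 := by
      have := Nat.ceil_lt_add_one (show 0 ≤ Lg ^ 10 by positivity)
      rw [← hD] at this
      have := hLp 10
      linarith
    have hD1r : (1:ℝ) ≤ D := (hLp 10).trans hDlo
    have hDK : (D:ℝ) * K ≤ X := by
      have h1 : 2 * (D:ℝ) ≤ U := by
        calc 2 * (D:ℝ) ≤ 4 * Lg ^ 10 := by linarith
          _ ≤ Lg ^ 2 * Lg ^ 10 := by gcongr; linarith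
          _ = Lg ^ 12 := by ring
          _ ≤ Lg ^ 52 := hmono _ _ (by norm_num)
          _ ≤ U := hU1
      nlinarith
    refine ⟨D, fun i => η * K, by exact_mod_cast hD1r, fun i => by positivity, by exact_mod_cast hDK, ?_, ?_, ?_⟩
    · rw [hη]
      calc (1:ℝ) = 1 / Lg ^ 10 * Lg ^ 10 := by field_simp
        _ ≤ _ := by gcongr
    · rw [Finset.sum_const, nsmul_eq_mul, Nat.card_Ico, mul_comm]
      gcongr
      omega
    · intro c1 c2 A B h1 h12 hcD hAB hKA hBK hA hB
      have hr := pair_range X c1 c2 A B h12 h1 hA hB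
      have h12r : (c1:ℝ) < c2 := by exact_mod_cast h12
      have h1r : (1:ℝ) ≤ c1 := by exact_mod_cast h1
      have hA0 : (0:ℝ) < A := by
        have : 0 < A := Nat.pos_of_ne_zero (by rintro rfl; omega)
        exact_mod_cast this
      have hKA' : (K:ℝ) ≤ 2 * A := by exact_mod_cast hKA
      have hBK' : (B:ℝ) ≤ 2 * K := by exact_mod_cast hBK
      have hcDr : (c2:ℝ) - c1 ≤ D := by
        have : (c2:ℝ) ≤ c1 + D := by exact_mod_cast hcD.le
        linarith
      have hδ1 : (1:ℝ) ≤ c2 - c1 := by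
        have : (c1:ℝ) + 1 ≤ c2 := by exact_mod_cast h12
        linarith
      obtain ⟨δ, hδ⟩ : ∃ δ, δ = (c2:ℝ) - c1 := ⟨_, rfl⟩
      rw [← hδ] at hcDr hδ1
      have hδ0 : 0 < δ := by linarith
      obtain ⟨lam, hlam⟩ : ∃ lam, lam = δ * r / (8 * K) := ⟨_, rfl⟩
      have hlam0 : 0 < lam := by rw [hlam]; positivity
      have hlamhi : lam ≤ (1 / (448 * Lg ^ 10)) ^ 2 := by
        rw [hlam, div_le_iff₀ (by positivity), div_pow, one_pow, div_mul_eq_mul_div, le_div_iff₀ (by positivity), one_mul]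
        calc δ * r * (448 * Lg ^ 10) ^ 2 ≤ (2 * Lg ^ 10) * 1 * (448 * Lg ^ 10) ^ 2 := by gcongr; linarith
          _ = 401408 * Lg ^ 30 := by ring
          _ ≤ Lg ^ 2 * Lg ^ 30 := by gcongr; linarith
          _ = Lg ^ 32 := by ring
          _ ≤ Lg ^ 52 := hmono _ _ (by norm_num)
          _ ≤ 2 * K := hKlo
          _ ≤ 8 * K := by linarith
      have hlamlo : (42 * Lg ^ 10 / K) ^ 2 ≤ lam := by
        rw [hlam, div_pow, div_le_div_iff₀ (by positivity) (by positivity)]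
        have h1 : 14112 * Lg ^ 20 ≤ r * K := by
          have : 28224 * Lg ^ 20 ≤ r * (2 * K) := by
            calc 28224 * Lg ^ 20 ≤ Lg ^ 2 * Lg ^ 20 := by gcongr; linarith
              _ = Lg ^ 22 * 1 := by ring
              _ ≤ Lg ^ 22 * (r * Lg ^ 30) := by gcongr
              _ = r * Lg ^ 52 := by ring
              _ ≤ _ := by gcongr
          linarith
        calc (42 * Lg ^ 10) ^ 2 * (8 * K) = 1 * K * (14112 * Lg ^ 20) := by ring
          _ ≤ δ * K * (r * K) := by gcongr
          _ = _ := by ring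
      have hlam4 : lam ≤ 1 / 4 := by
        refine hlamhi.trans ?_
        have : 1 / (448 * Lg ^ 10) ≤ 1 / 2 := by
          apply one_div_le_one_div_of_le (by norm_num)
          have := hLp 10; linarith
        calc _ ≤ (1 / 2 : ℝ) ^ 2 := by gcongr
          _ = _ := by norm_num
      have hmv : ∀ x ∈ Set.Icc (A:ℝ) B, ∃ ξ ∈ Set.Icc ((X:ℝ) / 2) (2 * X),
          c2 * (c2 * f2 (c2 * x)) - c1 * (c1 * f2 (c1 * x)) = δ / x * q1 ξ := by
        intro x hx
        have hx0 : 0 < x := hA0.trans_le hx.1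
        obtain ⟨ξ, hξ, h⟩ := mvt (fun u => u ^ 2 * f2 u) q1 (c1 * x) (c2 * x) (by gcongr)
          (fun u hu => hq u
              ⟨(hr c1 x le_rfl h12r.le hx).1.trans hu.1, hu.2.trans (hr c2 x h12r.le le_rfl hx).2⟩)
        refine ⟨ξ, ⟨(hr c1 x le_rfl h12r.le hx).1.trans hξ.1.le, hξ.2.le.trans (hr c2 x h12r.le le_rfl hx).2⟩, ?_⟩
        have h3 : x ^ 2 * (c2 * (c2 * f2 (c2 * x)) - c1 * (c1 * f2 (c1 * x))) = x ^ 2 * (δ / x * q1 ξ) := by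
          have : x ^ 2 * (δ / x * q1 ξ) = x * δ * q1 ξ := by field_simp
          rw [this, hδ]; linear_combination h
        exact mul_left_cancel₀ (pow_pos hx0 2).ne' h3
      have hk := second_cont (fun x => f (c2 * x) - f (c1 * x)) (fun x => c2 * f1 (c2 * x) - c1 * f1 (c1 * x))
        (fun x => c2 * (c2 * f2 (c2 * x)) - c1 * (c1 * f2 (c1 * x))) A B
        lam (16 * lam) hlam0 hlam4 (by positivity) hAB
        (fun x hx => (hasDeriv_scale f f1 c2 x (hf _ (hr c2 x h12r.le le_rfl hx))).sub
          (hasDeriv_scale f f1 c1 x (hf _ (hr c1 x le_rfl h12r.le hx))))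
        (fun x hx => ((hasDeriv_scale f1 f2 c2 x (hf1 _ (hr c2 x h12r.le le_rfl hx))).const_mul _).sub
          ((hasDeriv_scale f1 f2 c1 x (hf1 _ (hr c1 x le_rfl h12r.le hx))).const_mul _))
        (fun x hx => by
          obtain ⟨ξ, hξ, h⟩ := hmv x hx
          have hx0 : 0 < x := hA0.trans_le hx.1
          have hxK : x ≤ 2 * K := hx.2.trans hBK'
          rw [h]
          calc lam = δ / (2 * K) * (r / 4) := by rw [hlam]; field_simp; norm_num
            _ ≤ δ / x * (- q1 ξ) := by
              gcongr
              exact (hb2 ξ hξ).1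
            _ = _ := by ring)
        (fun x hx => by
          obtain ⟨ξ, hξ, h⟩ := hmv x hx
          have hx0 : 0 < x := hA0.trans_le hx.1
          have hxK : K / 2 ≤ x := by linarith [hx.1]
          rw [h]
          calc _ = δ / x * (- q1 ξ) := by ring
            _ ≤ δ / (K / 2) * r := by
              gcongr
              · linarith [(hb2 ξ hξ).1]
              · exact (hb2 ξ hξ).2
            _ = _ := by rw [hlam]; field_simp; norm_num)
      have e1 : ∑ k ∈ Finset.Ioc A B, e (f ((c2 * k : ℕ) : ℝ)) * (starRingEnd ℂ) (e (f ((c1 * k : ℕ) : ℝ))) =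
          ∑ k ∈ Finset.Ioc A B, e (f (c2 * (k:ℝ)) - f (c1 * (k:ℝ))) := by
        apply Finset.sum_congr rfl
        intro k _
        rw [e_sub]; push_cast; rfl
      rw [e1]
      refine hk.trans ?_
      obtain ⟨s, hs⟩ : ∃ s, s = √lam := ⟨_, rfl⟩
      rw [← hs]
      have hs0 : 0 < s := by rw [hs]; exact Real.sqrt_pos.2 hlam0
      have hs2 : lam = s ^ 2 := by rw [hs]; exact (Real.sq_sqrt hlam0.le).symm
      have hshi : s ≤ 1 / (448 * Lg ^ 10) := by
        rw [hs]; exact Real.sqrt_le_iff.2 ⟨by positivity, hlamhi⟩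
      have hslo : 42 * Lg ^ 10 / K ≤ s := by rw [hs]; exact Real.le_sqrt_of_sq_le hlamlo
      have hBA : (B:ℝ) - A ≤ 2 * K := by linarith
      calc (16 * lam * ((B:ℝ) - A) + 3) * (7 / s) ≤ (16 * lam * (2 * K) + 3) * (7 / s) := by gcongr
        _ = 224 * K * s + 21 / s := by rw [hs2]; field_simp; ring
        _ ≤ 224 * K * (1 / (448 * Lg ^ 10)) + 21 / (42 * Lg ^ 10 / K) := by gcongr
        _ = η * K := by rw [hη]; field_simp; norm_num

end UDP

namespace UDP
open ArithmeticFunction (vonMangoldt moebius)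

lemma e_lip (x y : ℝ) : ‖e x - e y‖ ≤ 7 * |x - y| := by
  have h1 : e x - e y = e y * (e (x - y) - 1) := by
    have : x = y + (x - y) := by ring
    nth_rewrite 1 [this]
    rw [e_add]; ring
  rw [h1, norm_mul, norm_e, one_mul]
  have h2 : e (x - y) = Complex.exp (Complex.I * ((2 * Real.pi * (x - y) : ℝ) : ℂ)) := by
    rw [e]; push_cast; ring_nf
  rw [h2]
  refine (Real.norm_exp_I_mul_ofReal_sub_one_le).trans ?_
  rw [Real.norm_eq_abs, abs_mul, abs_of_pos Real.two_pi_pos]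
  have := Real.pi_lt_d2
  gcongr
  linarith

theorem regimeA (j : ℕ) (hj : 1 ≤ j) : ∃ C : ℝ, 0 < C ∧ ∀ (f f1 : ℝ → ℝ) (X : ℕ) (θ M : ℝ), 4 ≤ X →
    0 < θ → M ≤ 1 / 2 →
    (∀ x ∈ Set.Icc (X:ℝ) (2 * X), HasDerivAt f (f1 x) x) →
    (AntitoneOn f1 (Set.Icc (X:ℝ) (2 * X))) →
    (∀ x ∈ Set.Icc (X:ℝ) (2 * X), θ ≤ f1 x ∧ f1 x ≤ M) →
    ‖∑ n ∈ Finset.Ioc X (2 * X), ((vonMangoldt n : ℝ) : ℂ) * e (f n)‖ ≤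
      4 / θ + C * X / Real.log X ^ j * (1 + 7 * X * M) := by
  obtain ⟨C, hC0, hC⟩ := pnt j hj
  refine ⟨6 * C, by positivity, fun f f1 X θ M hX hθ hM hf hanti hb => ?_⟩
  have hX0 : (4:ℝ) ≤ X := by exact_mod_cast hX
  have hl := one_le_log (show 3 ≤ X by omega)
  have hMθ : θ ≤ M := by
    have := hb X ⟨le_rfl, by linarith⟩
    linarith [this.1, this.2]
  have hM0 : 0 ≤ M := by linarith
  have h1 : ‖∑ n ∈ Finset.Ioc X (2 * X), e (f n)‖ ≤ 4 / θ := by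
    refine kl_cont f f1 X (2 * X) θ hθ (by linarith) ?_ ?_ ?_ ?_
    · intro x hx; push_cast at hx; exact hf x hx
    · push_cast; exact hanti
    · intro x hx; push_cast at hx; exact (hb x hx).1
    · intro x hx; push_cast at hx; exact (hb x hx).2.trans hM
  have hP : ∀ N : ℕ, X ≤ N → N ≤ 3 * X → |PsiK 0 N| ≤ 3 * C * X / Real.log X ^ j := by
    intro N h1 h2
    refine (hC N (by omega)).trans ?_
    have h3 : (N:ℝ) ≤ 3 * X := by exact_mod_cast h2
    have h4 : Real.log X ≤ Real.log N := Real.log_le_log (by linarith) (by exact_mod_cast h1)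
    have h5 : Real.log X ^ j ≤ Real.log N ^ j := pow_le_pow_left₀ (by linarith) h4 j
    have h6 : C * N ≤ 3 * C * X := by nlinarith
    exact div_le_div₀ (by positivity) h6 (by positivity) h5
  have h2 : ‖∑ n ∈ Finset.Ioc X (2 * X), (((vonMangoldt n - 1 : ℝ)) : ℂ) * e (f n)‖ ≤
      6 * C * X / Real.log X ^ j * (1 + 7 * X * M) := by
    have e2 : 2 * X = X + X := by ring
    rw [e2, sum_Ioc_shift]
    have := abel_bound (fun i => ((vonMangoldt (X + 1 + i) - 1 : ℝ) : ℂ))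
      (fun i => e (f (min (X + 1 + i) (2 * X) : ℕ))) (6 * C * X / Real.log X ^ j) X ?_
    · have e3 : ∑ i ∈ Finset.range X, (((vonMangoldt (X + 1 + i) - 1 : ℝ)) : ℂ) * e (f (X + 1 + i : ℕ))
          = ∑ i ∈ Finset.range X, e (f (min (X + 1 + i) (2 * X) : ℕ)) * ((vonMangoldt (X + 1 + i) - 1 : ℝ) : ℂ) := by
        refine Finset.sum_congr rfl fun i hi => ?_
        have := Finset.mem_range.1 hi
        rw [min_eq_left (by omega), mul_comm]
      rw [e3]
      refine this.trans ?_
      refine mul_le_mul_of_nonneg_left ?_ (by positivity)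
      rw [norm_e]
      have : ∑ i ∈ Finset.range X, ‖e (f (min (X + 1 + (i + 1)) (2 * X) : ℕ)) - e (f (min (X + 1 + i) (2 * X) : ℕ))‖
          ≤ ∑ i ∈ Finset.range X, 7 * M := by
        refine Finset.sum_le_sum fun i hi => ?_
        have hi := Finset.mem_range.1 hi
        rcases Nat.lt_or_ge (X + 1 + i) (2 * X) with h | h
        · rw [min_eq_left (by omega), min_eq_left (by omega)]
          have hi' : (X:ℝ) + 1 + i + 1 ≤ 2 * X := by exact_mod_cast h
          obtain ⟨c, hc, hc2⟩ := mvt f f1 ((X + 1 + i : ℕ) : ℝ) ((X + 1 + (i + 1) : ℕ) : ℝ) (by push_cast; linarith) (by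
            intro x hx
            push_cast at hx
            exact hf x ⟨by linarith [hx.1, (Nat.cast_nonneg i : (0:ℝ) ≤ i)], by linarith [hx.2]⟩)
          push_cast at hc
          have hb' := hb c ⟨by linarith [hc.1, (Nat.cast_nonneg i : (0:ℝ) ≤ i)], by linarith [hc.2]⟩
          refine (e_lip _ _).trans ?_
          rw [hc2]
          push_cast
          have e5 : f1 c * ((X:ℝ) + 1 + (i + 1) - (X + 1 + i)) = f1 c := by ring
          rw [e5, abs_of_pos (by linarith [hb'.1])]
          linarith [hb'.2]
        · rw [min_eq_right (by omega), min_eq_right (by omega)]; simp; linarith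
      rw [Finset.sum_const, Finset.card_range, nsmul_eq_mul] at this
      linarith
    · intro m hm
      have e4 : ∑ i ∈ Finset.range m, ((vonMangoldt (X + 1 + i) - 1 : ℝ) : ℂ) = ((PsiK 0 (X + 1 + m) - PsiK 0 (X + 1) : ℝ) : ℂ) := by
        rw [PsiK, PsiK, Finset.sum_range_add, add_sub_cancel_left]
        rw [← Complex.ofReal_sum]
        simp [aK]
      rw [e4, Complex.norm_real]
      refine (norm_sub_le _ _).trans ?_
      have a1 := hP (X + 1 + m) (by omega) (by omega)
      have a2 := hP (X + 1) (by omega) (by omega)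
      rw [Real.norm_eq_abs, Real.norm_eq_abs]
      have : 6 * C * X / Real.log X ^ j = 3 * C * X / Real.log X ^ j + 3 * C * X / Real.log X ^ j := by ring
      linarith
  have h3 : ∑ n ∈ Finset.Ioc X (2 * X), ((vonMangoldt n : ℝ) : ℂ) * e (f n) =
     ∑ n ∈ Finset.Ioc X (2 * X), e (f n) + ∑ n ∈ Finset.Ioc X (2 * X), (((vonMangoldt n - 1 : ℝ)) : ℂ) * e (f n) := by
    rw [← Finset.sum_add_distrib]
    refine Finset.sum_congr rfl fun i hi => ?_
    push_cast; ring
  rw [h3]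
  exact (norm_add_le _ _).trans (add_le_add h1 h2)

end UDP

namespace UDP

/-- Function-level Hardy field. -/
structure HF (K : Set (ℝ → ℝ)) : Prop where
  congr : ∀ {φ ψ : ℝ → ℝ}, φ ∈ K → φ =ᶠ[atTop] ψ → ψ ∈ K
  one : (1 : ℝ → ℝ) ∈ K
  neg : ∀ {φ : ℝ → ℝ}, φ ∈ K → -φ ∈ K
  add : ∀ {φ ψ : ℝ → ℝ}, φ ∈ K → ψ ∈ K → φ + ψ ∈ K
  mul : ∀ {φ ψ : ℝ → ℝ}, φ ∈ K → ψ ∈ K → φ * ψ ∈ K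
  inv : ∀ {φ : ℝ → ℝ}, φ ∈ K → φ⁻¹ ∈ K
  diff : ∀ {φ : ℝ → ℝ}, φ ∈ K → ∀ᶠ x in atTop, DifferentiableAt ℝ φ x
  deriv : ∀ {φ : ℝ → ℝ}, φ ∈ K → deriv φ ∈ K
  tri : ∀ {φ : ℝ → ℝ}, φ ∈ K → φ =ᶠ[atTop] 0 ∨ ∀ᶠ x in atTop, φ x ≠ 0

lemma ev_nhds {p : ℝ → Prop} (h : ∀ᶠ x in atTop, p x) : ∀ᶠ x in atTop, ∀ᶠ y in 𝓝 x, p y := by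
  obtain ⟨a, ha⟩ := eventually_atTop.1 h
  filter_upwards [eventually_gt_atTop a] with x hx
  filter_upwards [lt_mem_nhds hx] with y hy using ha y hy.le

lemma deriv_congr_ev {φ ψ : ℝ → ℝ} (h : φ =ᶠ[atTop] ψ) : deriv φ =ᶠ[atTop] deriv ψ := by
  filter_upwards [ev_nhds h] with x hx
  exact Filter.EventuallyEq.deriv_eq hx

lemma diff_congr_ev {φ ψ : ℝ → ℝ} (h : φ =ᶠ[atTop] ψ) (hd : ∀ᶠ x in atTop, DifferentiableAt ℝ φ x) :
    ∀ᶠ x in atTop, DifferentiableAt ℝ ψ x := by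
  filter_upwards [ev_nhds h, hd] with x hx h2
  exact h2.congr_of_eventuallyEq (Filter.EventuallyEq.symm hx)

lemma HF.of_hardy (H : Subring (Filter.Germ (Filter.atTop : Filter ℝ) ℝ)) (hH : IsHardyField H) :
    HF {φ | germAtTop φ ∈ H} := by
  have hinv : ∀ φ : ℝ → ℝ, germAtTop φ ∈ H → (φ =ᶠ[atTop] 0) ∨ ((∀ᶠ x in atTop, φ x ≠ 0) ∧ germAtTop φ⁻¹ ∈ H) := by
    intro φ hφ
    by_cases h0 : germAtTop φ = 0
    · left; exact Filter.Germ.coe_eq.1 h0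
    · right
      obtain ⟨h, hh, h1⟩ := hH.1 _ hφ h0
      induction h using Filter.Germ.inductionOn with
      | _ ψ =>
      have h2 : φ * ψ =ᶠ[atTop] 1 := Filter.Germ.coe_eq.1 h1
      have h3 : ∀ᶠ x in atTop, φ x ≠ 0 := by
        filter_upwards [h2] with x hx h0
        simp [h0] at hx
      refine ⟨h3, ?_⟩
      have : germAtTop φ⁻¹ = (ψ : Filter.Germ atTop ℝ) := by
        refine Filter.Germ.coe_eq.2 ?_
        filter_upwards [h2, h3] with x hx h0
        simp only [Pi.mul_apply, Pi.one_apply] at hx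
        simp only [Pi.inv_apply]
        field_simp
        linarith
      rw [this]; exact hh
  have hd : ∀ φ : ℝ → ℝ, germAtTop φ ∈ H → (∀ᶠ x in atTop, DifferentiableAt ℝ φ x) ∧ germAtTop (_root_.deriv φ) ∈ H := by
    intro φ hφ
    obtain ⟨f, hf, h1, h2⟩ := hH.2 _ hφ
    have h3 : f =ᶠ[atTop] φ := Filter.Germ.coe_eq.1 hf
    refine ⟨diff_congr_ev h3 h1, ?_⟩
    have : germAtTop (_root_.deriv φ) = germAtTop (_root_.deriv f) := Filter.Germ.coe_eq.2 (deriv_congr_ev h3.symm)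
    rw [this]; exact h2
  refine ⟨?_, ?_, ?_, ?_, ?_, ?_, ?_, ?_, ?_⟩
  · intro φ ψ h1 h2
    have : germAtTop ψ = germAtTop φ := Filter.Germ.coe_eq.2 h2.symm
    simp only [Set.mem_setOf_eq] at *
    rw [this]; exact h1
  · exact H.one_mem
  · intro φ h; exact H.neg_mem h
  · intro φ ψ h1 h2; exact H.add_mem h1 h2
  · intro φ ψ h1 h2; exact H.mul_mem h1 h2
  · intro φ h
    rcases hinv φ h with h0 | h0
    · have : germAtTop φ⁻¹ = 0 := by
        refine Filter.Germ.coe_eq.2 ?_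
        filter_upwards [h0] with x hx
        simp at hx ⊢; exact hx
      show germAtTop φ⁻¹ ∈ H
      rw [this]; exact H.zero_mem
    · exact h0.2
  · intro φ h; exact (hd φ h).1
  · intro φ h; exact (hd φ h).2
  · intro φ h; exact (hinv φ h).imp id (fun h => h.1)

namespace HF

lemma zero {K : Set (ℝ → ℝ)} (hK : HF K) : (0 : ℝ → ℝ) ∈ K := by
  have := hK.add hK.one (hK.neg hK.one)
  rwa [add_neg_cancel] at this

lemma sub {K : Set (ℝ → ℝ)} (hK : HF K) {φ ψ : ℝ → ℝ} (h1 : φ ∈ K) (h2 : ψ ∈ K) : φ - ψ ∈ K := by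
  rw [sub_eq_add_neg]; exact hK.add h1 (hK.neg h2)

lemma nat {K : Set (ℝ → ℝ)} (hK : HF K) (n : ℕ) : (fun _ => (n:ℝ)) ∈ K := by
  induction n with
  | zero => exact hK.congr hK.zero (Eventually.of_forall fun x => by simp)
  | succ n ih =>
    have := hK.add ih hK.one
    refine hK.congr this (Eventually.of_forall fun x => ?_)
    simp

lemma int {K : Set (ℝ → ℝ)} (hK : HF K) (n : ℤ) : (fun _ => (n:ℝ)) ∈ K := by
  rcases Int.eq_nat_or_neg n with ⟨m, rfl | rfl⟩
  · exact hK.congr (hK.nat m) (Eventually.of_forall fun x => by simp)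
  · exact hK.congr (hK.neg (hK.nat m)) (Eventually.of_forall fun x => by simp)

lemma pow {K : Set (ℝ → ℝ)} (hK : HF K) {φ : ℝ → ℝ} (h : φ ∈ K) (n : ℕ) : φ ^ n ∈ K := by
  induction n with
  | zero => simpa using hK.one
  | succ n ih => rw [pow_succ]; exact hK.mul ih h

end HF

/-- polynomials of degree `< n` in `y` -/
def Pol (K : Set (ℝ → ℝ)) (y : ℝ → ℝ) : ℕ → Set (ℝ → ℝ)
  | 0 => {φ | φ =ᶠ[atTop] 0}
  | (n + 1) => {φ | ∃ a ∈ K, ∃ p ∈ Pol K y n, φ =ᶠ[atTop] a * y ^ n + p}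

section
variable {K : Set (ℝ → ℝ)} {y : ℝ → ℝ}

lemma Pol_congr (n : ℕ) {φ ψ : ℝ → ℝ} (h : φ ∈ Pol K y n) (h2 : φ =ᶠ[atTop] ψ) : ψ ∈ Pol K y n := by
  cases n with
  | zero => exact h2.symm.trans h
  | succ n =>
    obtain ⟨a, ha, p, hp, h⟩ := h
    exact ⟨a, ha, p, hp, h2.symm.trans h⟩

lemma Pol_succ (hK : HF K) (n : ℕ) {φ : ℝ → ℝ} (h : φ ∈ Pol K y n) : φ ∈ Pol K y (n + 1) :=
  ⟨0, hK.zero, φ, h, by simp⟩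

lemma Pol_mono (hK : HF K) {m n : ℕ} (hmn : m ≤ n) {φ : ℝ → ℝ} (h : φ ∈ Pol K y m) : φ ∈ Pol K y n := by
  induction n, hmn using Nat.le_induction with
  | base => exact h
  | succ n _ ih => exact Pol_succ hK n ih

lemma Pol_zero (hK : HF K) (n : ℕ) : (0 : ℝ → ℝ) ∈ Pol K y n :=
  Pol_mono hK (Nat.zero_le n) (EventuallyEq.refl _ _)

lemma Pol_add (hK : HF K) (n : ℕ) {φ ψ : ℝ → ℝ} (h : φ ∈ Pol K y n) (h2 : ψ ∈ Pol K y n) :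
    φ + ψ ∈ Pol K y n := by
  induction n generalizing φ ψ with
  | zero =>
    have := EventuallyEq.add (show φ =ᶠ[atTop] 0 from h) (show ψ =ᶠ[atTop] 0 from h2)
    exact this.trans (by simp)
  | succ n ih =>
    obtain ⟨a, ha, p, hp, h⟩ := h
    obtain ⟨b, hb, q, hq, h2⟩ := h2
    refine ⟨a + b, hK.add ha hb, p + q, ih hp hq, (h.add h2).trans ?_⟩
    exact Eventually.of_forall fun x => by simp; ring

lemma Pol_smul (hK : HF K) (n : ℕ) {c φ : ℝ → ℝ} (hc : c ∈ K) (h : φ ∈ Pol K y n) : c * φ ∈ Pol K y n := by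
  induction n generalizing φ with
  | zero =>
    have : c * φ =ᶠ[atTop] c * 0 := EventuallyEq.mul (EventuallyEq.refl _ c) (show φ =ᶠ[atTop] 0 from h)
    exact this.trans (by simp)
  | succ n ih =>
    obtain ⟨a, ha, p, hp, h⟩ := h
    refine ⟨c * a, hK.mul hc ha, c * p, ih hp, (EventuallyEq.mul (EventuallyEq.refl _ c) h).trans ?_⟩
    exact Eventually.of_forall fun x => by simp; ring

lemma Pol_mono_mem (hK : HF K) (n : ℕ) {a : ℝ → ℝ} (ha : a ∈ K) : a * y ^ n ∈ Pol K y (n + 1) :=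
  ⟨a, ha, 0, Pol_zero hK n, by simp⟩

lemma Pol_mul_y (hK : HF K) (n : ℕ) {φ : ℝ → ℝ} (h : φ ∈ Pol K y n) : y * φ ∈ Pol K y (n + 1) := by
  induction n generalizing φ with
  | zero =>
    have : y * φ =ᶠ[atTop] y * 0 := EventuallyEq.mul (EventuallyEq.refl _ y) (show φ =ᶠ[atTop] 0 from h)
    exact Pol_succ hK 0 (this.trans (by simp))
  | succ n ih =>
    obtain ⟨a, ha, p, hp, h⟩ := h
    refine ⟨a, ha, y * p, ih hp, (EventuallyEq.mul (EventuallyEq.refl _ y) h).trans ?_⟩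
    exact Eventually.of_forall fun x => by simp; ring

lemma Pol_mul_ypow (hK : HF K) (n m : ℕ) {φ : ℝ → ℝ} (h : φ ∈ Pol K y n) : y ^ m * φ ∈ Pol K y (n + m) := by
  induction m with
  | zero => simpa using h
  | succ m ih =>
    have := Pol_mul_y hK _ ih
    rw [pow_succ', mul_assoc]; exact this

lemma Pol_mul (hK : HF K) (n m : ℕ) {φ ψ : ℝ → ℝ} (h : φ ∈ Pol K y n) (h2 : ψ ∈ Pol K y m) :
    φ * ψ ∈ Pol K y (m + n) := by
  induction n generalizing φ with
  | zero =>
    have : φ * ψ =ᶠ[atTop] 0 * ψ := EventuallyEq.mul (show φ =ᶠ[atTop] 0 from h) (EventuallyEq.refl _ ψ)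
    exact Pol_congr _ (Pol_zero hK _) (this.trans (by simp)).symm
  | succ n ih =>
    obtain ⟨a, ha, p, hp, h⟩ := h
    have h3 := Pol_succ hK _ (Pol_add hK _ (Pol_mul_ypow hK m n (Pol_smul hK m ha h2)) (ih hp))
    refine Pol_congr _ h3 ?_
    filter_upwards [h] with x hx
    simp [hx]; ring

lemma Pol_deriv (hK : HF K) (hy : ∀ᶠ x in atTop, DifferentiableAt ℝ y x) (hy' : deriv y ∈ K) (n : ℕ)
    {φ : ℝ → ℝ} (h : φ ∈ Pol K y n) :
    (∀ᶠ x in atTop, DifferentiableAt ℝ φ x) ∧ deriv φ ∈ Pol K y n := by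
  induction n generalizing φ with
  | zero =>
    have h' : φ =ᶠ[atTop] 0 := h
    refine ⟨diff_congr_ev h'.symm (Eventually.of_forall fun x => ?_), (deriv_congr_ev h').trans ?_⟩
    · exact differentiableAt_const (0:ℝ)
    · refine Eventually.of_forall fun x => ?_
      show deriv (fun _ => (0:ℝ)) x = 0
      simp
  | succ n ih =>
    obtain ⟨a, ha, p, hp, h⟩ := h
    obtain ⟨p1, p2⟩ := ih hp
    have had := hK.diff ha
    refine ⟨diff_congr_ev h.symm ?_, ?_⟩
    · filter_upwards [had, p1, hy] with x h1 h2 h3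
      exact (h1.mul (h3.pow n)).add h2
    · have e1 : deriv φ =ᶠ[atTop] (deriv a * y ^ n) + (((fun _ => (n:ℝ)) * a * deriv y) * y ^ (n - 1) + deriv p) := by
        refine (deriv_congr_ev h).trans ?_
        filter_upwards [had, p1, hy] with x h1 h2 h3
        have := ((h1.hasDerivAt.mul (h3.hasDerivAt.pow n)).add h2.hasDerivAt).deriv
        rw [this]
        simp; ring
      refine ⟨_, hK.deriv ha, _, ?_, e1⟩
      refine Pol_add hK n ?_ p2
      cases n with
      | zero => exact Pol_congr _ (Pol_zero hK _) (by simp; exact Eventually.of_forall fun x => by simp)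
      | succ n => exact Pol_mono_mem hK n (hK.mul (hK.mul (hK.nat _) ha) hy')

lemma tri_of_deriv {ψ : ℝ → ℝ} (hd : ∀ᶠ x in atTop, DifferentiableAt ℝ ψ x)
    (h : deriv ψ =ᶠ[atTop] 0 ∨ ∀ᶠ x in atTop, deriv ψ x ≠ 0) :
    ψ =ᶠ[atTop] 0 ∨ ∀ᶠ x in atTop, ψ x ≠ 0 := by
  rcases h with h | h
  · obtain ⟨A, hA⟩ := eventually_atTop.1 (hd.and h)
    have hc : ∀ x, A < x → ψ x = ψ A := by
      intro x hx
      obtain ⟨c, hc, h2⟩ := mvt ψ (deriv ψ) A x hx (fun z hz => (hA z hz.1).1.hasDerivAt)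
      rw [(hA c hc.1.le).2] at h2
      simp at h2; linarith
    by_cases h0 : ψ A = 0
    · left; filter_upwards [eventually_gt_atTop A] with x hx
      rw [hc x hx, h0]; rfl
    · right; filter_upwards [eventually_gt_atTop A] with x hx
      rw [hc x hx]; exact h0
  · right
    obtain ⟨A, hA⟩ := eventually_atTop.1 (hd.and h)
    by_cases hz : ∃ z, A < z ∧ ψ z = 0
    · obtain ⟨z, hz1, hz2⟩ := hz
      filter_upwards [eventually_gt_atTop z] with x hx h0
      obtain ⟨c, hc, h2⟩ := mvt ψ (deriv ψ) z x hx (fun w hw => (hA w (by linarith [hw.1])).1.hasDerivAt)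
      rw [h0, hz2, sub_zero] at h2
      rcases mul_eq_zero.1 h2.symm with h3 | h3
      · exact (hA c (by linarith [hc.1])).2 h3
      · linarith
    · push Not at hz
      filter_upwards [eventually_gt_atTop A] with x hx using hz x hx

lemma Pol_tri (hK : HF K) (hy : ∀ᶠ x in atTop, DifferentiableAt ℝ y x) (hy' : deriv y ∈ K) (n : ℕ)
    {φ : ℝ → ℝ} (h : φ ∈ Pol K y n) : φ =ᶠ[atTop] 0 ∨ ∀ᶠ x in atTop, φ x ≠ 0 := by
  induction n generalizing φ with
  | zero => left; exact h
  | succ n ih =>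
    obtain ⟨a, ha, p, hp, h⟩ := h
    rcases hK.tri ha with h0 | h0
    · refine ih (Pol_congr n hp ?_)
      filter_upwards [h, h0] with x hx hx0
      simp [hx, hx0]
    · have hap := Pol_smul hK n (hK.inv ha) hp
      obtain ⟨p1, p2⟩ := Pol_deriv hK hy hy' n hap
      have hd : ∀ᶠ x in atTop, DifferentiableAt ℝ (y ^ n + a⁻¹ * p) x := by
        filter_upwards [p1, hy] with x h2 h3
        exact ((h3.pow n)).add h2
      have key := tri_of_deriv hd (by
        refine ih ?_
        have e1 : deriv (y ^ n + a⁻¹ * p) =ᶠ[atTop] (((fun _ => (n:ℝ)) * deriv y) * y ^ (n - 1) + deriv (a⁻¹ * p)) := by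
          filter_upwards [p1, hy] with x h2 h3
          have := ((h3.hasDerivAt.pow n).add h2.hasDerivAt).deriv
          rw [this]
          simp; ring
        refine Pol_congr _ ?_ e1.symm
        refine Pol_add hK n ?_ p2
        cases n with
        | zero => exact Pol_congr _ (Pol_zero hK _) (by simp; exact Eventually.of_forall fun x => by simp)
        | succ n => exact Pol_mono_mem hK n (hK.mul (hK.nat _) hy'))
      rcases key with h1 | h1
      · left
        filter_upwards [h, h0, h1] with x hx hx0 hx1
        simp at hx1 hx ⊢
        rw [hx]
        have : a x * y x ^ n + p x = a x * (y x ^ n + (a x)⁻¹ * p x) := by field_simp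
        rw [this, hx1, mul_zero]
      · right
        filter_upwards [h, h0, h1] with x hx hx0 hx1
        simp at hx1 hx ⊢
        rw [hx]
        have : a x * y x ^ n + p x = a x * (y x ^ n + (a x)⁻¹ * p x) := by field_simp
        rw [this]
        exact mul_ne_zero hx0 hx1

/-- the extension field -/
def Ext (K : Set (ℝ → ℝ)) (y : ℝ → ℝ) : Set (ℝ → ℝ) :=
  {φ | ∃ n, ∃ p ∈ Pol K y n, ∃ q ∈ Pol K y n, (∀ᶠ x in atTop, q x ≠ 0) ∧ φ =ᶠ[atTop] p * q⁻¹}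

lemma Ext_mk (hK : HF K) {n m : ℕ} {φ p q : ℝ → ℝ} (hp : p ∈ Pol K y n) (hq : q ∈ Pol K y m)
    (hq0 : ∀ᶠ x in atTop, q x ≠ 0) (h : φ =ᶠ[atTop] p * q⁻¹) : φ ∈ Ext K y :=
  ⟨max n m, p, Pol_mono hK (le_max_left _ _) hp, q, Pol_mono hK (le_max_right _ _) hq, hq0, h⟩

lemma Pol_one (hK : HF K) : (1 : ℝ → ℝ) ∈ Pol K y 1 :=
  Pol_congr _ (Pol_mono_mem hK 0 hK.one) (by simp)

lemma Ext_of_Pol (hK : HF K) {n : ℕ} {p : ℝ → ℝ} (hp : p ∈ Pol K y n) : p ∈ Ext K y :=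
  Ext_mk hK hp (Pol_one hK) (by simp) (by simp)

lemma Ext_K (hK : HF K) {a : ℝ → ℝ} (ha : a ∈ K) : a ∈ Ext K y :=
  Ext_of_Pol hK (n := 1) (Pol_congr _ (Pol_mono_mem hK 0 ha) (by simp))

lemma Ext_y (hK : HF K) : y ∈ Ext K y :=
  Ext_of_Pol hK (n := 2) (Pol_congr _ (Pol_mono_mem hK 1 hK.one) (by simp))

theorem Ext_HF (hK : HF K) (hy : ∀ᶠ x in atTop, DifferentiableAt ℝ y x) (hy' : deriv y ∈ K) : HF (Ext K y) := by
  have hc : ∀ {φ ψ : ℝ → ℝ}, φ ∈ Ext K y → φ =ᶠ[atTop] ψ → ψ ∈ Ext K y := by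
    rintro φ ψ ⟨n, p, hp, q, hq, h0, h⟩ h2
    exact ⟨n, p, hp, q, hq, h0, h2.symm.trans h⟩
  have hdiff : ∀ {φ : ℝ → ℝ}, φ ∈ Ext K y → (∀ᶠ x in atTop, DifferentiableAt ℝ φ x) ∧ deriv φ ∈ Ext K y := by
    rintro φ ⟨n, p, hp, q, hq, h0, h⟩
    obtain ⟨p1, p2⟩ := Pol_deriv hK hy hy' n hp
    obtain ⟨q1, q2⟩ := Pol_deriv hK hy hy' n hq
    refine ⟨diff_congr_ev h.symm ?_, ?_⟩
    · filter_upwards [p1, q1, h0] with x h1 h2 h3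
      exact h1.mul (h2.inv h3)
    · have hn := Pol_smul hK _ (hK.neg hK.one) (Pol_mul hK _ _ hp q2)
      refine Ext_mk hK (Pol_add hK _ (Pol_mul hK _ _ p2 hq) hn) (Pol_mul hK _ _ hq hq) ?_ ?_
      · filter_upwards [h0] with x hx
        exact mul_ne_zero hx hx
      · refine (deriv_congr_ev h).trans ?_
        filter_upwards [p1, q1, h0] with x h1 h2 h3
        have := (h1.hasDerivAt.mul (h2.hasDerivAt.inv h3)).deriv
        rw [this]
        simp
        field_simp
  refine ⟨hc, Ext_K hK hK.one, ?_, ?_, ?_, ?_, fun h => (hdiff h).1, fun h => (hdiff h).2, ?_⟩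
  · rintro φ ⟨n, p, hp, q, hq, h0, h⟩
    refine ⟨n, _, Pol_smul hK _ (hK.neg hK.one) hp, q, hq, h0, ?_⟩
    filter_upwards [h] with x hx
    simp [hx]
  · rintro φ ψ ⟨n, p, hp, q, hq, h0, h⟩ ⟨m, r, hr, s, hs, h0', h'⟩
    have a1 := Pol_mono hK (show m + n ≤ n + m by omega) (Pol_mul hK _ _ hp hs)
    refine Ext_mk hK (Pol_add hK _ a1 (Pol_mul hK _ _ hr hq)) (Pol_mul hK _ _ hq hs) ?_ ?_
    · filter_upwards [h0, h0'] with x h1 h2 using mul_ne_zero h1 h2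
    · filter_upwards [h, h', h0, h0'] with x h1 h2 h3 h4
      simp [h1, h2]; field_simp
  · rintro φ ψ ⟨n, p, hp, q, hq, h0, h⟩ ⟨m, r, hr, s, hs, h0', h'⟩
    refine Ext_mk hK (Pol_mul hK _ _ hp hr) (Pol_mul hK _ _ hq hs) ?_ ?_
    · filter_upwards [h0, h0'] with x h1 h2 using mul_ne_zero h1 h2
    · filter_upwards [h, h'] with x h1 h2
      simp [h1, h2]; ring
  · rintro φ ⟨n, p, hp, q, hq, h0, h⟩
    rcases Pol_tri hK hy hy' n hp with h1 | h1
    · refine hc (Ext_K hK hK.zero) ?_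
      filter_upwards [h, h1] with x a b
      simp [a, b]
    · refine ⟨n, q, hq, p, hp, h1, ?_⟩
      filter_upwards [h] with x a
      simp [a, mul_comm]
  · rintro φ ⟨n, p, hp, q, hq, h0, h⟩
    rcases Pol_tri hK hy hy' n hp with h1 | h1
    · left
      filter_upwards [h, h1] with x a b
      simp [a, b]
    · right
      filter_upwards [h, h1, h0] with x a b c
      rw [a]; exact mul_ne_zero b (inv_ne_zero c)
end

end UDP

namespace UDP

lemma exists_ext (H : Subring (Filter.Germ (Filter.atTop : Filter ℝ) ℝ)) (hH : IsHardyField H)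
    (f : ℝ → ℝ) (hf : germAtTop f ∈ H) :
    ∃ K : Set (ℝ → ℝ), HF K ∧ (fun x => x) ∈ K ∧ Real.log ∈ K ∧ f ∈ K := by
  have h0 := HF.of_hardy H hH
  have h1 := Ext_HF (y := fun x : ℝ => x) h0 (Eventually.of_forall fun x => differentiableAt_id) (by
    refine h0.congr h0.one (Eventually.of_forall fun x => ?_)
    simp)
  have hx := Ext_y (y := fun x : ℝ => x) h0
  have h2 := Ext_HF (y := Real.log) h1 (by
      filter_upwards [eventually_gt_atTop 0] with x hx
      exact Real.differentiableAt_log hx.ne') (by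
    refine h1.congr (h1.inv hx) (Eventually.of_forall fun x => ?_)
    simp)
  exact ⟨_, h2, Ext_K h1 hx, Ext_y h1, Ext_K h1 (Ext_K h0 hf)⟩

namespace HF

lemma sign {K : Set (ℝ → ℝ)} (hK : HF K) {φ : ℝ → ℝ} (h : φ ∈ K) :
    (∀ᶠ x in atTop, φ x = 0) ∨ (∀ᶠ x in atTop, 0 < φ x) ∨ (∀ᶠ x in atTop, φ x < 0) := by
  rcases hK.tri h with h0 | h0
  · left; exact h0
  · right
    obtain ⟨A, hA⟩ := eventually_atTop.1 (h0.and (hK.diff h))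
    have hcont : ContinuousOn φ (Set.Ici A) := fun x hx => (hA x hx).2.continuousAt.continuousWithinAt
    by_cases hp : 0 < φ A
    · left
      filter_upwards [eventually_ge_atTop A] with x hx
      by_contra hneg
      push Not at hneg
      have := intermediate_value_Icc' hx (hcont.mono Set.Icc_subset_Ici_self) ⟨hneg, hp.le⟩
      obtain ⟨c, hc, hc0⟩ := this
      exact (hA c hc.1).1 hc0
    · right
      push Not at hp
      filter_upwards [eventually_ge_atTop A] with x hx
      by_contra hneg
      push Not at hneg
      have := intermediate_value_Icc hx (hcont.mono Set.Icc_subset_Ici_self) ⟨hp, hneg⟩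
      obtain ⟨c, hc, hc0⟩ := this
      exact (hA c hc.1).1 hc0

lemma le_or_lt {K : Set (ℝ → ℝ)} (hK : HF K) {φ ψ : ℝ → ℝ} (h : φ ∈ K) (h2 : ψ ∈ K) :
    (∀ᶠ x in atTop, φ x ≤ ψ x) ∨ (∀ᶠ x in atTop, ψ x < φ x) := by
  rcases hK.sign (hK.sub h h2) with h | h | h
  · left; filter_upwards [h] with x hx; simp at hx; linarith
  · right; filter_upwards [h] with x hx; simp at hx; linarith
  · left; filter_upwards [h] with x hx; simp at hx; linarith

lemma mono_of {φ : ℝ → ℝ} (hd : ∀ᶠ x in atTop, DifferentiableAt ℝ φ x) (h : ∀ᶠ x in atTop, 0 ≤ _root_.deriv φ x) :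
    ∃ A, ∀ B ≥ A, MonotoneOn φ (Set.Ici B) := by
  obtain ⟨A, hA⟩ := eventually_atTop.1 (hd.and h)
  refine ⟨A, fun B hB => ?_⟩
  refine monotoneOn_of_deriv_nonneg (convex_Ici B) (fun x hx => (hA x (hB.le.trans hx)).1.continuousAt.continuousWithinAt) ?_ ?_
  · intro x hx
    rw [interior_Ici] at hx
    exact (hA x (hB.le.trans hx.le)).1.differentiableWithinAt
  · intro x hx
    rw [interior_Ici] at hx
    exact (hA x (hB.le.trans hx.le)).2

lemma anti_of {φ : ℝ → ℝ} (hd : ∀ᶠ x in atTop, DifferentiableAt ℝ φ x) (h : ∀ᶠ x in atTop, _root_.deriv φ x ≤ 0) :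
    ∃ A, ∀ B ≥ A, AntitoneOn φ (Set.Ici B) := by
  obtain ⟨A, hA⟩ := eventually_atTop.1 (hd.and h)
  refine ⟨A, fun B hB => ?_⟩
  refine antitoneOn_of_deriv_nonpos (convex_Ici B) (fun x hx => (hA x (hB.le.trans hx)).1.continuousAt.continuousWithinAt) ?_ ?_
  · intro x hx
    rw [interior_Ici] at hx
    exact (hA x (hB.le.trans hx.le)).1.differentiableWithinAt
  · intro x hx
    rw [interior_Ici] at hx
    exact (hA x (hB.le.trans hx.le)).2

lemma deriv_pos_of_top {K : Set (ℝ → ℝ)} (hK : HF K) {φ : ℝ → ℝ} (h : φ ∈ K) (ht : Tendsto φ atTop atTop) :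
    ∀ᶠ x in atTop, 0 < _root_.deriv φ x := by
  rcases hK.le_or_lt (hK.deriv h) hK.zero with h1 | h1
  swap
  · exact h1
  · exfalso
    obtain ⟨A, hA⟩ := anti_of (hK.diff h) h1
    obtain ⟨x, hx1, hx2⟩ := ((ht.eventually_gt_atTop (φ A)).and (eventually_ge_atTop A)).exists
    have := hA A le_rfl (Set.mem_Ici.2 le_rfl) (Set.mem_Ici.2 hx2) hx2
    linarith

lemma lt_zero_of_mono {φ : ℝ → ℝ} (hd : ∀ᶠ x in atTop, DifferentiableAt ℝ φ x)
    (h : ∀ᶠ x in atTop, 0 ≤ _root_.deriv φ x) (ht : Tendsto φ atTop (𝓝 0)) : ∀ᶠ x in atTop, φ x ≤ 0 := by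
  obtain ⟨A, hA⟩ := mono_of hd h
  filter_upwards [eventually_ge_atTop A] with x hx
  refine ge_of_tendsto ht ?_
  filter_upwards [eventually_ge_atTop x] with y hy
  exact hA A le_rfl (Set.mem_Ici.2 hx) (Set.mem_Ici.2 (hx.trans hy)) hy

lemma deriv_neg_of_zero {K : Set (ℝ → ℝ)} (hK : HF K) {φ : ℝ → ℝ} (h : φ ∈ K) (hp : ∀ᶠ x in atTop, 0 < φ x)
    (ht : Tendsto φ atTop (𝓝 0)) : ∀ᶠ x in atTop, _root_.deriv φ x < 0 := by
  rcases hK.le_or_lt hK.zero (hK.deriv h) with h1 | h1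
  · exfalso
    obtain ⟨x, hx1, hx2⟩ := (hp.and (lt_zero_of_mono (hK.diff h) h1 ht)).exists
    linarith
  · exact h1

end HF

lemma tendsto_deriv_zero {K : Set (ℝ → ℝ)} (hK : HF K) (hid : (fun x => x) ∈ K) {f : ℝ → ℝ} (hf : f ∈ K)
    (hpos : ∀ᶠ x in atTop, 0 < deriv f x) (h0 : Tendsto (fun x => f x / x) atTop (𝓝 0)) :
    Tendsto (deriv f) atTop (𝓝 0) := by
  have key : ∀ n : ℕ, 0 < n → ∀ᶠ x in atTop, deriv f x < (n:ℝ)⁻¹ := by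
    intro n hn
    have hn' : (0:ℝ) < n := by exact_mod_cast hn
    have hc : (fun _ => (n:ℝ)⁻¹) ∈ K := hK.inv (hK.nat n)
    rcases hK.le_or_lt hc (hK.deriv hf) with h1 | h1
    swap
    · exact h1
    exfalso
    obtain ⟨A, hA⟩ := HF.mono_of (φ := fun x => f x - (n:ℝ)⁻¹ * x) (by
      filter_upwards [hK.diff hf] with x hx
      fun_prop) (by
      filter_upwards [hK.diff hf, h1] with x hx h2
      have := (hx.hasDerivAt.sub ((hasDerivAt_id x).const_mul (n:ℝ)⁻¹)).deriv
      simp only [id, mul_one] at this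
      have e1 : deriv (fun x => f x - (n:ℝ)⁻¹ * x) x = deriv f x - (n:ℝ)⁻¹ := this
      rw [e1]; linarith)
    have hm := hA A le_rfl
    -- f x ≥ c + x/n
    have h3 : Tendsto (fun x : ℝ => (f A - (n:ℝ)⁻¹ * A) / x + (n:ℝ)⁻¹) atTop (𝓝 (0 + (n:ℝ)⁻¹)) :=
      (tendsto_const_nhds.div_atTop tendsto_id).add tendsto_const_nhds
    have h4 : (0 + (n:ℝ)⁻¹) ≤ 0 := by
      refine le_of_tendsto_of_tendsto h3 h0 ?_
      filter_upwards [eventually_ge_atTop A, eventually_gt_atTop 0] with x hx hx0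
      have := hm (Set.mem_Ici.2 le_rfl) (Set.mem_Ici.2 hx) hx
      simp only at this
      rw [le_div_iff₀ hx0, add_mul, div_mul_cancel₀ _ hx0.ne']
      linarith
    have : 0 < (n:ℝ)⁻¹ := by positivity
    linarith
  rw [Metric.tendsto_atTop']
  intro ε hε
  obtain ⟨n, hn⟩ := exists_nat_one_div_lt hε
  obtain ⟨A, hA⟩ := eventually_atTop.1 (hpos.and (key (n + 1) (by omega)))
  refine ⟨A, fun x hx => ?_⟩
  have := hA x hx.le
  rw [Real.dist_eq, sub_zero, abs_of_pos this.1]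
  refine this.2.trans ?_
  push_cast
  rw [one_div] at hn; exact hn

end UDP

namespace UDP
open ArithmeticFunction (vonMangoldt moebius)

/-- dyadic sum -/
def SS (f : ℝ → ℝ) (X : ℕ) : ℂ := ∑ n ∈ Finset.Ioc X (2 * X), ((vonMangoldt n : ℝ) : ℂ) * e (f n)

lemma ev_win {p : ℝ → Prop} (h : ∀ᶠ x in atTop, p x) :
    ∀ᶠ X : ℕ in atTop, ∀ x ∈ Set.Icc ((X:ℝ) / 2) (2 * X), p x := by
  obtain ⟨A, hA⟩ := eventually_atTop.1 h
  filter_upwards [tendsto_natCast_atTop_atTop.eventually_ge_atTop (2 * A)] with X hX x hx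
  exact hA x (by linarith [hx.1])

lemma anti_win {φ : ℝ → ℝ} (h : ∃ A, ∀ B ≥ A, AntitoneOn φ (Set.Ici B)) :
    ∀ᶠ X : ℕ in atTop, AntitoneOn φ (Set.Icc ((X:ℝ) / 2) (2 * X)) := by
  obtain ⟨A, hA⟩ := h
  filter_upwards [tendsto_natCast_atTop_atTop.eventually_ge_atTop (2 * A)] with X hX
  exact (hA A le_rfl).mono (fun x hx => Set.mem_Ici.2 (by linarith [hx.1]))

lemma mono_win {φ : ℝ → ℝ} (h : ∃ A, ∀ B ≥ A, MonotoneOn φ (Set.Ici B)) :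
    ∀ᶠ X : ℕ in atTop, MonotoneOn φ (Set.Icc ((X:ℝ) / 2) (2 * X)) := by
  obtain ⟨A, hA⟩ := h
  filter_upwards [tendsto_natCast_atTop_atTop.eventually_ge_atTop (2 * A)] with X hX
  exact (hA A le_rfl).mono (fun x hx => Set.mem_Ici.2 (by linarith [hx.1]))

lemma tendsto_logN : Tendsto (fun X : ℕ => Real.log X) atTop atTop :=
  Real.tendsto_log_atTop.comp tendsto_natCast_atTop_atTop

lemma caseA {f f1 : ℝ → ℝ} (hf : ∀ᶠ x in atTop, HasDerivAt f (f1 x) x)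
    (hanti : ∃ A, ∀ B ≥ A, AntitoneOn f1 (Set.Ici B)) (hpos : ∀ᶠ x in atTop, 0 < f1 x)
    (h0 : Tendsto f1 atTop (𝓝 0)) (ht : Tendsto (fun x => x * f1 x) atTop atTop)
    (A : ℕ) (hA : ∀ᶠ x in atTop, x * f1 x ≤ Real.log x ^ A) :
    Tendsto (fun X : ℕ => ‖SS f X‖ / X) atTop (𝓝 0) := by
  obtain ⟨C, hC0, hC⟩ := regimeA (A + 1) (by omega)
  have hbound : ∀ᶠ X : ℕ in atTop, ‖SS f X‖ / X ≤ 8 / ((2 * X : ℝ) * f1 (2 * X)) + 8 * C / Real.log X := by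
    have h12 : ∀ᶠ x in atTop, f1 x ≤ 1 / 2 := by
      filter_upwards [h0.eventually_lt_const (show (0:ℝ) < 1 / 2 by norm_num)] with x hx using hx.le
    filter_upwards [ev_win (hf.and (hpos.and (hA.and h12))), anti_win hanti, eventually_ge_atTop 4,
      tendsto_logN.eventually_ge_atTop 1] with X hX hX2 hX4 hl
    have hX4' : (4:ℝ) ≤ X := by exact_mod_cast hX4
    have sub : Set.Icc (X:ℝ) (2 * X) ⊆ Set.Icc ((X:ℝ) / 2) (2 * X) := Set.Icc_subset_Icc_left (by linarith)
    have m1 : (X:ℝ) ∈ Set.Icc (X:ℝ) (2 * X) := ⟨le_rfl, by linarith⟩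
    have m2 : (2 * X:ℝ) ∈ Set.Icc (X:ℝ) (2 * X) := ⟨by linarith, le_rfl⟩
    have hp2 := (hX _ (sub m2)).2.1
    have := hC f f1 X (f1 (2 * X)) (f1 X) hX4 hp2 (hX _ (sub m1)).2.2.2
      (fun x hx => (hX x (sub hx)).1) (hX2.mono sub)
      (fun x hx => ⟨hX2 (sub hx) (sub m2) hx.2, hX2 (sub m1) (sub hx) hx.1⟩)
    have hXA := (hX _ (sub m1)).2.2.1
    rw [div_le_iff₀ (by linarith)]
    refine this.trans ?_
    have e1 : (8 / ((2 * X : ℝ) * f1 (2 * X)) + 8 * C / Real.log X) * X = 4 / f1 (2 * X) + 8 * C / Real.log X * X := by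
      field_simp; ring
    rw [e1]
    have hLA : 1 ≤ Real.log X ^ A := one_le_pow₀ hl
    have h3 : 1 + 7 * X * f1 X ≤ 8 * Real.log X ^ A := by nlinarith
    have h4 : C * X / Real.log X ^ (A + 1) * (1 + 7 * X * f1 X) ≤ C * X / Real.log X ^ (A + 1) * (8 * Real.log X ^ A) :=
      mul_le_mul_of_nonneg_left h3 (by positivity)
    have h5 : C * X / Real.log X ^ (A + 1) * (8 * Real.log X ^ A) = 8 * C / Real.log X * X := by
      rw [pow_succ]; field_simp
    linarith
  refine squeeze_zero' (Eventually.of_forall fun X => by positivity) hbound ?_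
  have a1 : Tendsto (fun X : ℕ => (2 * X : ℝ)) atTop atTop :=
    (tendsto_natCast_atTop_atTop (R := ℝ)).const_mul_atTop (by norm_num)
  have a2 := (tendsto_const_nhds (x := (8:ℝ))).div_atTop (ht.comp a1)
  have a3 := (tendsto_const_nhds (x := 8 * C)).div_atTop tendsto_logN
  simpa using a2.add a3

lemma pow_aux (n : ℕ) (Lg l : ℝ) (hl : Lg - 3 ≤ l) (hL : 3000 ≤ Lg) (hn : n ≤ 100) : Lg ^ n / 2 ≤ l ^ n := by
  have h1 : (Lg - 3) ^ n ≤ l ^ n := pow_le_pow_left₀ (by linarith) hl n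
  refine le_trans ?_ h1
  have h2 : 1 + (n:ℝ) * (-3 / Lg) ≤ (1 + (-3 / Lg)) ^ n := by
    refine one_add_mul_le_pow ?_ n
    rw [le_div_iff₀ (by linarith)]; linarith
  have e1 : Lg - 3 = Lg * (1 + (-3 / Lg)) := by field_simp; ring
  rw [e1, mul_pow]
  have hn' : (n:ℝ) ≤ 100 := by exact_mod_cast hn
  have h3 : 1 / 2 ≤ 1 + (n:ℝ) * (-3 / Lg) := by
    have : (n:ℝ) * (3 / Lg) ≤ 1 / 2 := by
      rw [← mul_div_assoc, div_le_iff₀ (by linarith)]; linarith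
    have e2 : (-3 / Lg) = -(3 / Lg) := by ring
    rw [e2]; linarith
  have hp : 0 ≤ Lg ^ n := by positivity
  nlinarith [mul_le_mul_of_nonneg_left (h3.trans h2) hp]

lemma Lg_facts : ∀ᶠ X : ℕ in atTop, 3000 ≤ 1 + Real.log (2 * X) ∧ (1 + Real.log (2 * X)) ^ 400 ≤ (X:ℝ) ∧
    4 * (1 + Real.log (2 * X)) ^ 26 ≤ (X:ℝ) ∧ 1 + Real.log (2 * X) - 3 ≤ Real.log ((X:ℝ) / 2) ∧ (4:ℝ) ≤ X := by
  have a1 : Tendsto (fun X : ℕ => (2 * X : ℝ)) atTop atTop :=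
    (tendsto_natCast_atTop_atTop (R := ℝ)).const_mul_atTop (by norm_num)
  have hlo := (Real.isLittleO_pow_log_id_atTop (n := 400)).comp_tendsto a1
  have hlo' := hlo.bound (show (0:ℝ) < 1 / (8 * 2 ^ 400) by positivity)
  have hL := (Real.tendsto_log_atTop.comp a1).eventually_ge_atTop 3000
  filter_upwards [hlo', hL, eventually_ge_atTop 4] with X h1 h2 h3
  have h3' : (4:ℝ) ≤ X := by exact_mod_cast h3
  simp only [Function.comp, id] at h1 h2
  have h4 : (1 + Real.log (2 * X)) ^ 400 ≤ (X:ℝ) / 4 := by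
    rw [Real.norm_of_nonneg (pow_nonneg (by linarith) _), Real.norm_of_nonneg (by linarith)] at h1
    have : (1 + Real.log (2 * X)) ^ 400 ≤ (2 * Real.log (2 * X)) ^ 400 :=
      pow_le_pow_left₀ (by linarith) (by linarith) _
    rw [mul_pow] at this
    have h6 : (2:ℝ) ^ 400 * Real.log (2 * X) ^ 400 ≤ 2 ^ 400 * (1 / (8 * 2 ^ 400) * (2 * X)) :=
      mul_le_mul_of_nonneg_left h1 (by positivity)
    have h7 : (2:ℝ) ^ 400 * (1 / (8 * 2 ^ 400) * (2 * X)) = X / 4 := by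
      have : (2:ℝ) ^ 400 ≠ 0 := by positivity
      generalize (2:ℝ) ^ 400 = c at *
      field_simp; ring
    exact this.trans (h6.trans h7.le)
  have h8 : (1 + Real.log (2 * X)) ^ 26 ≤ (1 + Real.log (2 * X)) ^ 400 :=
      pow_le_pow_right₀ (by linarith) (by norm_num)
  clear h1 hlo hlo'
  refine ⟨by linarith, h4.trans (by linarith), ?_, ?_, h3'⟩
  · have h9 := h8.trans h4
    clear h8 h4
    generalize (1 + Real.log (2 * X)) ^ 26 = P at *
    linarith
  · clear h8 h4
    have e1 : (2 * X : ℝ) = 4 * (X / 2) := by ring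
    rw [e1, Real.log_mul (by norm_num) (by linarith)]
    have : Real.log 4 ≤ 2 := by
      have e4 : (4:ℝ) = 2 ^ 2 := by norm_num
      rw [e4, Real.log_pow]
      have := Real.log_two_lt_d9
      push_cast; linarith
    linarith

lemma caseB_fin {f : ℝ → ℝ} (h : ∀ᶠ X : ℕ in atTop, ‖SS f X‖ ≤ 21 * X / (1 + Real.log (2 * X))) :
    Tendsto (fun X : ℕ => ‖SS f X‖ / X) atTop (𝓝 0) := by
  have a1 : Tendsto (fun X : ℕ => (2 * X : ℝ)) atTop atTop :=
    (tendsto_natCast_atTop_atTop (R := ℝ)).const_mul_atTop (by norm_num)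
  have a3 := (tendsto_const_nhds (x := (21:ℝ))).div_atTop
    (tendsto_atTop_add_const_left _ 1 (Real.tendsto_log_atTop.comp a1))
  refine squeeze_zero' (Eventually.of_forall fun X => by positivity) ?_ a3
  filter_upwards [h, eventually_gt_atTop 0] with X hX h0
  have h0' : (0:ℝ) < X := by exact_mod_cast h0
  rw [div_le_iff₀ h0']
  refine hX.trans (le_of_eq ?_)
  simp only [Function.comp]; ring

lemma caseB1 {f f1 f2 : ℝ → ℝ} (hf : ∀ᶠ x in atTop, HasDerivAt f (f1 x) x)
    (hf1 : ∀ᶠ x in atTop, HasDerivAt f1 (f2 x) x)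
    (hanti : ∃ A, ∀ B ≥ A, AntitoneOn f1 (Set.Ici B)) (hpos : ∀ᶠ x in atTop, 0 < f1 x)
    (ht : ∃ A, ∀ B ≥ A, MonotoneOn (fun x => x * f1 x) (Set.Ici B))
    (ht1 : ∀ᶠ x in atTop, f1 x / Real.log x ≤ f1 x + x * f2 x) (hf2 : ∀ᶠ x in atTop, f2 x ≤ 0)
    (hq : ∃ A, ∀ B ≥ A, AntitoneOn (fun x => x ^ 2 * f2 x) (Set.Ici B))
    (hA : ∀ᶠ x in atTop, Real.log x ^ 13 ≤ x * f1 x)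
    (hB : ∀ᶠ x in atTop, f1 x ≤ (Real.log x ^ 27)⁻¹) :
    Tendsto (fun X : ℕ => ‖SS f X‖ / X) atTop (𝓝 0) := by
  refine caseB_fin ?_
  filter_upwards [ev_win (hf.and (hf1.and (hpos.and (ht1.and (hf2.and (hA.and hB)))))), anti_win hanti, mono_win ht,
    anti_win hq, Lg_facts] with X hw w1 w2 w3 ⟨l1, l2, l3, l4, l5⟩
  obtain ⟨Lg, hLg⟩ : ∃ Lg, Lg = 1 + Real.log (2 * X) := ⟨_, rfl⟩
  rw [← hLg] at l1 l2 l3 l4 ⊢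
  have m1 : (X:ℝ) / 2 ∈ Set.Icc ((X:ℝ) / 2) (2 * X) := ⟨le_rfl, by linarith⟩
  have m2 : (2 * X:ℝ) ∈ Set.Icc ((X:ℝ) / 2) (2 * X) := ⟨by linarith, le_rfl⟩
  obtain ⟨-, -, p0, -, -, p1, p2⟩ := hw _ m1
  have hll : 0 < Real.log ((X:ℝ) / 2) := by linarith
  have hlow : ∀ x ∈ Set.Icc ((X:ℝ) / 2) (2 * X), f1 (X / 2) / 4 ≤ f1 x := by
    intro x hx
    have h1 := w1 hx m2 hx.2
    have h2 := w2 m1 m2 (by linarith)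
    simp only at h2
    nlinarith
  refine regimeB1 f f1 f2 X (f1 (X / 2)) Lg hLg (by linarith) l3 p0 ?_ ?_ (fun x hx => (hw x hx).1)
    (fun x hx => (hw x hx).2.1) w1 ?_ ?_ w3
  · refine p2.trans ?_
    rw [one_div]
    refine inv_anti₀ (by positivity) ?_
    have := pow_aux 27 Lg _ l4 l1 (by norm_num)
    refine le_trans ?_ this
    rw [pow_succ]
    nlinarith [show 0 < Lg ^ 26 by positivity]
  · have := pow_aux 13 Lg _ l4 l1 (by norm_num)
    have h2 : Lg ^ 13 = Lg ^ 12 * Lg := pow_succ _ _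
    rw [h2] at this
    nlinarith [show 0 < Lg ^ 12 by positivity]
  · intro x hx
    exact ⟨hlow x hx, w1 m1 hx hx.1⟩
  · intro x hx
    obtain ⟨-, -, q0, q1, q2, -, -⟩ := hw x hx
    have hx0 : 0 < x := by linarith [hx.1]
    constructor
    · refine le_trans ?_ q1
      have h3 : Real.log x ≤ Lg := by
        have : Real.log x ≤ Real.log (2 * X) := Real.log_le_log hx0 hx.2
        linarith
      have h4 : 0 < Real.log x := hll.trans_le (Real.log_le_log (by linarith) hx.1)
      have e1 : f1 (X / 2) / (4 * Lg) = (f1 (X / 2) / 4) / Lg := by field_simp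
      rw [e1]
      exact div_le_div₀ q0.le (hlow x hx) h4 h3
    · have h1 := w1 m1 hx hx.1
      have h2 : x * f2 x ≤ 0 := mul_nonpos_of_nonneg_of_nonpos hx0.le q2
      linarith

lemma caseB2 {f f1 f2 q1 : ℝ → ℝ} (hf : ∀ᶠ x in atTop, HasDerivAt f (f1 x) x)
    (hf1 : ∀ᶠ x in atTop, HasDerivAt f1 (f2 x) x)
    (hq : ∀ᶠ x in atTop, HasDerivAt (fun x => x ^ 2 * f2 x) (q1 x) x)
    (hanti : ∃ A, ∀ B ≥ A, AntitoneOn (fun x => -(x * f2 x)) (Set.Ici B)) (hpos : ∀ᶠ x in atTop, 0 < -(x * f2 x))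
    (ht : ∃ A, ∀ B ≥ A, MonotoneOn (fun x => (-(x * f2 x)) ^ 2 * x) (Set.Ici B))
    (hq1 : ∀ᶠ x in atTop, -(x * f2 x) / 2 ≤ - q1 x ∧ - q1 x ≤ -(x * f2 x))
    (hA : ∀ᶠ x in atTop, (Real.log x ^ 29)⁻¹ ≤ -(x * f2 x)) (hB : ∀ᶠ x in atTop, -(x * f2 x) ≤ 1) :
    Tendsto (fun X : ℕ => ‖SS f X‖ / X) atTop (𝓝 0) := by
  refine caseB_fin ?_
  obtain ⟨ρ, hρ⟩ : ∃ ρ : ℝ → ℝ, ρ = fun x => -(x * f2 x) := ⟨_, rfl⟩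
  have hρx : ∀ x, -(x * f2 x) = ρ x := fun x => by rw [hρ]
  simp only [hρx] at hanti hpos ht hq1 hA hB
  filter_upwards [ev_win (hf.and (hf1.and (hq.and (hpos.and (hq1.and (hA.and hB)))))), anti_win hanti, mono_win ht,
    Lg_facts] with X hw w1 w2 ⟨l1, l2, l3, l4, l5⟩
  obtain ⟨Lg, hLg⟩ : ∃ Lg, Lg = 1 + Real.log (2 * X) := ⟨_, rfl⟩
  rw [← hLg] at l1 l2 l3 l4 ⊢
  have m1 : (X:ℝ) / 2 ∈ Set.Icc ((X:ℝ) / 2) (2 * X) := ⟨le_rfl, by linarith⟩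
  have m2 : (2 * X:ℝ) ∈ Set.Icc ((X:ℝ) / 2) (2 * X) := ⟨by linarith, le_rfl⟩
  obtain ⟨-, -, -, p0, -, p1, p2⟩ := hw _ m1
  have hll : 0 < Real.log ((X:ℝ) / 2) := by linarith
  have hlow : ∀ x ∈ Set.Icc ((X:ℝ) / 2) (2 * X), ρ (X / 2) / 2 ≤ ρ x := by
    intro x hx
    have h1 := w1 hx m2 hx.2
    have h2 := w2 m1 m2 (by linarith)
    have h3 := (hw _ m2).2.2.2.1
    simp only at h1 h2
    have h4 : ρ (X / 2) ^ 2 ≤ (2 * ρ (2 * X)) ^ 2 := by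
      have : 0 < (X:ℝ) := by linarith
      nlinarith
    have := (pow_le_pow_iff_left₀ p0.le (by linarith) (two_ne_zero)).1 h4
    linarith
  refine regimeB2 f f1 f2 q1 X (ρ (X / 2)) Lg hLg (by linarith) l2 p2 ?_ (fun x hx => (hw x hx).1)
    (fun x hx => (hw x hx).2.1) ?_ (fun x hx => (hw x hx).2.2.1) ?_
  · refine le_trans ?_ p1
    rw [one_div]
    refine inv_anti₀ (by positivity) ?_
    have h3 : Real.log (X / 2) ≤ Lg := by
      have : Real.log (X / 2) ≤ Real.log (2 * X) := Real.log_le_log (by linarith) (by linarith)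
      linarith
    calc Real.log (X / 2) ^ 29 ≤ Lg ^ 29 := pow_le_pow_left₀ hll.le h3 _
      _ ≤ Lg ^ 30 := pow_le_pow_right₀ (by linarith) (by norm_num)
  · intro x hx
    rw [hρx]
    exact ⟨hlow x hx, w1 m1 hx hx.1⟩
  · intro x hx
    have h1 := (hw x hx).2.2.2.2.1
    have h2 := hlow x hx
    have h3 := w1 m1 hx hx.1
    constructor <;> linarith [h1.1, h1.2]

end UDP

namespace UDP
open ArithmeticFunction (vonMangoldt moebius)

lemma log_pow_inv_hasDeriv (n : ℕ) (x : ℝ) (hx : 1 < x) :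
    HasDerivAt (fun x => (Real.log x ^ n)⁻¹) (-(n / (x * Real.log x ^ (n + 1)))) x := by
  have hl : 0 < Real.log x := Real.log_pos hx
  have h := ((Real.hasDerivAt_log (by linarith : x ≠ 0)).pow n).inv (pow_ne_zero n hl.ne')
  refine h.congr_deriv ?_
  have hx0 : x ≠ 0 := by linarith
  rcases n with _ | n
  · simp
  · simp only [Nat.add_sub_cancel, Pi.pow_apply]
    field_simp
    ring

set_option maxHeartbeats 1000000 in
theorem window_sum {K : Set (ℝ → ℝ)} (hK : HF K) (hid : (fun x => x) ∈ K) (hlog : Real.log ∈ K)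
    {f : ℝ → ℝ} (hf : f ∈ K) (hpos : ∀ᶠ x in atTop, 0 < deriv f x)
    (h0 : Tendsto (fun x => f x / x) atTop (𝓝 0)) (ht : Tendsto (fun x => x * deriv f x) atTop atTop) :
    Tendsto (fun X : ℕ => ‖SS f X‖ / X) atTop (𝓝 0) := by
  obtain ⟨f1, hf1⟩ : ∃ f1, f1 = deriv f := ⟨_, rfl⟩
  obtain ⟨f2, hf2⟩ : ∃ f2, f2 = deriv f1 := ⟨_, rfl⟩
  obtain ⟨f3, hf3⟩ : ∃ f3, f3 = deriv f2 := ⟨_, rfl⟩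
  have k1 : f1 ∈ K := hf1 ▸ hK.deriv hf
  have k2 : f2 ∈ K := hf2 ▸ hK.deriv k1
  have k3 : f3 ∈ K := hf3 ▸ hK.deriv k2
  have d0 : ∀ᶠ x in atTop, HasDerivAt f (f1 x) x := by
    filter_upwards [hK.diff hf] with x hx; rw [hf1]; exact hx.hasDerivAt
  have d1 : ∀ᶠ x in atTop, HasDerivAt f1 (f2 x) x := by
    filter_upwards [hK.diff k1] with x hx; rw [hf2]; exact hx.hasDerivAt
  have d2 : ∀ᶠ x in atTop, HasDerivAt f2 (f3 x) x := by
    filter_upwards [hK.diff k2] with x hx; rw [hf3]; exact hx.hasDerivAt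
  have z1 : Tendsto f1 atTop (𝓝 0) := hf1 ▸ tendsto_deriv_zero hK hid hf hpos h0
  rw [← hf1] at hpos ht
  have n2 : ∀ᶠ x in atTop, f2 x < 0 := by rw [hf2]; exact hK.deriv_neg_of_zero k1 hpos z1
  have anti1 : ∃ A, ∀ B ≥ A, AntitoneOn f1 (Set.Ici B) := by
    refine HF.anti_of (hK.diff k1) ?_
    filter_upwards [n2] with x hx; rw [← hf2]; exact hx.le
  -- t = x f1
  have kt : (fun x => x * f1 x) ∈ K := hK.mul hid k1
  have dt : ∀ᶠ x in atTop, HasDerivAt (fun x => x * f1 x) (f1 x + x * f2 x) x := by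
    filter_upwards [d1] with x hx
    refine ((hasDerivAt_id x).mul hx).congr_deriv ?_
    simp
  have t1pos : ∀ᶠ x in atTop, 0 < f1 x + x * f2 x := by
    filter_upwards [hK.deriv_pos_of_top kt ht, dt] with x hx h2
    rw [h2.deriv] at hx; exact hx
  by_cases hA : ∃ A : ℕ, ∀ᶠ x in atTop, x * f1 x ≤ Real.log x ^ A
  · obtain ⟨A, hA⟩ := hA
    exact caseA d0 anti1 hpos z1 ht A hA
  have hB : ∀ A : ℕ, ∀ᶠ x in atTop, Real.log x ^ A < x * f1 x := by
    intro A
    rcases hK.le_or_lt kt (hK.pow hlog A) with h | h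
    · exact absurd ⟨A, h⟩ hA
    · exact h
  clear hA
  have lpos : ∀ᶠ x in atTop, 1 < Real.log x := Real.tendsto_log_atTop.eventually_gt_atTop 1
  have xpos : ∀ᶠ x : ℝ in atTop, 1 < x := eventually_gt_atTop 1
  have monot : ∃ A, ∀ B ≥ A, MonotoneOn (fun x => x * f1 x) (Set.Ici B) := by
    refine HF.mono_of (hK.diff kt) ?_
    filter_upwards [dt, t1pos] with x h1 h2
    rw [h1.deriv]; exact h2.le
  have ht1 : ∀ᶠ x in atTop, f1 x / Real.log x ≤ f1 x + x * f2 x := by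
    have kq : (fun x => x * f1 x / Real.log x) ∈ K := hK.mul kt (hK.inv hlog)
    have htop : Tendsto (fun x => x * f1 x / Real.log x) atTop atTop := by
      refine tendsto_atTop_mono' _ ?_ Real.tendsto_log_atTop
      filter_upwards [hB 2, lpos] with x h1 h2
      rw [le_div_iff₀ (by linarith)]; nlinarith
    filter_upwards [hK.deriv_pos_of_top kq htop, dt, lpos, xpos] with x h1 h2 h3 h4
    have hx0 : x ≠ 0 := by linarith
    have e1 := (h2.div (Real.hasDerivAt_log hx0) (by linarith)).deriv
    have e2 : deriv (fun x => x * f1 x / Real.log x) x =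
      ((f1 x + x * f2 x) * Real.log x - x * f1 x * x⁻¹) / Real.log x ^ 2 := e1
    rw [e2] at h1
    have h5 := (div_pos_iff_of_pos_right (by positivity)).1 h1
    have e3 : x * f1 x * x⁻¹ = f1 x := by field_simp
    rw [e3] at h5
    rw [div_le_iff₀ (by linarith)]; linarith
  have kt1 : (fun x => f1 x + x * f2 x) ∈ K := hK.add k1 (hK.mul hid k2)
  have dt1 : ∀ᶠ x in atTop, HasDerivAt (fun x => f1 x + x * f2 x) (2 * f2 x + x * f3 x) x := by
    filter_upwards [d1, d2] with x h1 h2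
    refine (h1.add ((hasDerivAt_id x).mul h2)).congr_deriv ?_
    simp; ring
  have t2neg : ∀ᶠ x in atTop, 2 * f2 x + x * f3 x < 0 := by
    have hz : Tendsto (fun x => f1 x + x * f2 x) atTop (𝓝 0) := by
      refine squeeze_zero' (t1pos.mono fun x hx => hx.le) ?_ z1
      filter_upwards [n2, xpos] with x h1 h2
      nlinarith
    filter_upwards [hK.deriv_neg_of_zero kt1 t1pos hz, dt1] with x h1 h2
    rw [h2.deriv] at h1; exact h1
  have dq : ∀ᶠ x in atTop, HasDerivAt (fun x => x ^ 2 * f2 x) (x * (2 * f2 x + x * f3 x)) x := by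
    filter_upwards [d2] with x h2
    refine (((hasDerivAt_id x).pow 2).mul h2).congr_deriv ?_
    simp; ring
  have hq : ∃ A, ∀ B ≥ A, AntitoneOn (fun x => x ^ 2 * f2 x) (Set.Ici B) := by
    refine HF.anti_of (dq.mono fun x hx => hx.differentiableAt) ?_
    filter_upwards [dq, t2neg, xpos] with x h1 h2 h3
    rw [h1.deriv]; nlinarith
  have kL : ∀ n : ℕ, (fun x => (Real.log x ^ n)⁻¹) ∈ K := fun n => hK.inv (hK.pow hlog n)
  rcases hK.le_or_lt k1 (kL 27) with hC | hC
  · exact caseB1 d0 d1 anti1 hpos monot ht1 (n2.mono fun x hx => hx.le) hq ((hB 13).mono fun x hx => hx.le) hC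
  -- regime B2
  have kρ : (fun x => -(x * f2 x)) ∈ K := hK.neg (hK.mul hid k2)
  have ρpos : ∀ᶠ x in atTop, 0 < -(x * f2 x) := by
    filter_upwards [n2, xpos] with x h1 h2; nlinarith
  have ρlt : ∀ᶠ x in atTop, -(x * f2 x) ≤ f1 x := by
    filter_upwards [t1pos] with x h1; linarith
  have ρz : Tendsto (fun x => -(x * f2 x)) atTop (𝓝 0) :=
    squeeze_zero' (ρpos.mono fun x hx => hx.le) ρlt z1
  have dρ : ∀ᶠ x in atTop, HasDerivAt (fun x => -(x * f2 x)) (-f2 x - x * f3 x) x := by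
    filter_upwards [d2] with x h2
    refine (((hasDerivAt_id x).mul h2).neg).congr_deriv ?_
    simp; ring
  have ρ1neg : ∀ᶠ x in atTop, -f2 x - x * f3 x < 0 := by
    filter_upwards [hK.deriv_neg_of_zero kρ ρpos ρz, dρ] with x h1 h2
    rw [h2.deriv] at h1; exact h1
  have antiρ : ∃ A, ∀ B ≥ A, AntitoneOn (fun x => -(x * f2 x)) (Set.Ici B) := by
    refine HF.anti_of (hK.diff kρ) ?_
    filter_upwards [dρ, ρ1neg] with x h1 h2
    rw [h1.deriv]; exact h2.le
  have ρlow : ∀ᶠ x in atTop, (Real.log x ^ 29)⁻¹ < -(x * f2 x) := by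
    rcases hK.le_or_lt kρ (kL 29) with h | h
    swap
    · exact h
    exfalso
    have dD : ∀ᶠ x in atTop, HasDerivAt (fun x => f1 x - (Real.log x ^ 28)⁻¹) (f2 x + 28 / (x * Real.log x ^ 29)) x := by
      filter_upwards [d1, xpos] with x h1 h2
      refine (h1.sub (log_pow_inv_hasDeriv 28 x h2)).congr_deriv ?_
      norm_num
    have hz : Tendsto (fun x => f1 x - (Real.log x ^ 28)⁻¹) atTop (𝓝 0) := by
      have : Tendsto (fun x => (Real.log x ^ 28)⁻¹) atTop (𝓝 0) :=
        ((tendsto_pow_atTop (by norm_num)).comp Real.tendsto_log_atTop).inv_tendsto_atTop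
      simpa using z1.sub this
    have := HF.lt_zero_of_mono (dD.mono fun x hx => hx.differentiableAt) (by
      filter_upwards [dD, h, xpos, lpos] with x h1 h2 h3 h4
      rw [h1.deriv]
      have hp : 0 < Real.log x ^ 29 := by positivity
      have e1 : 28 / (x * Real.log x ^ 29) = 28 * (Real.log x ^ 29)⁻¹ / x := by
        generalize Real.log x ^ 29 = P at *
        field_simp
      rw [e1]
      have h5 : -(x * f2 x) ≤ 28 * (Real.log x ^ 29)⁻¹ := h2.trans (by linarith [inv_pos.2 hp])
      have h6 : - f2 x ≤ 28 * (Real.log x ^ 29)⁻¹ / x := by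
        rw [le_div_iff₀ (by linarith)]
        have : -f2 x * x = -(x * f2 x) := by ring
        rw [this]; exact h5
      linarith) hz
    obtain ⟨x, h1, h2, h3⟩ := (this.and (hC.and lpos)).exists
    have h4 : (Real.log x ^ 28)⁻¹ ≤ (Real.log x ^ 27)⁻¹ :=
      inv_anti₀ (by positivity) (pow_le_pow_right₀ h3.le (by norm_num))
    generalize (Real.log x ^ 28)⁻¹ = P at *
    generalize (Real.log x ^ 27)⁻¹ = Q at *
    linarith
  have kρ2 : (fun x => (-(x * f2 x)) ^ 2 * x) ∈ K := hK.mul (hK.pow kρ 2) hid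
  have dρ2 : ∀ᶠ x in atTop, HasDerivAt (fun x => (-(x * f2 x)) ^ 2 * x)
      (2 * (-(x * f2 x)) * (-f2 x - x * f3 x) * x + (-(x * f2 x)) ^ 2) x := by
    filter_upwards [dρ] with x h2
    refine ((h2.pow 2).mul (hasDerivAt_id x)).congr_deriv ?_
    simp
  have ρ2top : Tendsto (fun x => (-(x * f2 x)) ^ 2 * x) atTop atTop := by
    have hlo := (Real.isLittleO_pow_log_id_atTop (n := 59)).bound (show (0:ℝ) < 1 by norm_num)
    refine tendsto_atTop_mono' _ ?_ Real.tendsto_log_atTop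
    filter_upwards [ρlow, hlo, lpos, xpos] with x h1 h2 h3 h4
    simp only [id] at h2
    rw [Real.norm_of_nonneg (by positivity), Real.norm_of_nonneg (by linarith), one_mul] at h2
    have h5 : (Real.log x ^ 29)⁻¹ ^ 2 ≤ (-(x * f2 x)) ^ 2 := pow_le_pow_left₀ (by positivity) h1.le 2
    refine le_trans ?_ (mul_le_mul_of_nonneg_right h5 (by linarith))
    rw [inv_pow, ← pow_mul, inv_mul_eq_div, le_div_iff₀ (by positivity), ← pow_succ']
    exact h2
  have key : ∀ᶠ x in atTop, 0 < 2 * (-(x * f2 x)) * (-f2 x - x * f3 x) * x + (-(x * f2 x)) ^ 2 := by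
    filter_upwards [hK.deriv_pos_of_top kρ2 ρ2top, dρ2] with x h1 h2
    rw [h2.deriv] at h1; exact h1
  refine caseB2 d0 d1 dq antiρ ρpos ?_ ?_ (ρlow.mono fun x hx => hx.le) ?_
  · refine HF.mono_of (hK.diff kρ2) ?_
    filter_upwards [dρ2, key] with x h1 h2
    rw [h1.deriv]; exact h2.le
  · filter_upwards [key, ρpos, ρ1neg, xpos] with x h1 h2 h3 h4
    obtain ⟨ρ, hρ⟩ : ∃ ρ, ρ = -(x * f2 x) := ⟨_, rfl⟩
    obtain ⟨σ, hσ⟩ : ∃ σ, σ = (-f2 x - x * f3 x) * x := ⟨_, rfl⟩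
    have e1 : -(x * (2 * f2 x + x * f3 x)) = ρ + σ := by rw [hρ, hσ]; ring
    have e2 : 2 * (-(x * f2 x)) * (-f2 x - x * f3 x) * x + (-(x * f2 x)) ^ 2 = ρ * (2 * σ + ρ) := by rw [hρ, hσ]; ring
    rw [e2] at h1
    rw [e1, ← hρ]
    rw [← hρ] at h2
    have h5 : 0 < 2 * σ + ρ := pos_of_mul_pos_right h1 h2.le
    have h6 : σ ≤ 0 := by rw [hσ]; exact mul_nonpos_of_nonpos_of_nonneg h3.le (by linarith)
    constructor <;> linarith
  · filter_upwards [ρz.eventually_lt_const (show (0:ℝ) < 1 by norm_num)] with x hx using hx.le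

end UDP

namespace UDP
open ArithmeticFunction (vonMangoldt moebius)

/-- full sum -/
def TT (f : ℝ → ℝ) (N : ℕ) : ℂ := ∑ n ∈ Finset.Ioc 0 N, ((vonMangoldt n : ℝ) : ℂ) * e (f n)

lemma TT_split (f : ℝ → ℝ) (X : ℕ) : TT f (2 * X) = TT f X + SS f X := by
  rw [TT, TT, SS, Finset.sum_Ioc_consecutive _ (Nat.zero_le _) (by omega)]

lemma TT_succ (f : ℝ → ℝ) (X : ℕ) : TT f (X + 1) = TT f X + ((vonMangoldt (X + 1) : ℝ) : ℂ) * e (f ((X + 1 : ℕ) : ℝ)) := by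
  rw [TT, TT, Finset.sum_Ioc_succ_top (Nat.zero_le _)]

lemma full_sum {f : ℝ → ℝ} (h : Tendsto (fun X : ℕ => ‖SS f X‖ / X) atTop (𝓝 0)) :
    Tendsto (fun X : ℕ => ‖TT f X‖ / X) atTop (𝓝 0) := by
  rw [Metric.tendsto_atTop]
  intro ε hε
  obtain ⟨η, hη, hη0⟩ : ∃ η, η = ε / 4 ∧ 0 < η := ⟨_, rfl, by positivity⟩
  have h1 : ∀ᶠ X : ℕ in atTop, ‖SS f X‖ ≤ η * X := by
    filter_upwards [h.eventually_lt_const hη0, eventually_gt_atTop 0] with X hX h0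
    have h0' : (0:ℝ) < X := by exact_mod_cast h0
    rw [div_lt_iff₀ h0'] at hX; exact hX.le
  have h2 : ∀ᶠ X : ℕ in atTop, Real.log X ≤ η / 2 * X := by
    have := (Real.isLittleO_log_id_atTop.comp_tendsto (tendsto_natCast_atTop_atTop (R := ℝ))).bound (half_pos hη0)
    filter_upwards [this] with X hX
    simp only [Function.comp, id] at hX
    rw [Real.norm_of_nonneg (by positivity : (0:ℝ) ≤ X)] at hX
    exact (le_abs_self _).trans hX
  obtain ⟨M, hM⟩ := eventually_atTop.1 (h1.and h2)
  obtain ⟨C, hC⟩ : ∃ C : ℝ, ∀ N ≤ 2 * M + 2, ‖TT f N‖ ≤ C := by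
    refine ⟨∑ N ∈ Finset.range (2 * M + 3), ‖TT f N‖, fun N hN => ?_⟩
    exact Finset.single_le_sum (f := fun N => ‖TT f N‖) (fun _ _ => norm_nonneg _) (Finset.mem_range.2 (by omega))
  have key : ∀ N : ℕ, ‖TT f N‖ ≤ 2 * η * N + C := by
    intro N
    induction N using Nat.strong_induction_on with
    | _ N ih =>
    rcases Nat.lt_or_ge (2 * M + 2) N with hN | hN
    swap
    · have := hC N hN
      have : 0 ≤ 2 * η * N := by positivity
      linarith [hC N hN]
    rcases Nat.even_or_odd' N with ⟨X, rfl | rfl⟩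
    · rw [TT_split]
      refine (norm_add_le _ _).trans ?_
      have a1 := ih X (by omega)
      have a2 := (hM X (by omega)).1
      push_cast
      nlinarith [show 0 ≤ η * X by positivity]
    · rw [TT_succ, TT_split]
      refine (norm_add₃_le).trans ?_
      have a1 := ih X (by omega)
      have a2 := (hM X (by omega)).1
      have a3 := (hM (2 * X + 1) (by omega)).2
      rw [norm_mul, norm_e, mul_one, Complex.norm_real, Real.norm_of_nonneg ArithmeticFunction.vonMangoldt_nonneg]
      have a4 : vonMangoldt (2 * X + 1) ≤ Real.log ((2 * X + 1 : ℕ) : ℝ) := ArithmeticFunction.vonMangoldt_le_log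
      push_cast at a3 a4 ⊢
      nlinarith [show 0 ≤ η * X by positivity]
  obtain ⟨M2, hM2⟩ := exists_nat_gt (C / η)
  refine ⟨M2 + 1, fun N hN => ?_⟩
  have hN0 : (0:ℝ) < N := by exact_mod_cast (by omega : 0 < N)
  rw [Real.dist_eq, sub_zero, abs_of_nonneg (by positivity), div_lt_iff₀ hN0]
  have h5 : C < η * N := by
    rw [div_lt_iff₀ hη0] at hM2
    have : (M2:ℝ) ≤ N := by exact_mod_cast (by omega : M2 ≤ N)
    nlinarith
  have := key N
  have e1 : ε = 4 * η := by rw [hη]; ring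
  rw [e1]
  nlinarith

end UDP

namespace UDP
open ArithmeticFunction (vonMangoldt moebius)

/-- prime sums -/
def VV (f : ℝ → ℝ) (N : ℕ) : ℂ := ∑ p ∈ (Finset.Ioc 0 N).filter Nat.Prime, e (f p)
/-- weighted prime sums -/
def UU (f : ℝ → ℝ) (N : ℕ) : ℂ := ∑ p ∈ (Finset.Ioc 0 N).filter Nat.Prime, ((Real.log p : ℝ) : ℂ) * e (f p)

lemma TT_sub_UU (f : ℝ → ℝ) (N : ℕ) : ‖TT f N - UU f N‖ ≤ Chebyshev.psi N - Chebyshev.theta N := by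
  have h1 : UU f N = ∑ p ∈ (Finset.Ioc 0 N).filter Nat.Prime, ((vonMangoldt p : ℝ) : ℂ) * e (f p) := by
    refine Finset.sum_congr rfl fun p hp => ?_
    rw [ArithmeticFunction.vonMangoldt_apply_prime (Finset.mem_filter.1 hp).2]
  have h2 : Chebyshev.theta N = ∑ p ∈ (Finset.Ioc 0 N).filter Nat.Prime, vonMangoldt p := by
    rw [Chebyshev.theta, Nat.floor_natCast]
    refine Finset.sum_congr rfl fun p hp => ?_
    rw [ArithmeticFunction.vonMangoldt_apply_prime (Finset.mem_filter.1 hp).2]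
  have h3 := Finset.sum_filter_add_sum_filter_not (Finset.Ioc 0 N) Nat.Prime
    (fun n => ((vonMangoldt n : ℝ) : ℂ) * e (f n))
  have h4 := Finset.sum_filter_add_sum_filter_not (Finset.Ioc 0 N) Nat.Prime
    (fun n => vonMangoldt n)
  rw [h1, h2, TT, Chebyshev.psi, Nat.floor_natCast, ← h3, ← h4, add_sub_cancel_left, add_sub_cancel_left]
  refine (norm_sum_le _ _).trans (Finset.sum_le_sum fun n _ => ?_)
  rw [norm_mul, norm_e, mul_one, Complex.norm_real, Real.norm_of_nonneg ArithmeticFunction.vonMangoldt_nonneg]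

lemma pi_card (N : ℕ) : (Nat.primeCounting N : ℝ) = (((Finset.Ioc 0 N).filter Nat.Prime).card : ℝ) := by
  rw [← Nat.primesLE_eq_filter_Ioc_zero]; simp

lemma VV_sub_UU (f : ℝ → ℝ) (N : ℕ) :
    ‖(Real.log N : ℂ) * VV f N - UU f N‖ ≤ Nat.primeCounting N * Real.log N - Chebyshev.theta N := by
  rw [VV, UU, Finset.mul_sum, ← Finset.sum_sub_distrib, Chebyshev.theta, Nat.floor_natCast, pi_card,
    ← nsmul_eq_mul, ← Finset.sum_const, ← Finset.sum_sub_distrib]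
  refine (norm_sum_le _ _).trans (Finset.sum_le_sum fun n hn => ?_)
  have hn1 := Finset.mem_Ioc.1 (Finset.mem_filter.1 hn).1
  rw [← sub_mul, norm_mul, norm_e, mul_one, ← Complex.ofReal_sub, Complex.norm_real, Real.norm_of_nonneg]
  have : Real.log n ≤ Real.log N := Real.log_le_log (by exact_mod_cast hn1.1) (by exact_mod_cast hn1.2)
  linarith

lemma pi_lower : ∀ᶠ N : ℕ in atTop, (N:ℝ) / (2 * Real.log N) ≤ Nat.primeCounting N := by
  have := (Real.isLittleO_log_id_atTop.comp_tendsto (tendsto_natCast_atTop_atTop (R := ℝ))).bound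
    (show (0:ℝ) < 1 / 10 by norm_num)
  filter_upwards [this, tendsto_logN.eventually_ge_atTop 1, eventually_ge_atTop 100] with N h1 h2 h3
  have h3' : (100:ℝ) ≤ N := by exact_mod_cast h3
  refine le_trans ?_ (Chebyshev.pi_ge N)
  simp only [Function.comp, id] at h1
  rw [Real.norm_of_nonneg (by positivity : (0:ℝ) ≤ N), Real.norm_of_nonneg (by linarith)] at h1
  have h4 : Real.log (N + 1) ≤ Real.log 2 + Real.log N := by
    rw [← Real.log_mul (by norm_num) (by linarith)]
    exact Real.log_le_log (by linarith) (by linarith)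
  have a1 := Real.log_two_gt_d9
  have a2 := Real.log_two_lt_d9
  have e1 : (N:ℝ) / (2 * Real.log N) = (N / 2) / Real.log N := by field_simp
  rw [e1]
  refine div_le_div_of_nonneg_right ?_ (by linarith)
  nlinarith

lemma prime_sum {f : ℝ → ℝ} (h : Tendsto (fun X : ℕ => ‖TT f X‖ / X) atTop (𝓝 0)) :
    Tendsto (fun N : ℕ => ‖VV f N‖ / Nat.primeCounting N) atTop (𝓝 0) := by
  obtain ⟨C, hC⟩ := Chebyshev.psi_sub_theta_le_mul_sqrt
  obtain ⟨D, hD⟩ := (Chebyshev.primeCounting_sub_theta_div_log_isBigO.comp_tendsto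
    (tendsto_natCast_atTop_atTop (R := ℝ))).bound
  have hbound : ∀ᶠ N : ℕ in atTop, ‖VV f N‖ / Nat.primeCounting N ≤
      2 * (‖TT f N‖ / N + C / Real.sqrt N + D / Real.log N) := by
    filter_upwards [hD, pi_lower, tendsto_logN.eventually_ge_atTop 1, eventually_gt_atTop 0] with N h1 h2 h3 h4
    have h4' : (0:ℝ) < N := by exact_mod_cast h4
    have hl : 0 < Real.log N := by linarith
    simp only [Function.comp, Nat.floor_natCast] at h1
    rw [Real.norm_eq_abs, Real.norm_of_nonneg (by positivity)] at h1
    have h5 : Nat.primeCounting N * Real.log N - Chebyshev.theta N ≤ D * (N / Real.log N) := by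
      have := (le_abs_self _).trans h1
      have e1 : (Nat.primeCounting N * Real.log N - Chebyshev.theta N : ℝ) =
        (Nat.primeCounting N - Chebyshev.theta N / Real.log N) * Real.log N := by field_simp
      have e2 : D * (N / Real.log N) = D * (N / Real.log N ^ 2) * Real.log N := by field_simp
      rw [e1, e2]
      exact mul_le_mul_of_nonneg_right this hl.le
    have a1 := TT_sub_UU f N
    have a2 := VV_sub_UU f N
    have a3 := hC N
    have a4 : Real.log N * ‖VV f N‖ ≤ ‖TT f N‖ + C * Real.sqrt N + D * (N / Real.log N) := by
      have e1 : Real.log N * ‖VV f N‖ = ‖(Real.log N : ℂ) * VV f N‖ := by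
        rw [norm_mul, Complex.norm_real, Real.norm_of_nonneg hl.le]
      rw [e1]
      have b1 := norm_sub_norm_le ((Real.log N : ℂ) * VV f N) (UU f N)
      have b2 := norm_sub_norm_le (UU f N) (TT f N)
      rw [norm_sub_rev] at b2
      linarith
    have hpi : 0 < (Nat.primeCounting N : ℝ) := lt_of_lt_of_le (by positivity) h2
    rw [div_le_iff₀ hpi]
    have hE0 : 0 ≤ ‖TT f N‖ / N + C / Real.sqrt N + D / Real.log N := by
      have hs : Real.sqrt N * Real.sqrt N = N := Real.mul_self_sqrt h4'.le
      have : 0 ≤ (‖TT f N‖ + C * Real.sqrt N + D * (N / Real.log N)) / N :=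
        div_nonneg (le_trans (by positivity) a4) h4'.le
      have e3 : (‖TT f N‖ + C * Real.sqrt N + D * (N / Real.log N)) / N = ‖TT f N‖ / N + C / Real.sqrt N + D / Real.log N := by
        have hs0 : 0 < Real.sqrt N := Real.sqrt_pos.2 h4'
        have : C * Real.sqrt N / N = C / Real.sqrt N := by
          rw [div_eq_div_iff h4'.ne' hs0.ne', mul_assoc, hs]
        rw [add_div, add_div, this]
        congr 1
        field_simp
      rw [e3] at this; exact this
    have e3 : (‖TT f N‖ + C * Real.sqrt N + D * (N / Real.log N)) = (‖TT f N‖ / N + C / Real.sqrt N + D / Real.log N) * N := by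
      have hs : Real.sqrt N * Real.sqrt N = N := Real.mul_self_sqrt h4'.le
      have hs0 : 0 < Real.sqrt N := Real.sqrt_pos.2 h4'
      have : C / Real.sqrt N * N = C * Real.sqrt N := by
        rw [div_mul_eq_mul_div, div_eq_iff hs0.ne', mul_assoc, hs]
      rw [add_mul, add_mul, this]
      field_simp
    rw [e3] at a4
    generalize ‖TT f N‖ / N + C / Real.sqrt N + D / Real.log N = E at *
    have b1 : ‖VV f N‖ ≤ 2 * E * (N / (2 * Real.log N)) := by
      have : 2 * E * (N / (2 * Real.log N)) = E * N / Real.log N := by field_simp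
      rw [this, le_div_iff₀ hl]; linarith
    exact b1.trans (mul_le_mul_of_nonneg_left h2 (by linarith))
  refine squeeze_zero' (Eventually.of_forall fun X => by positivity) hbound ?_
  have b1 := (tendsto_const_nhds (x := C)).div_atTop (Real.tendsto_sqrt_atTop.comp (tendsto_natCast_atTop_atTop (R := ℝ)))
  have b2 := (tendsto_const_nhds (x := D)).div_atTop tendsto_logN
  simpa using ((h.add b1).add b2).const_mul 2

lemma VV_nth (f : ℝ → ℝ) (n : ℕ) : VV f (Nat.nth Nat.Prime n - 1) = ∑ k ∈ Finset.range n, e (f (Nat.nth Nat.Prime k)) := by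
  have h0 : ∀ m, VV f (m - 1) = ∑ p ∈ (Finset.range m).filter Nat.Prime, e (f p) := by
    intro m
    rw [VV, ← Nat.primesLE_eq_filter_Ioc_zero]
    refine Finset.sum_congr ?_ fun _ _ => rfl
    ext p
    rw [Nat.mem_primesLE, Finset.mem_filter, Finset.mem_range]
    constructor
    · rintro ⟨h1, h2⟩; have := h2.pos; exact ⟨by omega, h2⟩
    · rintro ⟨h1, h2⟩; exact ⟨by omega, h2⟩
  rw [h0]
  induction n with
  | zero => 
    rw [Finset.range_zero, Finset.sum_empty]
    refine Finset.sum_eq_zero fun p hp => ?_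
    have hp := Finset.mem_filter.1 hp
    have := hp.2.two_le
    have h3 := Finset.mem_range.1 hp.1
    have h4 : Nat.nth Nat.Prime 0 = 2 := Nat.nth_prime_zero_eq_two
    omega
  | succ n ih =>
    rw [Nat.filter_range_nth_eq_insert_of_infinite Nat.infinite_setOfPred_prime, Finset.sum_insert (by simp), ih,
      Finset.sum_range_succ, add_comm]

lemma pi_nth (n : ℕ) : Nat.primeCounting (Nat.nth Nat.Prime n - 1) = n := by
  have h := Nat.primeCounting'_nth_eq n
  have h2 := Nat.add_two_le_nth_prime n
  rw [Nat.primeCounting, Nat.sub_add_cancel (by omega)]; exact h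

lemma prime_seq_sum {f : ℝ → ℝ} (h : Tendsto (fun N : ℕ => ‖VV f N‖ / Nat.primeCounting N) atTop (𝓝 0)) :
    Tendsto (fun n : ℕ => ‖∑ k ∈ Finset.range n, e (f (nthPrime k))‖ / n) atTop (𝓝 0) := by
  have ht : Tendsto (fun n => Nat.nth Nat.Prime n - 1) atTop atTop := by
    refine tendsto_atTop_mono (fun n => ?_) tendsto_id
    have h2 := Nat.add_two_le_nth_prime n
    simp only [id]; omega
  refine (h.comp ht).congr fun n => ?_
  simp only [Function.comp]
  rw [VV_nth, pi_nth]; rfl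

end UDP

namespace UDP

lemma harmonic_sum {K : Set (ℝ → ℝ)} (hK : HF K) (hid : (fun x => x) ∈ K) (hlog : Real.log ∈ K)
    {f : ℝ → ℝ} (hf : f ∈ K) (h0 : Tendsto (fun x => f x / x) atTop (𝓝 0))
    (ht : Tendsto (fun x => x * |deriv f x|) atTop atTop) (h : ℤ) (hh : h ≠ 0) :
    Tendsto (fun n : ℕ => ‖∑ k ∈ Finset.range n, e (h * f (nthPrime k))‖ / n) atTop (𝓝 0) := by
  have key : ∀ c : ℤ, c ≠ 0 → (∀ᶠ x in atTop, 0 < deriv (fun x => (c:ℝ) * f x) x) →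
      Tendsto (fun n : ℕ => ‖∑ k ∈ Finset.range n, e (c * f (nthPrime k))‖ / n) atTop (𝓝 0) := by
    intro c hc hpos
    have hgK : (fun x => (c:ℝ) * f x) ∈ K := hK.mul (hK.int c) hf
    refine prime_seq_sum (f := fun x => (c:ℝ) * f x) (prime_sum (full_sum (window_sum hK hid hlog hgK hpos ?_ ?_)))
    · have := h0.const_mul (c:ℝ)
      simp only [mul_zero] at this
      refine this.congr fun x => ?_
      ring
    · refine tendsto_atTop_mono' _ ?_ ht
      filter_upwards [hpos, hK.diff hf, eventually_gt_atTop 0] with x hx hd hx0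
      have e1 : deriv (fun x => (c:ℝ) * f x) x = c * deriv f x := deriv_const_mul _ hd
      have hc1 : (1:ℝ) ≤ |(c:ℝ)| := by exact_mod_cast Int.one_le_abs hc
      have e2 : deriv (fun x => (c:ℝ) * f x) x = |(c:ℝ)| * |deriv f x| := by
        rw [← abs_mul, ← e1, abs_of_pos hx]
      rw [e2]
      refine mul_le_mul_of_nonneg_left ?_ hx0.le
      nlinarith [abs_nonneg (deriv f x)]
  have hgK : (fun x => (h:ℝ) * f x) ∈ K := hK.mul (hK.int h) hf
  rcases hK.sign (hK.deriv hgK) with h1 | h1 | h1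
  · exfalso
    have h2 := ht.eventually_gt_atTop 0
    obtain ⟨x, hx1, hx2, hx3⟩ := (h1.and (h2.and (hK.diff hf))).exists
    have e1 : deriv (fun x => (h:ℝ) * f x) x = h * deriv f x := deriv_const_mul _ hx3
    rw [e1] at hx1
    rcases mul_eq_zero.1 hx1 with h3 | h3
    · exact hh (by exact_mod_cast h3)
    · rw [h3] at hx2; simp at hx2
  · exact key h hh h1
  · have := key (-h) (neg_ne_zero.2 hh) (by
      filter_upwards [h1, hK.diff hf] with x hx hd
      have e1 : deriv (fun x => (h:ℝ) * f x) x = h * deriv f x := deriv_const_mul _ hd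
      have e2 : deriv (fun x => ((-h : ℤ):ℝ) * f x) x = ((-h : ℤ):ℝ) * deriv f x := deriv_const_mul _ hd
      rw [e2]; rw [e1] at hx; push_cast; linarith)
    refine this.congr fun n => ?_
    have e3 : ∑ k ∈ Finset.range n, e (((-h : ℤ):ℝ) * f (nthPrime k))
        = (starRingEnd ℂ) (∑ k ∈ Finset.range n, e ((h:ℝ) * f (nthPrime k))) := by
      rw [map_sum]
      refine Finset.sum_congr rfl fun k _ => ?_
      rw [← e_neg]; congr 1; push_cast; ring
    rw [e3, RCLike.norm_conj]

/-- the unit circle -/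
abbrev UC := AddCircle (1 : ℝ)

/-- empirical measure -/
def emp (a : ℕ → ℝ) (N : ℕ) : Measure UC :=
  ((N : ENNReal) + 1)⁻¹ • ∑ k ∈ Finset.range (N + 1), Measure.dirac ((a k : ℝ) : UC)

lemma emp_apply (a : ℕ → ℝ) (N : ℕ) {S : Set UC} (hS : MeasurableSet S) [DecidablePred (fun k => ((a k : ℝ) : UC) ∈ S)] :
    emp a N S = ((N : ENNReal) + 1)⁻¹ * ((Finset.range (N+1)).filter (fun k => ((a k : ℝ) : UC) ∈ S)).card := by
  rw [emp, Measure.smul_apply, Measure.finsetSum_apply, smul_eq_mul]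
  congr 1
  rw [Finset.card_filter]
  push_cast
  refine Finset.sum_congr rfl fun k _ => ?_
  rw [Measure.dirac_apply' _ hS, Set.indicator_apply]; rfl

instance (a : ℕ → ℝ) (N : ℕ) : IsProbabilityMeasure (emp a N) := by
  classical
  constructor
  rw [emp_apply a N MeasurableSet.univ]
  simp
  rw [ENNReal.inv_mul_cancel]
  · simp
  · exact ENNReal.add_ne_top.2 ⟨ENNReal.natCast_ne_top N, ENNReal.one_ne_top⟩

lemma emp_integral (a : ℕ → ℝ) (N : ℕ) (g : C(UC, ℂ)) :
    ∫ z, g z ∂(emp a N) = (∑ k ∈ Finset.range (N+1), g (a k)) / ((N+1 : ℕ):ℂ) := by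
  rw [emp, integral_smul_measure, integral_finsetSum_measure]
  · simp only [integral_dirac]
    have : ((N : ENNReal) + 1)⁻¹.toReal = (((N+1:ℕ)):ℝ)⁻¹ := by
      rw [ENNReal.toReal_inv, ENNReal.toReal_add (ENNReal.natCast_ne_top N) ENNReal.one_ne_top]; simp
    rw [this, Complex.real_smul, div_eq_inv_mul]
    push_cast; rfl
  · intro i _
    exact Integrable.of_bound (C := ‖g‖) g.continuous.aestronglyMeasurable (Eventually.of_forall fun z => g.norm_coe_le_norm z)

lemma int_C (μ : Measure UC) [IsProbabilityMeasure μ] (g : C(UC, ℂ)) : Integrable (fun z => g z) μ :=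
  Integrable.of_bound (C := ‖g‖) g.continuous.aestronglyMeasurable (Eventually.of_forall fun z => g.norm_coe_le_norm z)

lemma int_diff (μ : Measure UC) [IsProbabilityMeasure μ] (g g' : C(UC, ℂ)) :
    dist (∫ z, g z ∂μ) (∫ z, g' z ∂μ) ≤ dist g g' := by
  rw [dist_eq_norm, dist_eq_norm, ← integral_sub (int_C μ g) (int_C μ g')]
  have := norm_integral_le_of_norm_le_const (μ := μ) (f := fun z => g z - g' z) (C := ‖g - g'‖)
    (Eventually.of_forall fun z => (g - g').norm_coe_le_norm z)
  simpa using this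

lemma fourier_int (n : ℤ) (hn : n ≠ 0) : ∫ z : UC, fourier n z ∂AddCircle.haarAddCircle = 0 :=
  integral_eq_zero_of_add_right_eq_neg (μ := AddCircle.haarAddCircle)
      (fourier_add_half_inv_index hn one_pos)

lemma weyl_cont {a : ℕ → ℝ}
    (ha : ∀ h : ℤ, h ≠ 0 → Tendsto (fun n : ℕ => ‖∑ k ∈ Finset.range n, e (h * a k)‖ / n) atTop (𝓝 0))
    (g : C(UC, ℂ)) :
    Tendsto (fun N => ∫ z, g z ∂(emp a N)) atTop (𝓝 (∫ z, g z ∂AddCircle.haarAddCircle)) := by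
  have hspan : ∀ g ∈ Submodule.span ℂ (Set.range (@fourier (1:ℝ))),
      Tendsto (fun N => ∫ z, g z ∂(emp a N)) atTop (𝓝 (∫ z, g z ∂AddCircle.haarAddCircle)) := by
    intro g hg
    induction hg using Submodule.span_induction with
    | mem x hx =>
      obtain ⟨n, rfl⟩ := hx
      by_cases hn : n = 0
      · subst hn
        simp
      · rw [fourier_int n hn, tendsto_zero_iff_norm_tendsto_zero]
        refine ((tendsto_add_atTop_iff_nat 1).2 (ha n hn)).congr fun N => ?_
        rw [emp_integral, norm_div, Complex.norm_natCast]
        congr 2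
        refine Finset.sum_congr rfl fun k _ => ?_
        rw [fourier_coe_apply, e]; congr 1; push_cast; ring
    | zero => simp
    | add x y _ _ hx hy =>
      have := hx.add hy
      simp only [ContinuousMap.add_apply]
      rw [integral_add (int_C _ x) (int_C _ y)]
      refine this.congr fun N => ?_
      rw [integral_add (int_C _ x) (int_C _ y)]
    | smul c x _ hx =>
      have := hx.const_mul c
      simp only [ContinuousMap.smul_apply, smul_eq_mul, integral_const_mul]
      exact this
  have hmem : g ∈ closure (Submodule.span ℂ (Set.range (@fourier (1:ℝ))) : Set C(UC, ℂ)) := by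
    rw [← Submodule.topologicalClosure_coe, span_fourier_closure_eq_top]; trivial
  rw [Metric.tendsto_atTop]
  intro ε hε
  obtain ⟨g', hg', hd⟩ := Metric.mem_closure_iff.1 hmem (ε/3) (by positivity)
  obtain ⟨N0, hN0⟩ := Metric.tendsto_atTop.1 (hspan g' hg') (ε/3) (by positivity)
  refine ⟨N0, fun N hN => ?_⟩
  have h1 := int_diff (emp a N) g g'
  have h2 := int_diff AddCircle.haarAddCircle g g'
  have h3 := hN0 N hN
  rw [dist_comm] at h2
  have := dist_triangle4 (∫ z, g z ∂(emp a N)) (∫ z, g' z ∂(emp a N)) (∫ z, g' z ∂AddCircle.haarAddCircle) (∫ z, g z ∂AddCircle.haarAddCircle)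
  linarith

lemma haar_eq : (AddCircle.haarAddCircle : Measure UC) = volume := by
  rw [AddCircle.volume_eq_smul_haarAddCircle]; simp

/-- arc -/
def arc (α β : ℝ) : Set UC := {z | ∃ x ∈ Set.Icc α β ∩ Set.Ico 0 1, ((x : ℝ) : UC) = z}

lemma mem_arc (α β x : ℝ) : ((x : ℝ) : UC) ∈ arc α β ↔ Int.fract x ∈ Set.Icc α β := by
  constructor
  · rintro ⟨y, ⟨hy1, hy2⟩, hy⟩
    rw [← AddCircle.coe_fract x] at hy
    rw [AddCircle.coe_eq_coe_iff_of_mem_Ico (a := 0) (by simpa using hy2)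
      ⟨Int.fract_nonneg x, by simpa using Int.fract_lt_one x⟩] at hy
    rwa [← hy]
  · intro h
    exact ⟨Int.fract x, ⟨h, Int.fract_nonneg x, Int.fract_lt_one x⟩, AddCircle.coe_fract x⟩

lemma arc_meas (α β : ℝ) : MeasurableSet (arc α β) := by
  have : arc α β = (AddCircle.measurableEquivIco (1:ℝ) 0) ⁻¹' {y | (y : ℝ) ∈ Set.Icc α β} := by
    ext z
    obtain ⟨x, rfl⟩ := QuotientAddGroup.mk_surjective z
    refine (mem_arc α β x).trans ?_
    have := AddCircle.coe_equivIco_mk_apply (1:ℝ) x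
    rw [div_one, mul_one] at this
    rw [← this]; rfl
  rw [this]
  exact (AddCircle.measurableEquivIco (1:ℝ) 0).measurable (measurable_subtype_coe measurableSet_Icc)

lemma arc_vol {α β : ℝ} (h0 : 0 ≤ α) (h1 : α ≤ β) (h2 : β ≤ 1) :
    (volume : Measure UC) (arc α β) = ENNReal.ofReal (β - α) := by
  rw [AddCircle.add_projection_respects_measure 1 0 (arc_meas α β), ← Real.volume_Icc]
  refine measure_congr ?_
  have hne : ∀ c : ℝ, ∀ᵐ x : ℝ, x ≠ c := fun c => by
    simp [ae_iff]
  filter_upwards [hne 0, hne 1] with x hx0 hx1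
  refine propext ?_
  change ((x:UC) ∈ arc α β ∧ x ∈ Set.Ioc 0 (0+1)) ↔ x ∈ Set.Icc α β
  rw [mem_arc]
  constructor
  · rintro ⟨h3, h4, h5⟩
    rw [zero_add] at h5
    rwa [Int.fract_eq_self.2 ⟨h4.le, lt_of_le_of_ne h5 hx1⟩] at h3
  · rintro ⟨h3, h4⟩
    have h5 : 0 < x := lt_of_le_of_ne (h0.trans h3) (Ne.symm hx0)
    have h6 : x < 1 := lt_of_le_of_ne (h4.trans h2) hx1
    rw [Int.fract_eq_self.2 ⟨h5.le, h6⟩]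
    exact ⟨⟨h3, h4⟩, h5, by linarith⟩

lemma singleton_vol (c : UC) : (volume : Measure UC) {c} = 0 := by
  rw [AddCircle.add_projection_respects_measure 1 0 (measurableSet_singleton c)]
  refine Set.Countable.measure_zero (Set.Countable.mono Set.inter_subset_left ?_) _
  obtain ⟨x, rfl⟩ := QuotientAddGroup.mk_surjective c
  refine Set.Countable.mono ?_ (Set.countable_range (fun n : ℤ => x + n))
  intro y hy
  have hy : ((y : ℝ) : UC) = (x : ℝ) := hy
  have h2 : ((y - x : ℝ) : UC) = 0 := by rw [AddCircle.coe_sub, hy, sub_self]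
  obtain ⟨n, hn⟩ := (AddCircle.coe_eq_zero_iff (1:ℝ)).1 h2
  refine ⟨n, ?_⟩
  simp only [zsmul_eq_mul, mul_one] at hn
  simp only; linarith

lemma arc_frontier {α β : ℝ} (h0 : 0 ≤ α) (h2 : β ≤ 1) :
    (volume : Measure UC) (frontier (arc α β)) = 0 := by
  have hcl : closure (arc α β) ⊆ (fun x : ℝ => (x : UC)) '' Set.Icc α β := by
    refine closure_minimal ?_ (isCompact_Icc.image (AddCircle.continuous_mk' 1)).isClosed
    rintro _ ⟨x, hx, rfl⟩
    exact ⟨x, hx.1, rfl⟩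
  have hintg : (fun x : ℝ => (x : UC)) '' Set.Ioo α β ⊆ interior (arc α β) := by
    refine interior_maximal ?_ (QuotientAddGroup.isOpenMap_coe _ isOpen_Ioo)
    rintro _ ⟨x, hx, rfl⟩
    exact ⟨x, ⟨Set.Ioo_subset_Icc_self hx, h0.trans hx.1.le, hx.2.trans_le h2⟩, rfl⟩
  have : frontier (arc α β) ⊆ {((α:ℝ):UC)} ∪ {((β:ℝ):UC)} := by
    rintro z ⟨hz1, hz2⟩
    obtain ⟨x, hx, rfl⟩ := hcl hz1
    by_cases h3 : x = α
    · left; simp [h3]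
    by_cases h4 : x = β
    · right; simp [h4]
    exact absurd (hintg ⟨x, ⟨lt_of_le_of_ne hx.1 (Ne.symm h3), lt_of_le_of_ne hx.2 h4⟩, rfl⟩) hz2
  refine measure_mono_null this (measure_union_null (singleton_vol _) (singleton_vol _))

theorem weyl {a : ℕ → ℝ}
    (ha : ∀ h : ℤ, h ≠ 0 → Tendsto (fun n : ℕ => ‖∑ k ∈ Finset.range n, e (h * a k)‖ / n) atTop (𝓝 0)) :
    UDMod1 a := by
  classical
  intro α β h0 h1 h2
  have hw : Tendsto (β := ProbabilityMeasure UC) (fun N => (⟨emp a N, inferInstance⟩ : ProbabilityMeasure UC)) atTop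
      (𝓝 (⟨AddCircle.haarAddCircle, inferInstance⟩ : ProbabilityMeasure UC)) := by
    refine (ProbabilityMeasure.tendsto_iff_forall_integral_rclike_tendsto ℂ).2 ?_
    intro g
    exact weyl_cont ha g.toContinuousMap
  have hlim := ProbabilityMeasure.tendsto_measure_of_null_frontier_of_tendsto' hw (E := arc α β)
    (by simpa [haar_eq] using arc_frontier h0 h2)
  have hlim2 := (ENNReal.tendsto_toReal (by simp)).comp hlim
  rw [← tendsto_add_atTop_iff_nat 1]
  have e1 : ((AddCircle.haarAddCircle : Measure UC) (arc α β)).toReal = β - α := by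
    rw [haar_eq, arc_vol h0 h1 h2, ENNReal.toReal_ofReal (by linarith)]
  have hlim3 : Tendsto (fun N => (emp a N (arc α β)).toReal) atTop (𝓝 (β - α)) := by
    rw [← e1]; exact hlim2
  refine hlim3.congr fun N => ?_
  rw [emp_apply a N (arc_meas α β), ENNReal.toReal_mul, ENNReal.toReal_inv,
    ENNReal.toReal_add (ENNReal.natCast_ne_top N) ENNReal.one_ne_top]
  simp only [mem_arc, ENNReal.toReal_natCast, ENNReal.toReal_one]
  rw [div_eq_inv_mul]
  push_cast
  congr!

end UDP

/-- If `f` is a subpolynomial function in a Hardy field of type `x^{0+}` with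
`|f(x)/log x| → ∞` and `x·|f'(x)| → ∞`, then `(f(pₙ))ₙ` is u.d. mod 1. -/
theorem uniform_distribution_primes_type_zero
    (H : Subring (Filter.Germ (Filter.atTop : Filter ℝ) ℝ)) (hH : IsHardyField H)
    (f : ℝ → ℝ) (hfH : germAtTop f ∈ H) (hsub : Subpolynomial f)
    (htype : TypeXPow f 0)
    (hlog : Filter.Tendsto (fun x : ℝ => |f x / Real.log x|) Filter.atTop Filter.atTop)
    (hder : Filter.Tendsto (fun x : ℝ => x * |deriv f x|) Filter.atTop Filter.atTop) :
    UDMod1 (fun n : ℕ => f (nthPrime n)) := by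
  obtain ⟨K, hK, hid, hlogK, hfK⟩ := UDP.exists_ext H hH f hfH
  have h0 : Tendsto (fun x => f x / x) atTop (𝓝 0) := by
    have := htype.2
    simpa using this
  exact UDP.weyl (a := fun n : ℕ => f (nthPrime n))
    fun h hh => UDP.harmonic_sum hK hid hlogK hfK h0 hder h hh

end
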